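/- Let Ω, K ⊂ ℝⁿ be convex bodies with nonempty interior and r = r(Ω,K). The function λ ↦ Per_K(Ω ∼ λK)^{1/(n−1)} is concave on [0, r]. -/

import Mathlib

open Pointwise MeasureTheory Set

noncomputable section

/-- The inner parallel body `Ω ∼ λK = {x : x + λK ⊆ Ω}`. -/
def innerPar {n : ℕ} (Ω K : Set (EuclideanSpace ℝ (Fin n))) (l : ℝ) :
    Set (EuclideanSpace ℝ (Fin n)) :=
  {x | ∀ y ∈ K, x + l • y ∈ Ω}

/-- The inradius of `Ω` relative to `K`. -/
def inrad {n : ℕ} (Ω K : Set (EuclideanSpace ℝ (Fin n))) : ℝ :=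
  sSup {l : ℝ | 0 ≤ l ∧ ∃ x, ∀ y ∈ K, x + l • y ∈ Ω}

/-- The anisotropic perimeter of `C` relative to `K`, realized as the anisotropic
Minkowski content `d/dt V_n(C + tK) |_{t=0⁺}`. -/
def aniPer {n : ℕ} (C K : Set (EuclideanSpace ℝ (Fin n))) : ℝ :=
  derivWithin (fun t : ℝ => (volume (C + t • K)).toReal) (Set.Ici (0:ℝ)) 0

/-- The mixed volume `V(C,…,C,K,…,K)` with `i` copies of `K`, extracted as the
`i`-th Taylor coefficient (over `binom n i`) of `t ↦ V_n(C + tK)` at `t = 0⁺`. -/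
def mixedVol {n : ℕ} (i : ℕ) (C K : Set (EuclideanSpace ℝ (Fin n))) : ℝ :=
  iteratedDerivWithin i (fun t : ℝ => (volume (C + t • K)).toReal) (Set.Ici (0:ℝ)) 0
    / (n.choose i * i.factorial)

/-! ### A Perron-type lemma for weighted quadratic forms -/

/-- The Dirichlet form of a weighted symmetric matrix fixing a positive vector. -/
theorem dirichlet_form_eq {J : Type*} [Fintype J] (A : J → J → ℝ) (p a : J → ℝ)
    (hsymm : ∀ j k, A j k = A k j) (ha : ∀ j, 0 < a j)
    (hAa : ∀ j, ∑ k, A j k * a k = p j * a j) (z : J → ℝ) :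
    ∑ j, ∑ k, A j k * a j * a k * (z j / a j - z k / a k) ^ 2 =
      2 * (∑ j, p j * z j ^ 2 - ∑ j, ∑ k, A j k * z j * z k) := by
  have h1 : ∀ j, ∑ k, A j k * a j * a k * (z j / a j) ^ 2 = p j * z j ^ 2 := by
    intro j
    have : ∀ k, A j k * a j * a k * (z j / a j) ^ 2 = (A j k * a k) * (z j ^ 2 / a j) := by
      intro k
      have := (ha j).ne'
      field_simp
    simp_rw [this, ← Finset.sum_mul, hAa]
    have := (ha j).ne'
    field_simp
  have h2 : ∑ j, ∑ k, A j k * a j * a k * (z k / a k) ^ 2 = ∑ j, p j * z j ^ 2 := by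
    rw [Finset.sum_comm]
    refine Finset.sum_congr rfl fun k _ => ?_
    rw [← h1 k]
    refine Finset.sum_congr rfl fun j _ => ?_
    rw [hsymm j k]; ring
  have h3 : ∀ j k, A j k * a j * a k * (z j / a j - z k / a k) ^ 2 =
      A j k * a j * a k * (z j / a j) ^ 2 + A j k * a j * a k * (z k / a k) ^ 2
        - 2 * (A j k * z j * z k) := by
    intro j k
    have := (ha j).ne'
    have := (ha k).ne'
    field_simp
    ring
  simp_rw [h3, Finset.sum_sub_distrib, Finset.sum_add_distrib, h1, h2, ← Finset.mul_sum]
  ring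

theorem eigenvector_nonpos_or_parallel {J : Type*} [Fintype J] (A : J → J → ℝ) (p a : J → ℝ)
    (hsymm : ∀ j k, A j k = A k j) (hp : ∀ j, 0 < p j) (ha : ∀ j, 0 < a j)
    (hoff : ∀ j k, j ≠ k → 0 ≤ A j k)
    (hAa : ∀ j, ∑ k, A j k * a k = p j * a j)
    (hsq : ∀ z : J → ℝ, ∑ j, ∑ k, A j k * z j * z k ≤ ∑ j, (∑ k, A j k * z k) ^ 2 / p j)
    (hconn : ∀ S : Set J, S.Nonempty → Sᶜ.Nonempty → ∃ j ∈ S, ∃ k ∉ S, A j k ≠ 0)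
    (z : J → ℝ) (μ : ℝ) (hz : ∀ j, ∑ k, A j k * z k = μ * p j * z j) :
    μ ≤ 0 ∨ ∃ c, ∀ j, z j = c * a j := by
  by_cases hz0 : z = 0
  · exact Or.inr ⟨0, fun j => by simp [hz0]⟩
  by_cases hμ : μ ≤ 0
  · exact Or.inl hμ
  right
  push Not at hμ
  obtain ⟨j0, hj0⟩ : ∃ j, z j ≠ 0 := by
    by_contra h
    push Not at h
    exact hz0 (funext h)
  have hN : 0 < ∑ j, p j * z j ^ 2 := by
    refine Finset.sum_pos' (fun j _ => by have := hp j; positivity) ⟨j0, Finset.mem_univ _, ?_⟩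
    have := hp j0
    positivity
  have hform : ∑ j, ∑ k, A j k * z j * z k = μ * ∑ j, p j * z j ^ 2 := by
    rw [Finset.mul_sum]
    refine Finset.sum_congr rfl fun j _ => ?_
    have : ∀ k, A j k * z j * z k = (A j k * z k) * z j := fun k => by ring
    simp_rw [this, ← Finset.sum_mul, hz]
    ring
  have hμ1 : 1 ≤ μ := by
    have h := hsq z
    have h2 : ∑ j, (∑ k, A j k * z k) ^ 2 / p j = μ ^ 2 * ∑ j, p j * z j ^ 2 := by
      rw [Finset.mul_sum]
      refine Finset.sum_congr rfl fun j _ => ?_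
      rw [hz]
      have := (hp j).ne'
      field_simp
    rw [hform, h2] at h
    have h3 : μ ≤ μ ^ 2 := le_of_mul_le_mul_right h hN
    nlinarith
  have hD := dirichlet_form_eq A p a hsymm ha hAa z
  have hterm : ∀ j k, 0 ≤ A j k * a j * a k * (z j / a j - z k / a k) ^ 2 := by
    intro j k
    by_cases hjk : j = k
    · simp [hjk]
    · have := hoff j k hjk
      have := ha j
      have := ha k
      positivity
  have hzero : ∑ j, ∑ k, A j k * a j * a k * (z j / a j - z k / a k) ^ 2 = 0 := by
    refine le_antisymm ?_ (Finset.sum_nonneg fun j _ => Finset.sum_nonneg fun k _ => hterm j k)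
    rw [hD, hform]
    nlinarith
  have hall : ∀ j k, A j k * a j * a k * (z j / a j - z k / a k) ^ 2 = 0 := by
    intro j k
    have h1 := (Finset.sum_eq_zero_iff_of_nonneg
      (fun j _ => Finset.sum_nonneg fun k _ => hterm j k)).1 hzero j (Finset.mem_univ _)
    exact (Finset.sum_eq_zero_iff_of_nonneg (fun k _ => hterm j k)).1 h1 k (Finset.mem_univ _)
  refine ⟨z j0 / a j0, fun j => ?_⟩
  by_contra hne
  obtain ⟨i, hi, k, hk, hik⟩ := hconn {i | z i / a i = z j0 / a j0} ⟨j0, rfl⟩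
    ⟨j, fun h => hne (by rw [← (show z j / a j = z j0 / a j0 from h),
      div_mul_cancel₀ _ (ha j).ne'])⟩
  have h := hall i k
  simp only [mem_ofPred_eq] at hi hk
  have h2 : z i / a i - z k / a k = 0 := by
    have := (ha i).ne'
    have := (ha k).ne'
    simpa [hik, (ha i).ne', (ha k).ne'] using h
  exact hk (by linarith)

/-- A weighted symmetric matrix with nonnegative off-diagonal entries and connected support, which
fixes a positive vector `a` and has no eigenvalue in `(0, 1)`, is nonpositive on the orthogonal
complement of `a`. -/
theorem form_nonpos_of_orthogonal {J : Type*} [Fintype J] (A : J → J → ℝ) (p a : J → ℝ)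
    (hsymm : ∀ j k, A j k = A k j) (hp : ∀ j, 0 < p j) (ha : ∀ j, 0 < a j)
    (hoff : ∀ j k, j ≠ k → 0 ≤ A j k)
    (hAa : ∀ j, ∑ k, A j k * a k = p j * a j)
    (hsq : ∀ z : J → ℝ, ∑ j, ∑ k, A j k * z j * z k ≤ ∑ j, (∑ k, A j k * z k) ^ 2 / p j)
    (hconn : ∀ S : Set J, S.Nonempty → Sᶜ.Nonempty → ∃ j ∈ S, ∃ k ∉ S, A j k ≠ 0)
    (z : J → ℝ) (hz : ∑ j, p j * a j * z j = 0) :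
    ∑ j, ∑ k, A j k * z j * z k ≤ 0 := by
  classical
  set s : J → ℝ := fun j => √(p j) with hs
  have hspos : ∀ j, 0 < s j := fun j => Real.sqrt_pos.2 (hp j)
  have hss : ∀ j, s j * s j = p j := fun j => Real.mul_self_sqrt (hp j).le
  let M : Matrix J J ℝ := Matrix.of fun j k => A j k / (s j * s k)
  have hM : M.IsHermitian := by
    ext j k
    simp only [M, Matrix.conjTranspose_apply, star_trivial, Matrix.of_apply]
    rw [hsymm k j, mul_comm (s k)]
  let v := hM.eigenvectorBasis
  have hv : ∀ i j, ∑ k, M j k * v i k = hM.eigenvalues i * v i j := by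
    intro i j
    have := congrFun (hM.mulVec_eigenvectorBasis i) j
    simpa [Matrix.mulVec, dotProduct] using this
  let y : EuclideanSpace ℝ J := WithLp.toLp 2 fun j => s j * z j
  let My : EuclideanSpace ℝ J := WithLp.toLp 2 fun j => ∑ k, M j k * y k
  have hform : ∑ j, ∑ k, A j k * z j * z k = inner ℝ y My := by
    simp only [PiLp.inner_apply, My, y, RCLike.inner_apply, conj_trivial, M, Matrix.of_apply,
      Finset.sum_mul]
    refine Finset.sum_congr rfl fun j _ => Finset.sum_congr rfl fun k _ => ?_
    have := (hspos j).ne'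
    have := (hspos k).ne'
    field_simp
  have hinner : ∀ i, inner ℝ (v i) My = hM.eigenvalues i * inner ℝ (v i) y := by
    intro i
    simp only [PiLp.inner_apply, My, RCLike.inner_apply, conj_trivial, Finset.sum_mul]
    rw [Finset.sum_comm, Finset.mul_sum]
    refine Finset.sum_congr rfl fun k _ => ?_
    rw [mul_left_comm, ← hv i k, Finset.mul_sum]
    refine Finset.sum_congr rfl fun j _ => ?_
    simp only [M, Matrix.of_apply]
    rw [hsymm j k, mul_comm (s j)]; ring
  rw [hform, ← OrthonormalBasis.sum_inner_mul_inner v]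
  refine Finset.sum_nonpos fun i _ => ?_
  rw [hinner, real_inner_comm]
  have hz' : ∀ j, ∑ k, A j k * (v i k / s k) = hM.eigenvalues i * p j * (v i j / s j) := by
    intro j
    have h := hv i j
    have h' : ∑ k, A j k * (v i k / s k) = s j * ∑ k, M j k * v i k := by
      rw [Finset.mul_sum]
      refine Finset.sum_congr rfl fun k _ => ?_
      simp only [M, Matrix.of_apply]
      have := (hspos j).ne'
      have := (hspos k).ne'
      field_simp
    rw [h', h, ← hss j]
    have := (hspos j).ne'
    field_simp
  rcases eigenvector_nonpos_or_parallel A p a hsymm hp ha hoff hAa hsq hconn _ _ hz' with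
    h | ⟨c, hc⟩
  · nlinarith [mul_self_nonneg (inner ℝ (v i) y : ℝ)]
  · have : (inner ℝ (v i) y : ℝ) = 0 := by
      simp only [PiLp.inner_apply, y, RCLike.inner_apply, conj_trivial]
      have h2 : ∀ j, s j * z j * v i j = c * (p j * a j * z j) := by
        intro j
        have h3 : v i j = c * a j * s j := by
          rw [← hc j, div_mul_cancel₀ _ (hspos j).ne']
        rw [h3, ← hss j]; ring
      simp_rw [h2, ← Finset.mul_sum, hz, mul_zero]
    simp [this]

/-- A symmetric bilinear form that is nonpositive on the orthogonal complement of one vector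
satisfies the reversed Cauchy–Schwarz inequality at every vector of positive square. -/
theorem reversed_cauchySchwarz {E : Type*} [AddCommGroup E] [Module ℝ E] (Q : E →ₗ[ℝ] E →ₗ[ℝ] ℝ)
    (hsymm : ∀ x y, Q x y = Q y x) (a : E) (hneg : ∀ z, Q z a = 0 → Q z z ≤ 0)
    (h : E) (hh : 0 < Q h h) (x : E) : Q x x * Q h h ≤ Q x h ^ 2 := by
  by_contra hcon
  push Not at hcon
  have hz := hneg (Q h a • x - Q x a • h) (by simp; ring)
  simp only [map_sub, map_smul, LinearMap.sub_apply, LinearMap.smul_apply, smul_eq_mul] at hz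
  rw [hsymm h x] at hz
  have hne : Q h a ≠ 0 := fun h0 => absurd (hneg h h0) (not_le.2 hh)
  have h2 : 0 < Q h a ^ 2 := by positivity
  nlinarith [mul_pos h2 (sub_pos.2 hcon), sq_nonneg (Q h a * Q x h - Q x a * Q h h),
    mul_nonneg hh.le (neg_nonneg.2 hz)]

/-! ### Mixed derivatives of polynomials -/

theorem pderiv_pderiv_comm {ι : Type*} (i j : ι) (q : MvPolynomial ι ℝ) :
    MvPolynomial.pderiv i (MvPolynomial.pderiv j q) =
      MvPolynomial.pderiv j (MvPolynomial.pderiv i q) := by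
  classical
  have h : ⁅(MvPolynomial.pderiv i : Derivation ℝ (MvPolynomial ι ℝ) (MvPolynomial ι ℝ)),
      (MvPolynomial.pderiv j : Derivation ℝ (MvPolynomial ι ℝ) (MvPolynomial ι ℝ))⁆ = 0 := by
    refine MvPolynomial.derivation_ext fun k => ?_
    rw [Derivation.commutator_apply, MvPolynomial.pderiv_X, MvPolynomial.pderiv_X]
    simp only [Pi.single_apply]
    split_ifs <;> simp
  have h2 := congrArg (fun D => D q) h
  simp only [Derivation.commutator_apply, Derivation.coe_zero, Pi.zero_apply] at h2
  exact sub_eq_zero.1 h2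

theorem sum_eq_sum_subtype {ι : Type*} [Fintype ι] (p : ι → Prop) [Fintype {j // p j}]
    (f : ι → ℝ) (hf : ∀ j, ¬ p j → f j = 0) : ∑ j, f j = ∑ j : {j // p j}, f j := by
  classical
  rw [← Finset.sum_subtype (Finset.univ.filter p) (by simp)]
  exact (Finset.sum_filter_of_ne fun j _ h => by_contra fun h' => h (hf j h')).symm

section Mixed

variable {ι : Type*} [Fintype ι]

/-- The derivative of polynomials in the constant direction `z`. -/
def dirD (z : ι → ℝ) : MvPolynomial ι ℝ →ₗ[ℝ] MvPolynomial ι ℝ :=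
  ∑ i, z i • (MvPolynomial.pderiv i).toLinearMap

theorem dirD_apply (z : ι → ℝ) (q : MvPolynomial ι ℝ) :
    dirD z q = ∑ i, z i • MvPolynomial.pderiv i q := by
  simp [dirD]

theorem dirD_add (x y : ι → ℝ) (q : MvPolynomial ι ℝ) : dirD (x + y) q = dirD x q + dirD y q := by
  simp [dirD_apply, add_smul, Finset.sum_add_distrib]

theorem dirD_smul (c : ℝ) (x : ι → ℝ) (q : MvPolynomial ι ℝ) :
    dirD (c • x) q = c • dirD x q := by
  simp [dirD_apply, mul_smul, Finset.smul_sum]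

theorem dirD_sub (x y : ι → ℝ) (q : MvPolynomial ι ℝ) : dirD (x - y) q = dirD x q - dirD y q := by
  simp [dirD_apply, sub_smul, Finset.sum_sub_distrib]

theorem dirD_single [DecidableEq ι] (i : ι) (q : MvPolynomial ι ℝ) :
    dirD (Pi.single i 1) q = MvPolynomial.pderiv i q := by
  rw [dirD_apply, Finset.sum_eq_single i] <;> simp +contextual

theorem dirD_comm (x y : ι → ℝ) (q : MvPolynomial ι ℝ) :
    dirD x (dirD y q) = dirD y (dirD x q) := by
  simp only [dirD_apply, map_sum, map_smul, Finset.smul_sum]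
  rw [Finset.sum_comm]
  refine Finset.sum_congr rfl fun i _ => Finset.sum_congr rfl fun j _ => ?_
  rw [pderiv_pderiv_comm, smul_comm]

theorem dirD_isHomogeneous {q : MvPolynomial ι ℝ} {m : ℕ} (hq : q.IsHomogeneous m)
    (z : ι → ℝ) : (dirD z q).IsHomogeneous (m - 1) := by
  rw [dirD_apply]
  refine MvPolynomial.IsHomogeneous.sum _ _ _ fun i _ => ?_
  rw [MvPolynomial.smul_eq_C_mul]
  simpa using (MvPolynomial.isHomogeneous_C ι (z i)).mul hq.pderiv

/-- The value at the origin of the iterated derivative of `q` along a list of directions. -/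
def mix (q : MvPolynomial ι ℝ) : List (ι → ℝ) → ℝ
  | [] => MvPolynomial.constantCoeff q
  | z :: l => mix (dirD z q) l

@[simp] theorem mix_nil (q : MvPolynomial ι ℝ) : mix q [] = MvPolynomial.constantCoeff q := rfl

theorem mix_cons (q : MvPolynomial ι ℝ) (z : ι → ℝ) (l : List (ι → ℝ)) :
    mix q (z :: l) = mix (dirD z q) l := rfl

/-- `mix` as a linear map in the polynomial. -/
def mixₗ (l : List (ι → ℝ)) : MvPolynomial ι ℝ →ₗ[ℝ] ℝ where
  toFun q := mix q l
  map_add' p q := by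
    induction l generalizing p q with
    | nil => simp
    | cons z l ih => simp only [mix_cons, map_add]; exact ih _ _
  map_smul' c q := by
    induction l generalizing q with
    | nil => simp
    | cons z l ih => simp only [mix_cons, map_smul]; exact ih _

theorem mixₗ_apply (l : List (ι → ℝ)) (q : MvPolynomial ι ℝ) : mixₗ l q = mix q l := rfl

theorem mix_perm {l l' : List (ι → ℝ)} (h : l.Perm l') (q : MvPolynomial ι ℝ) :
    mix q l = mix q l' := by
  induction h generalizing q with
  | nil => rfl
  | cons z _ ih => exact ih _
  | swap x y l => simp only [mix_cons, dirD_comm]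
  | trans _ _ h1 h2 => rw [h1, h2]

theorem mix_zero (l : List (ι → ℝ)) : mix (0 : MvPolynomial ι ℝ) l = 0 := (mixₗ l).map_zero

theorem mix_swap (q : MvPolynomial ι ℝ) (x y : ι → ℝ) (l : List (ι → ℝ)) :
    mix q (x :: y :: l) = mix q (y :: x :: l) := mix_perm (List.Perm.swap _ _ _) q

theorem mix_cons_eq_sum (q : MvPolynomial ι ℝ) (z : ι → ℝ) (l : List (ι → ℝ)) :
    mix q (z :: l) = ∑ i, z i * mix (MvPolynomial.pderiv i q) l := by
  rw [mix_cons, dirD_apply, ← mixₗ_apply, map_sum]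
  simp [mixₗ_apply]

/-- The symmetric bilinear form obtained from `mix` by fixing all but two directions. -/
def mixForm (q : MvPolynomial ι ℝ) (l : List (ι → ℝ)) :
    (ι → ℝ) →ₗ[ℝ] (ι → ℝ) →ₗ[ℝ] ℝ :=
  LinearMap.mk₂ ℝ (fun x y => mix q (x :: y :: l))
    (fun x x' y => by simp only [mix_cons, dirD_add, map_add]; exact (mixₗ l).map_add _ _)
    (fun c x y => by simp only [mix_cons, dirD_smul, map_smul]; exact (mixₗ l).map_smul _ _)
    (fun x y y' => by simp only [mix_cons, dirD_add]; exact (mixₗ l).map_add _ _)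
    (fun c x y => by simp only [mix_cons, dirD_smul]; exact (mixₗ l).map_smul _ _)

theorem mixForm_apply (q : MvPolynomial ι ℝ) (l : List (ι → ℝ)) (x y : ι → ℝ) :
    mixForm q l x y = mix q (x :: y :: l) := rfl

theorem mixForm_comm (q : MvPolynomial ι ℝ) (l : List (ι → ℝ)) (x y : ι → ℝ) :
    mixForm q l x y = mixForm q l y x := mix_swap q x y l

theorem dirD_pderiv (x : ι → ℝ) (i : ι) (q : MvPolynomial ι ℝ) :
    dirD x (MvPolynomial.pderiv i q) = MvPolynomial.pderiv i (dirD x q) := by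
  classical
  rw [← dirD_single, ← dirD_single, dirD_comm]

end Mixed

/-! ### An abstract Alexandrov–Fenchel inequality -/

/-- The combinatorial and analytic data shared by the volume polynomials of the faces of a simple
polytope: `Δ` is the set of faces, `T` the cone of support vectors, and `G I` the volume polynomial
of the face `I`. -/
structure FacePolynomials {ι : Type*} [Fintype ι] [DecidableEq ι] (n : ℕ) (T : Set (ι → ℝ))
    (Δ : Finset ι → Prop) (G : Finset ι → MvPolynomial ι ℝ) : Prop where
  pderiv_eq : ∀ I, ∀ j ∉ I, MvPolynomial.pderiv j (G I) = G (insert j I)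
  eq_zero : ∀ I, ¬ Δ I → G I = 0
  exists_lt : ∀ I, Δ I → ∀ h ∈ T, ∃ v, dirD v (G I) = 0 ∧ (∀ i ∈ I, v i = h i) ∧ ∀ j ∉ I, v j < h j
  exists_eq : ∀ I, Δ I → ∀ h : ι → ℝ, ∃ v, dirD v (G I) = 0 ∧ ∀ i ∈ I, v i = h i
  const_pos : ∀ I, Δ I → I.card = n → 0 < MvPolynomial.constantCoeff (G I)
  extend : ∀ I, Δ I → I.card < n → ∃ j ∉ I, Δ (insert j I)
  minkowski : ∀ I m, Δ I → I.card + m + 2 = n → ∀ h ∈ T, ∀ x,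
    mix (G I) (x :: x :: List.replicate m h) * mix (G I) (h :: h :: List.replicate m h) ≤
      mix (G I) (x :: h :: List.replicate m h) ^ 2

namespace FacePolynomials

variable {ι : Type*} [Fintype ι] [DecidableEq ι] {n : ℕ} {T : Set (ι → ℝ)}
  {Δ : Finset ι → Prop} {G : Finset ι → MvPolynomial ι ℝ}

theorem exists_pos_rep (F : FacePolynomials n T Δ G) {I : Finset ι} (hI : Δ I) {h : ι → ℝ}
    (hh : h ∈ T) : ∃ a : ι → ℝ, (∀ i ∈ I, a i = 0) ∧ (∀ i ∉ I, 0 < a i) ∧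
      dirD a (G I) = dirD h (G I) := by
  obtain ⟨v, hv, hvI, hvlt⟩ := F.exists_lt I hI h hh
  refine ⟨h - v, fun i hi => by simp [hvI i hi], fun i hi => by simpa using hvlt i hi, ?_⟩
  rw [dirD_sub, hv, sub_zero]

theorem exists_rep (F : FacePolynomials n T Δ G) {I : Finset ι} (hI : Δ I) (h : ι → ℝ) :
    ∃ a : ι → ℝ, (∀ i ∈ I, a i = 0) ∧ dirD a (G I) = dirD h (G I) := by
  obtain ⟨v, hv, hvI⟩ := F.exists_eq I hI h
  refine ⟨h - v, fun i hi => by simp [hvI i hi], ?_⟩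
  rw [dirD_sub, hv, sub_zero]

theorem mix_nonneg_of_pos {I : Finset ι} (F : FacePolynomials n T Δ G) (l : List (ι → ℝ))
    (h : Δ I → 0 < mix (G I) l) : 0 ≤ mix (G I) l := by
  by_cases hI : Δ I
  · exact (h hI).le
  · rw [F.eq_zero I hI, mix_zero]

theorem mix_pos (F : FacePolynomials n T Δ G) (l : List (ι → ℝ)) (hl : ∀ h ∈ l, h ∈ T) :
    ∀ I, Δ I → I.card + l.length = n → 0 < mix (G I) l := by
  induction l with
  | nil => exact fun I hI hn => F.const_pos I hI (by simpa using hn)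
  | cons h l ih =>
    intro I hI hn
    simp only [List.mem_cons, forall_eq_or_imp, List.length_cons] at hl hn
    have ih := ih hl.2
    obtain ⟨a, ha0, hapos, ha⟩ := F.exists_pos_rep hI hl.1
    rw [mix_cons, ← ha, ← mix_cons, mix_cons_eq_sum]
    have key : ∀ i ∉ I, Δ (insert i I) → 0 < mix (G (insert i I)) l := fun i hi hΔ =>
      ih _ hΔ (by rw [Finset.card_insert_of_notMem hi]; omega)
    obtain ⟨j, hj, hjΔ⟩ := F.extend I hI (by omega)
    refine Finset.sum_pos' (fun i _ => ?_) ⟨j, Finset.mem_univ _, ?_⟩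
    · by_cases hi : i ∈ I
      · simp [ha0 i hi]
      · rw [F.pderiv_eq I i hi]
        exact mul_nonneg (hapos i hi).le (F.mix_nonneg_of_pos l (key i hi))
    · rw [F.pderiv_eq I j hj]
      exact mul_pos (hapos j hj) (key j hj hjΔ)

/-- The Alexandrov–Fenchel inequality for a system of face polynomials. -/
theorem alexandrov_fenchel (F : FacePolynomials n T Δ G) (l : List (ι → ℝ))
    (hl : ∀ h ∈ l, h ∈ T) : ∀ I, Δ I → I.card + l.length + 2 = n → ∀ h ∈ T, ∀ x,
      mix (G I) (x :: x :: l) * mix (G I) (h :: h :: l) ≤ mix (G I) (x :: h :: l) ^ 2 := by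
  classical
  induction l with
  | nil => exact fun I hI hn h hh x => by simpa using F.minkowski I 0 hI (by simpa using hn) h hh x
  | cons g l ih =>
    intro I hI hn h hh x
    have hgT : g ∈ T := hl g (by simp)
    have hlT : ∀ h ∈ l, h ∈ T := fun h hh => hl h (by simp [hh])
    have ih := ih hlT
    simp only [List.length_cons] at hn
    obtain ⟨a, ha0, hapos, ha⟩ := F.exists_pos_rep hI hgT
    -- The matrix below is indexed by the neighbours of `I`.
    let J : Type _ := {j : ι // j ∉ I ∧ Δ (insert j I)}
    have hG0 : ∀ j ∉ I, ¬ (j ∉ I ∧ Δ (insert j I)) → MvPolynomial.pderiv j (G I) = 0 := by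
      intro j hj h
      rw [F.pderiv_eq I j hj]
      exact F.eq_zero _ fun h' => h ⟨hj, h'⟩
    have hG : ∀ j : J, MvPolynomial.pderiv j.1 (G I) = G (insert j.1 I) := fun j =>
      F.pderiv_eq I j.1 j.2.1
    have hexp : ∀ y : ι → ℝ, (∀ i ∈ I, y i = 0) → ∀ l', mix (G I) (y :: l') =
        ∑ j : J, y j.1 * mix (G (insert j.1 I)) l' := by
      intro y hy l'
      rw [mix_cons_eq_sum, sum_eq_sum_subtype fun j => j ∉ I ∧ Δ (insert j I)]
      · exact Finset.sum_congr rfl fun j _ => by rw [hG j]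
      · intro j hj
        by_cases hjI : j ∈ I
        · rw [hy j hjI, zero_mul]
        · rw [hG0 j hjI hj, mix_zero, mul_zero]
    let A : J → J → ℝ := fun j k =>
      mix (MvPolynomial.pderiv k.1 (MvPolynomial.pderiv j.1 (G I))) (g :: l)
    have hexpA : ∀ y : ι → ℝ, (∀ i ∈ I, y i = 0) → ∀ j : J,
        ∑ k, A j k * y k.1 = mix (G (insert j.1 I)) (y :: g :: l) := by
      intro y hy j
      rw [mix_cons_eq_sum, sum_eq_sum_subtype fun j => j ∉ I ∧ Δ (insert j I)]
      · exact Finset.sum_congr rfl fun k _ => by rw [mul_comm, ← hG j]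
      · intro k hk
        by_cases hkI : k ∈ I
        · rw [hy k hkI, zero_mul]
        · rw [← hG j, pderiv_pderiv_comm, hG0 k hkI hk, map_zero, mix_zero, mul_zero]
    have hcard : ∀ j : J, (insert j.1 I).card = I.card + 1 := fun j =>
      Finset.card_insert_of_notMem j.2.1
    have haG : ∀ j : J, dirD a (G (insert j.1 I)) = dirD g (G (insert j.1 I)) := by
      intro j
      rw [← hG j, dirD_pderiv, ha, dirD_pderiv]
    let b : J → ℝ := fun j => mix (G (insert j.1 I)) (g :: g :: l)
    have hb : ∀ j, 0 < b j := fun j => F.mix_pos _ (by simpa [hgT] using hlT) _ j.2.2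
      (by rw [hcard]; simp; omega)
    have haJ : ∀ j : J, 0 < a j.1 := fun j => hapos j.1 j.2.1
    have hAa : ∀ j, ∑ k, A j k * a k.1 = b j / a j.1 * a j.1 := by
      intro j
      rw [hexpA a ha0, mix_cons, haG, div_mul_cancel₀ _ (haJ j).ne']
      rfl
    have hsymm : ∀ j k, A j k = A k j := fun j k => by simp only [A]; rw [pderiv_pderiv_comm]
    have hp : ∀ j : J, 0 < b j / a j.1 := fun j => div_pos (hb j) (haJ j)
    have hAjk : ∀ j k : J, j ≠ k → MvPolynomial.pderiv k.1 (MvPolynomial.pderiv j.1 (G I)) =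
        G (insert k.1 (insert j.1 I)) ∧ (insert k.1 (insert j.1 I)).card = I.card + 2 := by
      intro j k hjk
      have hk : k.1 ∉ insert j.1 I := by
        simp only [Finset.mem_insert, not_or]
        exact ⟨fun h => hjk (Subtype.ext h.symm), k.2.1⟩
      exact ⟨by rw [hG j, F.pderiv_eq _ _ hk], by rw [Finset.card_insert_of_notMem hk, hcard]⟩
    have hoff : ∀ j k, j ≠ k → 0 ≤ A j k := by
      intro j k hjk
      simp only [A]
      rw [(hAjk j k hjk).1]
      exact F.mix_nonneg_of_pos _ fun hΔ => F.mix_pos _ hl _ hΔ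
        (by rw [(hAjk j k hjk).2]; simp; omega)
    let ext : (J → ℝ) → ι → ℝ := fun z i => if h : i ∉ I ∧ Δ (insert i I) then z ⟨i, h⟩ else 0
    have hextJ : ∀ z (j : J), ext z j.1 = z j := fun z j => dif_pos j.2
    have hextI : ∀ z, ∀ i ∈ I, ext z i = 0 := fun z i hi => dif_neg fun h => h.1 hi
    have hform : ∀ y : ι → ℝ, (∀ i ∈ I, y i = 0) →
        mix (G I) (y :: y :: g :: l) = ∑ j, ∑ k, A j k * y j.1 * y k.1 := by
      intro y hy
      rw [hexp y hy]
      refine Finset.sum_congr rfl fun j _ => ?_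
      rw [← hexpA y hy, Finset.mul_sum]
      exact Finset.sum_congr rfl fun k _ => by ring
    have hsq : ∀ z : J → ℝ, ∑ j, ∑ k, A j k * z j * z k ≤
        ∑ j, (∑ k, A j k * z k) ^ 2 / (b j / a j.1) := by
      intro z
      have h1 := hform (ext z) (hextI z)
      simp only [hextJ] at h1
      have hperm : (ext z :: ext z :: g :: l).Perm (g :: ext z :: ext z :: l) :=
        ((List.Perm.swap _ _ _).cons _).trans (List.Perm.swap _ _ _)
      rw [← h1, mix_perm hperm, mix_cons, ← ha, ← mix_cons, hexp a ha0]
      refine Finset.sum_le_sum fun j _ => ?_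
      have h2 := hexpA (ext z) (hextI z) j
      simp only [hextJ] at h2
      rw [h2, div_div_eq_mul_div, le_div_iff₀ (hb j)]
      have h3 := ih (insert j.1 I) j.2.2 (by rw [hcard]; omega) g hgT (ext z)
      have := mul_le_mul_of_nonneg_right h3 (haJ j).le
      simp only [b]
      linarith
    have hconn : ∀ S : Set J, S.Nonempty → Sᶜ.Nonempty → ∃ j ∈ S, ∃ k ∉ S, A j k ≠ 0 := by
      intro S ⟨j0, hj0⟩ ⟨k0, hk0⟩
      by_contra hcon
      push Not at hcon
      let m := l.length + 1
      have hzero : ∀ j ∈ S, ∀ k ∉ S,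
          MvPolynomial.pderiv k.1 (MvPolynomial.pderiv j.1 (G I)) = 0 := by
        intro j hj k hk
        have hjk : j ≠ k := fun h => hk (h ▸ hj)
        rw [(hAjk j k hjk).1]
        refine F.eq_zero _ fun hΔ => ?_
        have h1 := F.mix_pos _ hl _ hΔ (by rw [(hAjk j k hjk).2]; simp; omega)
        rw [← (hAjk j k hjk).1] at h1
        exact h1.ne' (hcon j hj k hk)
      let zS : J → ℝ := fun j => if j ∈ S then a j.1 else 0
      let zC : J → ℝ := fun j => if j ∈ S then 0 else a j.1
      let L := List.replicate m g
      have hL : ∀ h ∈ L, h ∈ T := fun h hh => (List.eq_of_mem_replicate hh) ▸ hgT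
      have hpos : ∀ j : J, 0 < mix (G (insert j.1 I)) (g :: L) := fun j =>
        F.mix_pos _ (by simpa [hgT] using hL) _ j.2.2 (by rw [hcard]; simp [L, m]; omega)
      have hcross : mixForm (G I) L (ext zS) (ext zC) = 0 := by
        rw [mixForm_apply, hexp _ (hextI _)]
        refine Finset.sum_eq_zero fun j _ => ?_
        rw [hextJ]
        by_cases hj : j ∈ S
        · rw [mix_cons_eq_sum]
          rw [Finset.sum_eq_zero, mul_zero]
          intro k _
          by_cases hk : k ∉ I ∧ Δ (insert k I)
          · rw [← hG j, hextJ zC ⟨k, hk⟩]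
            by_cases hkS : (⟨k, hk⟩ : J) ∈ S
            · simp [zC, hkS]
            · rw [hzero j hj ⟨k, hk⟩ hkS, mix_zero, mul_zero]
          · simp [ext, hk]
        · simp [zS, hj]
      have hgsum : ∀ y, mixForm (G I) L y g =
          mixForm (G I) L y (ext zS) + mixForm (G I) L y (ext zC) := by
        intro y
        rw [← map_add, mixForm_comm, mixForm_comm (G I) L y, mixForm_apply, mixForm_apply,
          mix_cons, ← ha, ← mix_cons, hexp a ha0,
          hexp _ (fun i hi => by simp [hextI _ i hi])]
        refine Finset.sum_congr rfl fun j _ => ?_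
        simp only [Pi.add_apply, hextJ]
        by_cases hj : j ∈ S <;> simp [zS, zC, hj]
      have hSpos : 0 < mixForm (G I) L (ext zS) g := by
        rw [mixForm_apply, hexp _ (hextI _)]
        refine Finset.sum_pos' (fun j _ => ?_) ⟨j0, Finset.mem_univ _, ?_⟩
        · rw [hextJ]
          refine mul_nonneg ?_ (hpos j).le
          by_cases hj : j ∈ S <;> simp [zS, hj, (haJ j).le]
        · rw [hextJ]
          refine mul_pos ?_ (hpos j0)
          simp [zS, hj0, haJ j0]
      have hCpos : 0 < mixForm (G I) L (ext zC) g := by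
        rw [mixForm_apply, hexp _ (hextI _)]
        refine Finset.sum_pos' (fun j _ => ?_) ⟨k0, Finset.mem_univ _, ?_⟩
        · rw [hextJ]
          refine mul_nonneg ?_ (hpos j).le
          by_cases hj : j ∈ S <;> simp [zC, hj, (haJ j).le]
        · rw [hextJ]
          refine mul_pos ?_ (hpos k0)
          have : k0 ∉ S := hk0
          simp [zC, this, haJ k0]
      have hmink := F.minkowski I m hI (by simp only [m]; omega) g hgT (ext zS)
      rw [← mixForm_apply, ← mixForm_apply, ← mixForm_apply] at hmink
      change mixForm (G I) L _ _ * mixForm (G I) L _ _ ≤ mixForm (G I) L _ _ ^ 2 at hmink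
      have h1 := hgsum (ext zS)
      rw [hcross, add_zero] at h1
      have h2 := hgsum g
      rw [mixForm_comm _ _ g (ext zS), mixForm_comm _ _ g (ext zC)] at h2
      rw [← h1, h2] at hmink
      nlinarith
    have hneg : ∀ y, mixForm (G I) (g :: l) y g = 0 → mixForm (G I) (g :: l) y y ≤ 0 := by
      intro y hy
      obtain ⟨y', hy'0, hy'⟩ := F.exists_rep hI y
      have h1 : mixForm (G I) (g :: l) y g = ∑ j : J, b j / a j.1 * a j.1 * y' j.1 := by
        rw [mixForm_apply, mix_cons, ← hy', ← mix_cons, hexp y' hy'0]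
        refine Finset.sum_congr rfl fun j _ => ?_
        rw [div_mul_cancel₀ _ (haJ j).ne', mul_comm]
      have h2 : mixForm (G I) (g :: l) y y = ∑ j, ∑ k, A j k * y' j.1 * y' k.1 := by
        rw [← hform y' hy'0, mixForm_apply, mix_cons, ← hy', ← mix_cons, mix_swap, mix_cons, ← hy',
          ← mix_cons]
      rw [h2]
      exact form_nonpos_of_orthogonal A (fun j => b j / a j.1) (fun j => a j.1) hsymm hp haJ hoff
        hAa hsq hconn (fun j => y' j.1) (by rw [← h1, hy])
    exact reversed_cauchySchwarz (mixForm (G I) (g :: l)) (mixForm_comm _ _) g hneg h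
      (F.mix_pos _ (by simp only [List.mem_cons]; rintro _ (rfl | rfl | rfl | h') <;> simp_all) I hI
        (by simp; omega)) x

end FacePolynomials

/-! ### Concavity from the Alexandrov–Fenchel inequality -/

theorem eval_eq_constantCoeff {ι : Type*} {q : MvPolynomial ι ℝ} (hq : q.IsHomogeneous 0)
    (h : ι → ℝ) :
    MvPolynomial.eval h q = MvPolynomial.constantCoeff q := by
  rw [MvPolynomial.totalDegree_eq_zero_iff_eq_C.1
    ((MvPolynomial.totalDegree_zero_iff_isHomogeneous ι).2 hq)]
  simp

section PolynomialCalculus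

variable {ι : Type*} [Fintype ι]

theorem hasDerivAt_eval_line (q : MvPolynomial ι ℝ) (x z : ι → ℝ) (t : ℝ) :
    HasDerivAt (fun t : ℝ => MvPolynomial.eval (x + t • z) q)
      (MvPolynomial.eval (x + t • z) (dirD z q)) t := by
  classical
  induction q using MvPolynomial.induction_on with
  | C a => simpa [dirD_apply] using hasDerivAt_const t a
  | add p q hp hq => simpa [Pi.add_def] using hp.add hq
  | mul_X p i hp =>
    have hX : HasDerivAt (fun t : ℝ => x i + t * z i) (z i) t := by
      simpa using ((hasDerivAt_id t).mul_const (z i)).const_add (x i)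
    have h := hp.mul hX
    have e : MvPolynomial.eval (x + t • z) (dirD z (p * MvPolynomial.X i)) =
        MvPolynomial.eval (x + t • z) (dirD z p) * (x i + t * z i) +
          MvPolynomial.eval (x + t • z) p * z i := by
      simp only [dirD_apply, Derivation.leibniz, MvPolynomial.pderiv_X, smul_add, map_sum,
        Finset.sum_add_distrib, map_add, MvPolynomial.smul_eval, smul_eq_mul, map_mul,
        MvPolynomial.eval_X, Finset.sum_mul]
      rw [add_comm]
      congr 1
      · exact Finset.sum_congr rfl fun j _ => by simp [Pi.add_apply]; ring
      · rw [Finset.sum_eq_single i] <;> simp +contextual [mul_comm]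
    rw [e]
    simpa [Pi.mul_def] using h

theorem eval_dirD_self {q : MvPolynomial ι ℝ} {m : ℕ} (hq : q.IsHomogeneous m) (h : ι → ℝ) :
    MvPolynomial.eval h (dirD h q) = m * MvPolynomial.eval h q := by
  have := congrArg (MvPolynomial.eval h) hq.sum_X_mul_pderiv
  simpa [dirD_apply] using this

theorem mix_replicate {q : MvPolynomial ι ℝ} {m : ℕ} (hq : q.IsHomogeneous m) (h : ι → ℝ) :
    mix q (List.replicate m h) = m.factorial * MvPolynomial.eval h q := by
  induction m generalizing q with
  | zero => simp [eval_eq_constantCoeff hq h]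
  | succ m ih =>
    have h1 := dirD_isHomogeneous hq h
    rw [List.replicate_succ, mix_cons, ih h1, eval_dirD_self hq, Nat.factorial_succ]
    push_cast
    ring

/-- Quasi-concavity of a homogeneous polynomial implies a Minkowski-type quadratic inequality. -/
theorem mix_sq_of_quasiconcave {q : MvPolynomial ι ℝ} {m : ℕ} (hq : q.IsHomogeneous (m + 2))
    {T : Set (ι → ℝ)} (hT : IsOpen T) (hnonneg : ∀ h ∈ T, 0 ≤ MvPolynomial.eval h q)
    (hquasi : ∀ x ∈ T, ∀ y ∈ T, min (MvPolynomial.eval x q) (MvPolynomial.eval y q) ≤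
      MvPolynomial.eval ((1 / 2 : ℝ) • (x + y)) q) {h : ι → ℝ} (hh : h ∈ T) (x : ι → ℝ) :
    mix q (x :: x :: List.replicate m h) * mix q (h :: h :: List.replicate m h) ≤
      mix q (x :: h :: List.replicate m h) ^ 2 := by
  set Q := mixForm q (List.replicate m h) with hQ
  change Q x x * Q h h ≤ Q x h ^ 2
  have hhh : Q h h = (m + 2).factorial * MvPolynomial.eval h q := by
    rw [← mix_replicate hq]; rfl
  have hge : 0 ≤ Q h h := by rw [hhh]; exact mul_nonneg (by positivity) (hnonneg h hh)
  rcases hge.eq_or_lt with h0 | hpos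
  · rw [← h0, mul_zero]; positivity
  refine reversed_cauchySchwarz Q (mixForm_comm _ _) h (fun z hz => ?_) h hpos x
  by_contra hcon
  push Not at hcon
  have h1 : MvPolynomial.eval h (dirD z q) = 0 := by
    have h2 := mix_replicate (dirD_isHomogeneous hq z) h
    have h3 : Q z h = mix (dirD z q) (List.replicate (m + 1) h) := rfl
    have h4 : ((m + 2 - 1).factorial : ℝ) ≠ 0 := by positivity
    rw [show m + 2 - 1 = m + 1 by omega, ← h3, hz] at h2
    simpa [h4, Nat.factorial_ne_zero] using h2.symm
  have h2 : 0 < MvPolynomial.eval h (dirD z (dirD z q)) := by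
    have h2 := mix_replicate (dirD_isHomogeneous (dirD_isHomogeneous hq z) z) h
    have h3 : Q z z = mix (dirD z (dirD z q)) (List.replicate m h) := rfl
    rw [show m + 2 - 1 - 1 = m by omega, ← h3] at h2
    rw [h2] at hcon
    exact pos_of_mul_pos_right hcon (by positivity)
  set s := MvPolynomial.eval h (dirD z (dirD z q)) with hs
  let φ : ℝ → ℝ := fun t => MvPolynomial.eval (h + t • z) q
  let ψ : ℝ → ℝ := fun t => φ t - s / 4 * t ^ 2
  have hψ : ∀ t, HasDerivAt ψ (MvPolynomial.eval (h + t • z) (dirD z q) - s / 2 * t) t := by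
    intro t
    have := (hasDerivAt_eval_line q h z t).sub ((hasDerivAt_pow 2 t).const_mul (s / 4))
    refine this.congr_deriv ?_
    norm_num
    ring
  have hψ' : deriv ψ = fun t => MvPolynomial.eval (h + t • z) (dirD z q) - s / 2 * t :=
    funext fun t => (hψ t).deriv
  have hψ'' : deriv (deriv ψ) 0 = s / 2 := by
    rw [hψ']
    have := (hasDerivAt_eval_line (dirD z q) h z 0).sub ((hasDerivAt_id 0).const_mul (s / 2))
    have h5 := this.deriv
    simp only [zero_smul, add_zero, mul_one] at h5
    rw [← hs] at h5
    refine h5.trans (by ring)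
  have hmin := isLocalMin_of_deriv_deriv_pos (f := ψ) (x₀ := 0) (by rw [hψ'']; positivity)
    (by rw [(hψ 0).deriv]; simp [h1]) (hψ 0).continuousAt
  have hcont : Continuous fun t : ℝ => h + t • z := by fun_prop
  have hTn : ∀ᶠ t : ℝ in nhds 0, h + t • z ∈ T :=
    hcont.continuousAt.eventually_mem (by simpa using hT.mem_nhds hh)
  have hneg : Filter.Tendsto (fun t : ℝ => -t) (nhds 0) (nhds 0) := by
    simpa using (continuous_neg (G := ℝ)).tendsto 0
  have hall := (hmin.and hTn).and (hneg.eventually (hmin.and hTn))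
  obtain ⟨ε, hε, hall⟩ := Metric.eventually_nhds_iff.1 hall
  obtain ⟨⟨ha, hb⟩, ⟨hc, hd⟩⟩ := hall (y := ε / 2) (by
    rw [Real.dist_eq, sub_zero, abs_of_pos (by positivity)]; linarith)
  have hmid := hquasi _ hb _ hd
  rw [show (1 / 2 : ℝ) • (h + (ε / 2) • z + (h + (-(ε / 2)) • z)) = h by
    ext i; simp; ring] at hmid
  have e0 : ψ 0 = MvPolynomial.eval h q := by simp [ψ, φ]
  rw [e0] at ha hc
  simp only [ψ, φ] at ha hc
  have : 0 < s / 4 * (ε / 2) ^ 2 := by positivity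
  rw [neg_sq] at hc
  rcases min_le_iff.1 hmid with h | h <;> linarith

theorem rpow_eval_concaveOn {q : MvPolynomial ι ℝ} {m : ℕ} (hm : 1 ≤ m) {T : Set (ι → ℝ)}
    (hT : Convex ℝ T) (hpos : ∀ h ∈ T, 0 < MvPolynomial.eval h q)
    (hineq : ∀ h ∈ T, ∀ z, m * (MvPolynomial.eval h (dirD z (dirD z q)) * MvPolynomial.eval h q) ≤
      (m - 1) * MvPolynomial.eval h (dirD z q) ^ 2) :
    ConcaveOn ℝ T fun h => MvPolynomial.eval h q ^ ((1 : ℝ) / m) := by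
  refine ⟨hT, fun x hx y hy a b ha hb hab => ?_⟩
  set z := y - x with hz
  let f : ℝ → ℝ := fun t => MvPolynomial.eval (x + t • z) q
  let f1 : ℝ → ℝ := fun t => MvPolynomial.eval (x + t • z) (dirD z q)
  let f2 : ℝ → ℝ := fun t => MvPolynomial.eval (x + t • z) (dirD z (dirD z q))
  have hline : ∀ t ∈ Icc (0 : ℝ) 1, x + t • z ∈ T := fun t ht => by
    have := hT hx hy (sub_nonneg.2 ht.2) ht.1 (by ring)
    convert this using 1
    ext i; simp [hz]; ring
  have hf : ∀ t, HasDerivAt f (f1 t) t := fun t => hasDerivAt_eval_line q x z t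
  have hf1 : ∀ t, HasDerivAt f1 (f2 t) t := fun t => hasDerivAt_eval_line _ x z t
  have hfpos : ∀ t ∈ Icc (0 : ℝ) 1, 0 < f t := fun t ht => hpos _ (hline t ht)
  have hm0 : (0 : ℝ) < m := by exact_mod_cast hm
  set r : ℝ := 1 / m with hr
  have hconc : ConcaveOn ℝ (Icc 0 1) fun t => f t ^ r := by
    refine concaveOn_of_hasDerivWithinAt2_nonpos (convex_Icc 0 1)
      (f' := fun t => f1 t * r * f t ^ (r - 1))
      (f'' := fun t => f2 t * r * f t ^ (r - 1) +
        f1 t * r * (f1 t * (r - 1) * f t ^ (r - 1 - 1))) ?_ ?_ ?_ ?_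
    · exact fun t ht => ((hf t).continuousAt.rpow_const
        (Or.inl (hfpos t ht).ne')).continuousWithinAt
    · intro t ht
      have := hfpos t (interior_subset ht)
      exact ((hf t).rpow_const (Or.inl this.ne')).hasDerivWithinAt
    · intro t ht
      have := hfpos t (interior_subset ht)
      exact (((hf1 t).mul_const r).mul
        ((hf t).rpow_const (p := r - 1) (Or.inl this.ne'))).hasDerivWithinAt
    · intro t ht
      have h0 := hfpos t (interior_subset ht)
      have h1 := hineq _ (hline t (interior_subset ht)) z
      change m * (f2 t * f t) ≤ (m - 1) * f1 t ^ 2 at h1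
      have h2 : f t ^ (r - 1) = f t ^ (r - 1 - 1) * f t := by
        rw [← Real.rpow_add_one h0.ne']; ring_nf
      have h3 : 0 < f t ^ (r - 1 - 1) := Real.rpow_pos_of_pos h0 _
      have h4 : f2 t * r * f t ^ (r - 1) + f1 t * r * (f1 t * (r - 1) * f t ^ (r - 1 - 1)) =
          r ^ 2 * f t ^ (r - 1 - 1) * (m * (f2 t * f t) - (m - 1) * f1 t ^ 2) := by
        rw [h2, hr]
        field_simp
        ring
      rw [h4]
      exact mul_nonpos_of_nonneg_of_nonpos (by positivity) (by linarith)
  have := hconc.2 (x := 0) (y := 1) (by simp) (by simp) ha hb hab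
  have e1 : x + b • z = a • x + b • y := by
    rw [← eq_sub_iff_add_eq] at hab
    ext i; simp [hz, hab]; ring
  simpa [f, hz, smul_eq_mul, ← e1] using this

end PolynomialCalculus

namespace FacePolynomials

variable {ι : Type*} [Fintype ι] [DecidableEq ι] {n : ℕ} {T : Set (ι → ℝ)}
  {Δ : Finset ι → Prop} {G : Finset ι → MvPolynomial ι ℝ}

theorem eval_dirD_pos (F : FacePolynomials n T Δ G) (h0 : Δ ∅) (hG : (G ∅).IsHomogeneous n)
    (hn : 2 ≤ n) {k h : ι → ℝ} (hk : k ∈ T) (hh : h ∈ T) :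
    0 < MvPolynomial.eval h (dirD k (G ∅)) := by
  have h1 := F.mix_pos (k :: List.replicate (n - 1) h)
    (by rintro x hx
        rcases List.mem_cons.1 hx with rfl | hx
        · exact hk
        · rwa [List.eq_of_mem_replicate hx]) ∅ h0 (by simp; omega)
  rw [mix_cons, mix_replicate (dirD_isHomogeneous hG k)] at h1
  exact pos_of_mul_pos_right h1 (by positivity)

theorem rpow_eval_dirD_concaveOn (F : FacePolynomials n T Δ G) (h0 : Δ ∅)
    (hG : (G ∅).IsHomogeneous n) (hn : 2 ≤ n) (hT : Convex ℝ T) {k : ι → ℝ} (hk : k ∈ T) :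
    ConcaveOn ℝ T fun h => MvPolynomial.eval h (dirD k (G ∅)) ^ ((1 : ℝ) / ((n : ℝ) - 1)) := by
  obtain ⟨m, rfl⟩ : ∃ m, n = m + 2 := ⟨n - 2, by omega⟩
  have hD := dirD_isHomogeneous hG k
  have := rpow_eval_concaveOn (q := dirD k (G ∅)) (m := m + 1) (by omega) hT
    (fun h hh => F.eval_dirD_pos h0 hG hn hk hh) fun h hh z => ?_
  · convert this using 3
    push_cast; ring
  rcases m with _ | m
  · have h1 := dirD_isHomogeneous (dirD_isHomogeneous hD z) h
    have h2 : dirD z (dirD z (dirD k (G ∅))) = 0 := by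
      have h3 : (dirD z (dirD k (G ∅))).IsHomogeneous 0 := dirD_isHomogeneous hD z
      rw [MvPolynomial.totalDegree_eq_zero_iff_eq_C.1
        ((MvPolynomial.totalDegree_zero_iff_isHomogeneous ι).2 h3), dirD_apply]
      simp
    simp [h2]
  · have hAF := F.alexandrov_fenchel (k :: List.replicate m h)
      (by rintro x hx
          rcases List.mem_cons.1 hx with rfl | hx
          · exact hk
          · rwa [List.eq_of_mem_replicate hx]) ∅ h0 (by simp) h hh z
    have hperm : ∀ x y : ι → ℝ, mix (G ∅) (x :: y :: k :: List.replicate m h) =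
        mix (dirD k (G ∅)) (x :: y :: List.replicate m h) := fun x y =>
      mix_perm (((List.Perm.swap _ _ _).cons _).trans (List.Perm.swap _ _ _)) _
    rw [hperm, hperm, hperm] at hAF
    have e1 : mix (dirD k (G ∅)) (z :: z :: List.replicate m h) =
        m.factorial * MvPolynomial.eval h (dirD z (dirD z (dirD k (G ∅)))) :=
      mix_replicate (m := m) (dirD_isHomogeneous (dirD_isHomogeneous hD z) z) h
    have e2 : mix (dirD k (G ∅)) (h :: h :: List.replicate m h) =
        (m + 2).factorial * MvPolynomial.eval h (dirD k (G ∅)) :=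
      mix_replicate (m := m + 2) hD h
    have e3 : mix (dirD k (G ∅)) (z :: h :: List.replicate m h) =
        (m + 1).factorial * MvPolynomial.eval h (dirD z (dirD k (G ∅))) :=
      mix_replicate (m := m + 1) (dirD_isHomogeneous hD z) h
    rw [e1, e2, e3, Nat.factorial_succ (m + 1), Nat.factorial_succ m] at hAF
    have h5 : (0 : ℝ) < m.factorial := by positivity
    push_cast at hAF ⊢
    have h6 : (0 : ℝ) < (m.factorial : ℝ) ^ 2 * (m + 1) := by positivity
    refine le_of_mul_le_mul_left ?_ h6
    linarith

theorem eval_dirD_mono (F : FacePolynomials n T Δ G) (hG : (G ∅).IsHomogeneous n) (hn : 2 ≤ n)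
    (hT : Convex ℝ T) {k x y : ι → ℝ} (hk : k ∈ T) (hx : x ∈ T) (hy : y ∈ T) (hxy : x ≤ y) :
    MvPolynomial.eval x (dirD k (G ∅)) ≤ MvPolynomial.eval y (dirD k (G ∅)) := by
  let f : ℝ → ℝ := fun t => MvPolynomial.eval (x + t • (y - x)) (dirD k (G ∅))
  have hf : ∀ t, HasDerivAt f
      (MvPolynomial.eval (x + t • (y - x)) (dirD (y - x) (dirD k (G ∅)))) t :=
    fun t => hasDerivAt_eval_line _ _ _ _
  have hmono : MonotoneOn f (Icc 0 1) := by
    refine monotoneOn_of_deriv_nonneg (convex_Icc 0 1)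
      (fun t _ => (hf t).continuousAt.continuousWithinAt)
      (fun t _ => (hf t).differentiableAt.differentiableWithinAt) fun t ht => ?_
    rw [(hf t).deriv]
    have ht := interior_subset ht
    have hl : x + t • (y - x) ∈ T := by
      have := hT hx hy (sub_nonneg.2 ht.2) ht.1 (by ring)
      convert this using 1
      ext i; simp; ring
    set h := x + t • (y - x)
    have h1 : mix (G ∅) ((y - x) :: k :: List.replicate (n - 2) h) = (n - 2).factorial *
        MvPolynomial.eval h (dirD k (dirD (y - x) (G ∅))) :=
      mix_replicate (m := n - 2) (dirD_isHomogeneous (dirD_isHomogeneous hG _) k) h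
    rw [dirD_comm]
    have h2 : 0 ≤ mix (G ∅) ((y - x) :: k :: List.replicate (n - 2) h) := by
      rw [mix_cons_eq_sum]
      refine Finset.sum_nonneg fun i _ => mul_nonneg (sub_nonneg.2 (hxy i)) ?_
      rw [F.pderiv_eq ∅ i (by simp)]
      refine F.mix_nonneg_of_pos _ fun hΔ => F.mix_pos _ ?_ _ hΔ (by simp; omega)
      rintro x hx
      rcases List.mem_cons.1 hx with rfl | hx
      · exact hk
      · rwa [List.eq_of_mem_replicate hx]
    rw [h1] at h2
    exact nonneg_of_mul_nonneg_right h2 (by positivity)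
  have := hmono (a := 0) (b := 1) (by simp) (by simp) zero_le_one
  simpa [f] using this

end FacePolynomials

/-! ### A multiplicative Brunn–Minkowski inequality for midpoints -/

theorem volume_half_add_image (K : Set ℝ) (b : ℝ) :
    volume ((fun x : ℝ => (x + b) / 2) '' K) = volume K / 2 := by
  have h : (fun x : ℝ => (x + b) / 2) '' K = (fun x => x + b / 2) '' ((1 / 2 : ℝ) • K) := by
    rw [← image_smul, image_image]
    refine image_congr fun x _ => ?_
    simp only [smul_eq_mul]; ring
  rw [h, image_add_right, measure_preimage_add_right, Measure.addHaar_smul]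
  simp only [Module.finrank_self, pow_one]
  rw [abs_of_pos (by norm_num), ENNReal.ofReal_div_of_pos (by norm_num), mul_comm]
  simp [div_eq_mul_inv]

theorem volume_add_le_midpoints_of_isCompact {A B M : Set ℝ} (hA : IsCompact A) (hB : IsCompact B)
    (hA0 : A.Nonempty) (hB0 : B.Nonempty) (h : ∀ x ∈ A, ∀ y ∈ B, (x + y) / 2 ∈ M) :
    volume A + volume B ≤ 2 * volume M := by
  obtain ⟨a, ha, hamax⟩ := hA.exists_isGreatest hA0
  obtain ⟨b, hb, hbmin⟩ := hB.exists_isLeast hB0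
  set U := (fun x : ℝ => (x + b) / 2) '' A
  set W := (fun x : ℝ => (x + a) / 2) '' B
  have hUW : U ∪ W ⊆ M := by
    rintro z (⟨x, hx, rfl⟩ | ⟨y, hy, rfl⟩)
    · exact h x hx b hb
    · simpa [add_comm] using h a ha y hy
  have hW : MeasurableSet W := (hB.image (by fun_prop)).measurableSet
  have hdisj : AEDisjoint volume U W := by
    refine measure_mono_null (t := {(a + b) / 2}) ?_ (measure_singleton _)
    rintro z ⟨⟨x, hx, rfl⟩, ⟨y, hy, hxy⟩⟩
    have h1 := hamax hx
    have h2 := hbmin hy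
    simp only [mem_singleton_iff] at hxy ⊢
    linarith
  have := measure_mono (μ := volume) hUW
  rw [measure_union₀ hW.nullMeasurableSet hdisj, volume_half_add_image,
    volume_half_add_image] at this
  calc volume A + volume B = 2 * (volume A / 2 + volume B / 2) := by
        rw [mul_add, ENNReal.mul_div_cancel (by simp) (by simp),
          ENNReal.mul_div_cancel (by simp) (by simp)]
    _ ≤ _ := by gcongr

theorem volume_add_le_midpoints {A B M : Set ℝ} (hA : MeasurableSet A) (hB : MeasurableSet B)
    (hA0 : A.Nonempty) (hB0 : B.Nonempty) (h : ∀ x ∈ A, ∀ y ∈ B, (x + y) / 2 ∈ M) :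
    volume A + volume B ≤ 2 * volume M := by
  rcases eq_or_ne (volume M) ⊤ with hM | hM
  · simp [hM]
  obtain ⟨a, ha⟩ := hA0
  obtain ⟨b, hb⟩ := hB0
  have hfin : ∀ C : Set ℝ, ∀ c, (∀ x ∈ C, (x + c) / 2 ∈ M) → volume C ≠ ⊤ := by
    intro C c hC hCtop
    have h1 : volume ((fun x : ℝ => (x + c) / 2) '' C) ≤ volume M :=
      measure_mono (image_subset_iff.2 hC)
    rw [volume_half_add_image, hCtop, ENNReal.top_div_of_ne_top (by simp)] at h1
    exact hM (top_le_iff.1 h1)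
  have hAfin := hfin A b fun x hx => h x hx b hb
  have hBfin := hfin B a fun y hy => by simpa [add_comm] using h a ha y hy
  refine ENNReal.le_of_forall_pos_le_add fun ε hε _ => ?_
  have hε2 : (ε / 2 : ENNReal) ≠ 0 := by simp [hε.ne']
  obtain ⟨K, hKA, hK, hKlt⟩ := hA.exists_isCompact_lt_add hAfin hε2
  obtain ⟨L, hLB, hL, hLlt⟩ := hB.exists_isCompact_lt_add hBfin hε2
  have h1 := volume_add_le_midpoints_of_isCompact (hK.insert a) (hL.insert b)
    (insert_nonempty _ _) (insert_nonempty _ _)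
    (fun x hx y hy => h x (insert_subset ha hKA hx) y (insert_subset hb hLB hy))
  calc volume A + volume B ≤ (volume K + ε / 2) + (volume L + ε / 2) := by gcongr
    _ = volume K + volume L + ε := by rw [add_add_add_comm, ENNReal.add_halves]
    _ ≤ volume (insert a K) + volume (insert b L) + ε := by
        gcongr <;> exact subset_insert _ _
    _ ≤ _ := by gcongr

theorem lintegral_add_le_of_min_le {f g m : ℝ → ℝ} (hf : Measurable f) (hg : Measurable g)
    (hm : Measurable m) (hf0 : ∀ x, 0 ≤ f x) (hg0 : ∀ x, 0 ≤ g x) (hm0 : ∀ x, 0 ≤ m x)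
    (hf1 : ∀ x, f x ≤ 1) (hg1 : ∀ x, g x ≤ 1) (hfs : ∀ t < 1, ∃ x, t < f x)
    (hgs : ∀ t < 1, ∃ x, t < g x) (h : ∀ x y, min (f x) (g y) ≤ m ((x + y) / 2)) :
    (∫⁻ x, ENNReal.ofReal (f x)) + ∫⁻ x, ENNReal.ofReal (g x) ≤
      2 * ∫⁻ x, ENNReal.ofReal (m x) := by
  rw [lintegral_eq_lintegral_meas_lt _ (.of_forall hf0) hf.aemeasurable,
    lintegral_eq_lintegral_meas_lt _ (.of_forall hg0) hg.aemeasurable,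
    lintegral_eq_lintegral_meas_lt _ (.of_forall hm0) hm.aemeasurable,
    ← lintegral_const_mul' _ _ (by simp)]
  have hanti : Antitone fun t : ℝ => volume {a | t < f a} :=
    fun s t hst => measure_mono fun a ha => lt_of_le_of_lt hst ha
  rw [← lintegral_add_left hanti.measurable]
  refine lintegral_mono fun t => ?_
  rcases lt_or_ge t 1 with ht | ht
  · refine volume_add_le_midpoints (hf measurableSet_Ioi) (hg measurableSet_Ioi) (hfs t ht)
      (hgs t ht) fun x hx y hy => ?_
    exact lt_of_lt_of_le (lt_min hx hy) (h x y)
  · have e1 : {a | t < f a} = ∅ := eq_empty_of_forall_notMem fun a ha =>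
      absurd (lt_of_lt_of_le ha (hf1 a)) (not_lt.2 ht)
    have e2 : {a | t < g a} = ∅ := eq_empty_of_forall_notMem fun a ha =>
      absurd (lt_of_lt_of_le ha (hg1 a)) (not_lt.2 ht)
    simp [e1, e2]

/-- The one-dimensional Prékopa–Leindler inequality for bounded functions and midpoints. -/
theorem prekopa_leindler_real {f g m : ℝ → ℝ} (hf : Measurable f) (hg : Measurable g)
    (hm : Measurable m) (hf0 : ∀ x, 0 ≤ f x) (hg0 : ∀ x, 0 ≤ g x) (hm0 : ∀ x, 0 ≤ m x)
    (hfb : BddAbove (range f)) (hgb : BddAbove (range g))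
    (h : ∀ x y, f x * g y ≤ m ((x + y) / 2) ^ 2) :
    (∫⁻ x, ENNReal.ofReal (f x)) * ∫⁻ x, ENNReal.ofReal (g x) ≤
      (∫⁻ x, ENNReal.ofReal (m x)) ^ 2 := by
  by_cases hfz : ∀ x, f x = 0
  · simp [hfz]
  by_cases hgz : ∀ x, g x = 0
  · simp [hgz]
  push Not at hfz hgz
  obtain ⟨x0, hx0⟩ := hfz
  obtain ⟨y0, hy0⟩ := hgz
  set a := ⨆ x, f x
  set b := ⨆ x, g x
  have hfa : ∀ x, f x ≤ a := le_ciSup hfb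
  have hgb' : ∀ x, g x ≤ b := le_ciSup hgb
  have ha : 0 < a := ((hf0 x0).lt_of_ne' hx0).trans_le (hfa x0)
  have hb : 0 < b := ((hg0 y0).lt_of_ne' hy0).trans_le (hgb' y0)
  set s := √(a * b)
  have hs : 0 < s := Real.sqrt_pos.2 (mul_pos ha hb)
  have hss : s ^ 2 = a * b := Real.sq_sqrt (mul_pos ha hb).le
  have key := lintegral_add_le_of_min_le (f := fun x => a⁻¹ * f x) (g := fun x => b⁻¹ * g x)
    (m := fun x => s⁻¹ * m x) (hf.const_mul _) (hg.const_mul _) (hm.const_mul _)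
    (fun x => mul_nonneg (by positivity) (hf0 x)) (fun x => mul_nonneg (by positivity) (hg0 x))
    (fun x => mul_nonneg (by positivity) (hm0 x))
    (fun x => by rw [inv_mul_le_one₀ ha]; exact hfa x)
    (fun x => by rw [inv_mul_le_one₀ hb]; exact hgb' x)
    (fun t ht => by
      obtain ⟨x, hx⟩ := exists_lt_of_lt_ciSup (show a * t < ⨆ x, f x by
        change a * t < a; nlinarith)
      exact ⟨x, by rwa [lt_inv_mul_iff₀ ha]⟩)
    (fun t ht => by
      obtain ⟨x, hx⟩ := exists_lt_of_lt_ciSup (show b * t < ⨆ x, g x by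
        change b * t < b; nlinarith)
      exact ⟨x, by rwa [lt_inv_mul_iff₀ hb]⟩)
    (fun x y => by
      have hu : 0 ≤ a⁻¹ * f x := mul_nonneg (by positivity) (hf0 x)
      have hv : 0 ≤ b⁻¹ * g y := mul_nonneg (by positivity) (hg0 y)
      refine le_of_sq_le_sq (a := min (a⁻¹ * f x) (b⁻¹ * g y)) ?_
        (mul_nonneg (by positivity) (hm0 _))
      calc min (a⁻¹ * f x) (b⁻¹ * g y) ^ 2 ≤ a⁻¹ * f x * (b⁻¹ * g y) := by
            rw [sq]; exact mul_le_mul (min_le_left _ _) (min_le_right _ _) (le_min hu hv) hu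
        _ = (a * b)⁻¹ * (f x * g y) := by rw [mul_inv]; ring
        _ ≤ (a * b)⁻¹ * m ((x + y) / 2) ^ 2 :=
            mul_le_mul_of_nonneg_left (h x y) (by positivity)
        _ = _ := by rw [← hss]; ring)
  have hmul : ∀ (c : ℝ) (u : ℝ → ℝ), 0 < c → (∫⁻ x, ENNReal.ofReal (c⁻¹ * u x)) =
      ENNReal.ofReal c⁻¹ * ∫⁻ x, ENNReal.ofReal (u x) := by
    intro c u hc
    rw [← lintegral_const_mul' _ _ (by simp)]
    exact lintegral_congr fun x => ENNReal.ofReal_mul (by positivity)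
  rw [hmul a f ha, hmul b g hb, hmul s m hs] at key
  generalize (∫⁻ x, ENNReal.ofReal (f x)) = X at key ⊢
  generalize (∫⁻ x, ENNReal.ofReal (g x)) = Y at key ⊢
  generalize (∫⁻ x, ENNReal.ofReal (m x)) = Z at key ⊢
  rcases eq_or_ne Z ⊤ with hZ | hZ
  · simp [hZ]
  have hR : ENNReal.ofReal a⁻¹ * X + ENNReal.ofReal b⁻¹ * Y ≠ ⊤ :=
    ne_top_of_le_ne_top (ENNReal.mul_ne_top (by simp)
      (ENNReal.mul_ne_top (by simp) hZ)) key
  obtain ⟨hX', hY'⟩ := ENNReal.add_ne_top.1 hR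
  have hX : X ≠ ⊤ := fun hX => hX' (by rw [hX, ENNReal.mul_top]; simpa using ha)
  have hY : Y ≠ ⊤ := fun hY => hY' (by rw [hY, ENNReal.mul_top]; simpa using hb)
  lift X to NNReal using hX
  lift Y to NNReal using hY
  lift Z to NNReal using hZ
  have key2 := ENNReal.toReal_mono (ENNReal.mul_ne_top (by simp)
      (ENNReal.mul_ne_top (by simp) (by simp))) key
  rw [ENNReal.toReal_add hX' hY'] at key2
  simp only [ENNReal.toReal_mul, ENNReal.coe_toReal, ENNReal.toReal_ofNat,
    ENNReal.toReal_ofReal (inv_pos.2 ha).le, ENNReal.toReal_ofReal (inv_pos.2 hb).le,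
    ENNReal.toReal_ofReal (inv_pos.2 hs).le] at key2
  have h0 : (0 : ℝ) ≤ a⁻¹ * X + b⁻¹ * Y := by positivity
  have h1 := pow_le_pow_left₀ h0 key2 2
  have h2 : (2 * (s⁻¹ * (Z : ℝ))) ^ 2 = 4 * (Z : ℝ) ^ 2 * (a * b)⁻¹ := by
    rw [← hss]; field_simp; ring
  have h3 : 4 * ((X : ℝ) * Y) * (a * b)⁻¹ ≤ (a⁻¹ * X + b⁻¹ * Y) ^ 2 := by
    rw [mul_inv]
    nlinarith [sq_nonneg (a⁻¹ * (X : ℝ) - b⁻¹ * Y)]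
  have h4 : (X : ℝ) * Y ≤ (Z : ℝ) ^ 2 := by
    have h5 : 4 * ((X : ℝ) * Y) * (a * b)⁻¹ ≤ 4 * (Z : ℝ) ^ 2 * (a * b)⁻¹ := by linarith
    have := le_of_mul_le_mul_right h5 (by positivity)
    linarith
  exact_mod_cast h4

theorem volume_mul_le_midpoints_pi (n : ℕ) {A B M : Set (Fin n → ℝ)} (hA : MeasurableSet A)
    (hB : MeasurableSet B) (hM : MeasurableSet M) (hAb : Bornology.IsBounded A)
    (hBb : Bornology.IsBounded B) (hMb : Bornology.IsBounded M)
    (h : ∀ x ∈ A, ∀ y ∈ B, (1 / 2 : ℝ) • (x + y) ∈ M) :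
    volume A * volume B ≤ volume M ^ 2 := by
  induction n with
  | zero =>
    rcases A.eq_empty_or_nonempty with rfl | ⟨a, ha⟩
    · simp
    rcases B.eq_empty_or_nonempty with rfl | ⟨b, hb⟩
    · simp
    have e : ∀ C : Set (Fin 0 → ℝ), C.Nonempty → C = univ := fun C hC =>
      Subsingleton.eq_univ_of_nonempty hC
    rw [e A ⟨a, ha⟩, e B ⟨b, hb⟩, e M ⟨_, h a ha b hb⟩, sq]
  | succ n ih =>
    let e := MeasurableEquiv.piFinSuccAbove (fun _ : Fin (n + 1) => ℝ) 0
    have he : MeasurePreserving e.symm volume volume :=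
      (volume_preserving_piFinSuccAbove (fun _ : Fin (n + 1) => ℝ) 0).symm
    have hes : ∀ t x, e.symm (t, x) = Fin.cons t x := fun t x => by
      simp [e, MeasurableEquiv.piFinSuccAbove, Fin.insertNthEquiv]
    have hslice : ∀ C : Set (Fin (n + 1) → ℝ), Bornology.IsBounded C →
        ∃ R : ℝ, ∀ t, Prod.mk t ⁻¹' (e.symm ⁻¹' C) ⊆ Metric.closedBall 0 R := by
      intro C hC
      obtain ⟨R, hR⟩ := hC.subset_closedBall 0
      refine ⟨max R 0, fun t x hx => ?_⟩
      have h1 := hR hx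
      rw [hes, mem_closedBall_zero_iff] at h1
      rw [mem_closedBall_zero_iff, pi_norm_le_iff_of_nonneg (le_max_right _ _)]
      intro i
      exact ((norm_le_pi_norm (Fin.cons t x : Fin (n + 1) → ℝ) i.succ).trans h1).trans
        (le_max_left _ _)
    have hvol : ∀ C : Set (Fin (n + 1) → ℝ), MeasurableSet C → Bornology.IsBounded C →
        volume C = ∫⁻ t, ENNReal.ofReal (volume (Prod.mk t ⁻¹' (e.symm ⁻¹' C))).toReal := by
      intro C hC hCb
      rw [← he.measure_preimage hC.nullMeasurableSet, Measure.volume_eq_prod,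
        Measure.prod_apply (e.symm.measurable hC)]
      obtain ⟨R, hR⟩ := hslice C hCb
      refine lintegral_congr fun t => (ENNReal.ofReal_toReal ?_).symm
      exact ne_top_of_le_ne_top measure_closedBall_lt_top.ne (measure_mono (hR t))
    have hmeas : ∀ C : Set (Fin (n + 1) → ℝ), MeasurableSet C →
        Measurable fun t => (volume (Prod.mk t ⁻¹' (e.symm ⁻¹' C))).toReal := fun C hC =>
      (measurable_measure_prodMk_left (e.symm.measurable hC)).ennreal_toReal
    have hbdd : ∀ C : Set (Fin (n + 1) → ℝ), Bornology.IsBounded C →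
        BddAbove (range fun t => (volume (Prod.mk t ⁻¹' (e.symm ⁻¹' C))).toReal) := by
      intro C hCb
      obtain ⟨R, hR⟩ := hslice C hCb
      refine ⟨(volume (Metric.closedBall (0 : Fin n → ℝ) R)).toReal, ?_⟩
      rintro _ ⟨t, rfl⟩
      exact ENNReal.toReal_mono measure_closedBall_lt_top.ne (measure_mono (hR t))
    have hsb : ∀ C : Set (Fin (n + 1) → ℝ), Bornology.IsBounded C → ∀ t,
        Bornology.IsBounded (Prod.mk t ⁻¹' (e.symm ⁻¹' C)) := by
      intro C hCb t
      obtain ⟨R, hR⟩ := hslice C hCb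
      exact Metric.isBounded_closedBall.subset (hR t)
    rw [hvol A hA hAb, hvol B hB hBb, hvol M hM hMb]
    refine prekopa_leindler_real (hmeas A hA) (hmeas B hB) (hmeas M hM) (fun _ => by positivity)
      (fun _ => by positivity) (fun _ => by positivity) (hbdd A hAb) (hbdd B hBb) fun s t => ?_
    rw [← ENNReal.toReal_mul, ← ENNReal.toReal_pow]
    have hfin : volume (Prod.mk ((s + t) / 2) ⁻¹' (e.symm ⁻¹' M)) ≠ ⊤ :=
      (hsb M hMb _).measure_lt_top.ne
    refine ENNReal.toReal_mono (ENNReal.pow_ne_top hfin) ?_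
    refine ih (measurable_prodMk_left (e.symm.measurable hA))
      (measurable_prodMk_left (e.symm.measurable hB))
      (measurable_prodMk_left (e.symm.measurable hM)) (hsb A hAb s) (hsb B hBb t) (hsb M hMb _) ?_
    intro x hx y hy
    have := h _ hx _ hy
    rw [hes, hes] at this
    simp only [mem_preimage, hes]
    convert this using 1
    ext i
    refine Fin.cases ?_ (fun i => ?_) i
    · simp
      ring
    · simp
      ring

/-- A multiplicative Brunn–Minkowski inequality for midpoints in Euclidean space. -/
theorem volume_mul_le_midpoints {n : ℕ} {A B M : Set (EuclideanSpace ℝ (Fin n))}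
    (hA : MeasurableSet A) (hB : MeasurableSet B) (hM : MeasurableSet M)
    (hAb : Bornology.IsBounded A) (hBb : Bornology.IsBounded B) (hMb : Bornology.IsBounded M)
    (h : ∀ x ∈ A, ∀ y ∈ B, (1 / 2 : ℝ) • (x + y) ∈ M) :
    volume A * volume B ≤ volume M ^ 2 := by
  let e := MeasurableEquiv.toLp 2 (Fin n → ℝ)
  have he : MeasurePreserving e volume volume :=
    (EuclideanSpace.volume_preserving_symm_measurableEquiv_toLp (Fin n)).symm
  have hb : ∀ C : Set (EuclideanSpace ℝ (Fin n)), Bornology.IsBounded C →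
      Bornology.IsBounded (e ⁻¹' C) := by
    intro C hC
    obtain ⟨R, hR⟩ := hC.subset_closedBall 0
    refine Metric.isBounded_closedBall.subset (t := Metric.closedBall 0 (max R 0))
      fun x hx => ?_
    have h1 := hR hx
    rw [mem_closedBall_zero_iff] at h1 ⊢
    rw [pi_norm_le_iff_of_nonneg (le_max_right _ _)]
    exact fun i => ((PiLp.norm_apply_le (e x) i).trans h1).trans (le_max_left _ _)
  rw [← he.measure_preimage hA.nullMeasurableSet, ← he.measure_preimage hB.nullMeasurableSet,
    ← he.measure_preimage hM.nullMeasurableSet]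
  exact volume_mul_le_midpoints_pi n (e.measurable hA) (e.measurable hB) (e.measurable hM)
    (hb A hAb) (hb B hBb) (hb M hMb) fun x hx y hy => h _ hx _ hy

/-! ### Polytopes with prescribed outer normals -/

section Polytopes

variable {E : Type*} [NormedAddCommGroup E] [InnerProductSpace ℝ E]
  {ι : Type*}

/-- The polytope with outer normals `u` and support vector `h`. -/
def hpoly (u : ι → E) (h : ι → ℝ) : Set E := {x | ∀ i, inner ℝ x (u i) ≤ h i}

/-- The vector `v`, read as the support vector of the point `v`. -/
def pairing (u : ι → E) : E →ₗ[ℝ] ι → ℝ where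
  toFun v i := inner ℝ v (u i)
  map_add' v w := by ext i; simp [inner_add_left]
  map_smul' c v := by ext i; simp [inner_smul_left]

@[simp] theorem pairing_apply (u : ι → E) (v : E) (i : ι) : pairing u v i = inner ℝ v (u i) := rfl

/-- `I` indexes a nonempty face of the polytope. -/
def IsFace (u : ι → E) (h : ι → ℝ) (I : Finset ι) : Prop :=
  ∃ x ∈ hpoly u h, ∀ i ∈ I, inner ℝ x (u i) = h i

theorem IsFace.add {u : ι → E} {h h' : ι → ℝ} {I : Finset ι} (hI : IsFace u h I)
    (hI' : IsFace u h' I) : IsFace u (h + h') I := by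
  obtain ⟨x, hx, hxI⟩ := hI
  obtain ⟨y, hy, hyI⟩ := hI'
  refine ⟨x + y, fun i => ?_, fun i hi => ?_⟩
  · rw [inner_add_left]; exact add_le_add (hx i) (hy i)
  · rw [inner_add_left, hxI i hi, hyI i hi]; rfl

theorem IsFace.smul {u : ι → E} {h : ι → ℝ} {I : Finset ι} (hI : IsFace u h I) {c : ℝ}
    (hc : 0 ≤ c) : IsFace u (c • h) I := by
  obtain ⟨x, hx, hxI⟩ := hI
  refine ⟨c • x, fun i => ?_, fun i hi => ?_⟩
  · rw [real_inner_smul_left]; exact mul_le_mul_of_nonneg_left (hx i) hc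
  · rw [real_inner_smul_left, hxI i hi]; rfl

theorem isFace_smul_iff {u : ι → E} {h : ι → ℝ} {I : Finset ι} {c : ℝ} (hc : 0 < c) :
    IsFace u (c • h) I ↔ IsFace u h I :=
  ⟨fun H => by simpa [smul_smul, hc.ne'] using H.smul (inv_pos.2 hc).le, fun H => H.smul hc.le⟩

theorem hpoly_smul (u : ι → E) (h : ι → ℝ) {c : ℝ} (hc : 0 < c) :
    hpoly u (c • h) = c • hpoly u h := by
  ext x
  rw [mem_smul_set_iff_inv_smul_mem₀ hc.ne']
  refine forall_congr' fun i => ?_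
  rw [real_inner_smul_left, inv_mul_le_iff₀ hc]
  rfl

theorem hpoly_add_pairing (u : ι → E) (h : ι → ℝ) (v : E) :
    hpoly u (h + pairing u v) = (fun x => x + v) '' hpoly u h := by
  ext x
  rw [image_add_right, mem_preimage]
  refine forall_congr' fun i => ?_
  rw [inner_add_left, inner_neg_left]
  simp only [Pi.add_apply, pairing_apply]
  constructor <;> intro h <;> linarith

theorem hpoly_add_subset (u : ι → E) (h h' : ι → ℝ) :
    hpoly u h + hpoly u h' ⊆ hpoly u (h + h') := by
  rintro _ ⟨x, hx, y, hy, rfl⟩ i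
  rw [inner_add_left]
  exact add_le_add (hx i) (hy i)

theorem convex_hpoly (u : ι → E) (h : ι → ℝ) : Convex ℝ (hpoly u h) := by
  intro x hx y hy a b ha hb hab i
  rw [inner_add_left, real_inner_smul_left, real_inner_smul_left]
  calc _ ≤ a * h i + b * h i := add_le_add (mul_le_mul_of_nonneg_left (hx i) ha)
        (mul_le_mul_of_nonneg_left (hy i) hb)
    _ = h i := by rw [← add_mul, hab, one_mul]

theorem isClosed_hpoly (u : ι → E) (h : ι → ℝ) : IsClosed (hpoly u h) := by
  have : hpoly u h = ⋂ i, {x | inner ℝ x (u i) ≤ h i} := by ext; simp [hpoly]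
  rw [this]
  exact isClosed_iInter fun i => isClosed_le (by fun_prop) continuous_const

variable [FiniteDimensional ℝ E]

theorem exists_inner_eq_of_linearIndependent {u : ι → E} {I : Finset ι}
    (hI : LinearIndependent ℝ fun i : I => u i) :
    ∃ R : (ι → ℝ) →ₗ[ℝ] E, ∀ c, ∀ i ∈ I, inner ℝ (R c) (u i) = c i := by
  let A : E →ₗ[ℝ] I → ℝ := pairing fun i : I => u i
  have hA : Function.Surjective A := by
    intro c
    obtain ⟨f, hf⟩ := LinearMap.exists_extend
      ((Finsupp.linearCombination ℝ c).comp (hI.repr : _ →ₗ[ℝ] I →₀ ℝ))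
    refine ⟨(InnerProductSpace.toDual ℝ E).symm (LinearMap.toContinuousLinearMap f), ?_⟩
    ext i
    simp only [A, pairing_apply, InnerProductSpace.toDual_symm_apply,
      LinearMap.coe_toContinuousLinearMap']
    have hmem : u i ∈ Submodule.span ℝ (range fun i : I => u i) :=
      Submodule.subset_span ⟨i, rfl⟩
    have h1 := LinearMap.congr_fun hf ⟨u i, hmem⟩
    have h2 : hI.repr ⟨u i, hmem⟩ = Finsupp.single i 1 := hI.repr_eq_single i _ rfl
    simpa [h2] using h1
  obtain ⟨R, hR⟩ := A.exists_rightInverse_of_surjective (LinearMap.range_eq_top.2 hA)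
  refine ⟨R.comp (LinearMap.pi fun i : I => LinearMap.proj i.1), fun c i hi => ?_⟩
  have := congrFun (LinearMap.congr_fun hR fun i : I => c i.1) ⟨i, hi⟩
  exact this

/-- At an optimal point with linearly independent tight constraints, the objective is a
nonnegative combination of the tight normals. -/
theorem exists_nonneg_combination [Fintype ι] {u : ι → E} {h : ι → ℝ} {x c : E}
    (hx : x ∈ hpoly u h) (hmax : ∀ y ∈ hpoly u h, inner ℝ y c ≤ inner ℝ x c) {I : Finset ι}
    (hI : ∀ i, i ∈ I ↔ inner ℝ x (u i) = h i) (hli : LinearIndependent ℝ fun i : I => u i) :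
    ∃ a : ι → ℝ, (∀ i, 0 ≤ a i) ∧ c = ∑ i ∈ I, a i • u i := by
  classical
  have hdir : ∀ d : E, (∀ i ∈ I, inner ℝ d (u i) ≤ 0) → inner ℝ d c ≤ 0 := by
    intro d hd
    have hev : ∀ᶠ t : ℝ in nhdsWithin 0 (Ioi 0), x + t • d ∈ hpoly u h := by
      refine Filter.eventually_all.2 fun i => ?_
      by_cases hi : i ∈ I
      · filter_upwards [self_mem_nhdsWithin] with t ht
        rw [inner_add_left, real_inner_smul_left, (hI i).1 hi]
        nlinarith [hd i hi, mem_Ioi.1 ht]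
      · have hlt : inner ℝ x (u i) < h i := lt_of_le_of_ne (hx i) fun e => hi ((hI i).2 e)
        have hc : ContinuousAt (fun t : ℝ => inner ℝ (x + t • d) (u i)) 0 := by fun_prop
        exact ((hc.eventually_lt continuousAt_const (by simpa using hlt)).filter_mono
          nhdsWithin_le_nhds).mono fun t ht => ht.le
    obtain ⟨t, ht, ht0⟩ := (hev.and self_mem_nhdsWithin).exists
    have h1 := hmax _ ht
    rw [inner_add_left, real_inner_smul_left] at h1
    have h2 : t * inner ℝ d c ≤ 0 := by linarith
    exact nonpos_of_mul_nonpos_right h2 ht0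
  have hspan : c ∈ Submodule.span ℝ (range fun i : I => u i) := by
    rw [← Submodule.orthogonal_orthogonal (Submodule.span ℝ (range fun i : I => u i)),
      Submodule.mem_orthogonal]
    intro d hd
    have hd0 : ∀ i ∈ I, inner ℝ d (u i) = 0 := fun i hi => by
      rw [real_inner_comm]
      exact (Submodule.mem_orthogonal _ _).1 hd _ (Submodule.subset_span ⟨⟨i, hi⟩, rfl⟩)
    have h1 := hdir d fun i hi => (hd0 i hi).le
    have h2 := hdir (-d) fun i hi => by rw [inner_neg_left, hd0 i hi, neg_zero]
    rw [inner_neg_left] at h2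
    linarith
  obtain ⟨a, ha⟩ := (Submodule.mem_span_range_iff_exists_fun ℝ).1 hspan
  obtain ⟨R, hR⟩ := exists_inner_eq_of_linearIndependent hli
  refine ⟨fun i => if hi : i ∈ I then a ⟨i, hi⟩ else 0, fun i => ?_, ?_⟩
  · by_cases hi : i ∈ I
    · simp only [hi, dif_pos]
      have h1 := hdir (R (-Pi.single i 1)) fun j hj => by
        rw [hR _ j hj]
        by_cases hij : j = i <;> simp [hij]
      rw [← ha, inner_sum, Finset.sum_eq_single ⟨i, hi⟩] at h1
      · rw [real_inner_smul_right, hR _ i hi] at h1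
        simpa using h1
      · intro j _ hj
        have : (j : ι) ≠ i := fun e => hj (Subtype.ext e)
        rw [real_inner_smul_right, hR _ j j.2]
        simp [this]
      · simp
    · simp [hi]
  · rw [← ha, ← Finset.sum_coe_sort I]
    refine Finset.sum_congr rfl fun i _ => ?_
    simp

end Polytopes

section TypeCone

variable {E : Type*} [NormedAddCommGroup E] [InnerProductSpace ℝ E] {ι : Type*}

/-- Support vectors whose polytopes have all the faces of `hpoly u h₀`. -/
def typeCone (u : ι → E) (h₀ : ι → ℝ) : Set (ι → ℝ) :=
  {h | ∀ I : Finset ι, IsFace u h₀ I → IsFace u h I}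

theorem convex_typeCone (u : ι → E) (h₀ : ι → ℝ) : Convex ℝ (typeCone u h₀) :=
  fun _ hx _ hy _ _ ha hb _ I hI => ((hx I hI).smul ha).add ((hy I hI).smul hb)

theorem smul_mem_interior_typeCone {u : ι → E} {h₀ h : ι → ℝ}
    (hh : h ∈ interior (typeCone u h₀)) {c : ℝ} (hc : 0 < c) :
    c • h ∈ interior (typeCone u h₀) := by
  have h1 : c • typeCone u h₀ ⊆ typeCone u h₀ := by
    rintro _ ⟨x, hx, rfl⟩ I hI
    exact (hx I hI).smul hc.le
  exact interior_mono h1 (by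
    rw [interior_smul₀ hc.ne']; exact smul_mem_smul_set hh)

theorem add_mem_interior_typeCone {u : ι → E} {h₀ h h' : ι → ℝ}
    (hh : h ∈ typeCone u h₀) (hh' : h' ∈ interior (typeCone u h₀)) :
    h + h' ∈ interior (typeCone u h₀) := by
  have h1 : (fun x => h + x) '' typeCone u h₀ ⊆ typeCone u h₀ := by
    rintro _ ⟨x, hx, rfl⟩ I hI
    exact (hh I hI).add (hx I hI)
  refine interior_mono h1 ?_
  have := (Homeomorph.addLeft h).image_interior (typeCone u h₀)
  exact this ▸ mem_image_of_mem _ hh'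

theorem IsFace.exists_strict {u : ι → E} {h₀ h : ι → ℝ} {I : Finset ι} (hI : IsFace u h₀ I)
    (hh : h ∈ interior (typeCone u h₀)) :
    ∃ x, (∀ i ∈ I, inner ℝ x (u i) = h i) ∧ ∀ i ∉ I, inner ℝ x (u i) < h i := by
  classical
  let e : ι → ℝ := fun i => if i ∈ I then 0 else 1
  have hev : ∀ᶠ t : ℝ in nhdsWithin 0 (Ioi 0), h - t • e ∈ typeCone u h₀ := by
    have hc : Filter.Tendsto (fun t : ℝ => h - t • e) (nhds 0) (nhds h) :=
      Continuous.tendsto' (by fun_prop) _ _ (by simp)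
    exact (hc.eventually (mem_interior_iff_mem_nhds.1 hh)).filter_mono nhdsWithin_le_nhds
  obtain ⟨t, ht, ht0⟩ := (hev.and self_mem_nhdsWithin).exists
  have ht0 : 0 < t := ht0
  obtain ⟨x, hx, hxI⟩ := ht I hI
  refine ⟨x, fun i hi => ?_, fun i hi => ?_⟩
  · simpa [e, hi] using hxI i hi
  · have := hx i
    simp only [e, Pi.sub_apply, Pi.smul_apply, hi, if_false, smul_eq_mul, mul_one] at this
    linarith

end TypeCone

section SimplePolytopes

variable {E : Type*} [NormedAddCommGroup E] [InnerProductSpace ℝ E] [FiniteDimensional ℝ E]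
  {ι : Type*} [Fintype ι]

theorem isCompact_hpoly {u : ι → E} (hu : ∀ d : E, d ≠ 0 → ∃ i, 0 < inner ℝ d (u i))
    (h : ι → ℝ) : ∃ r, ∀ h' ≤ h, hpoly u h' ⊆ Metric.closedBall 0 r := by
  let f : E → ℝ := fun x => ∑ i, max (inner ℝ x (u i)) 0
  have hf : Continuous f := by fun_prop
  obtain ⟨c, hc, hcf⟩ := (isCompact_sphere (0 : E) 1).exists_forall_le' hf.continuousOn (a := 0)
    (fun x hx => by
      obtain ⟨i, hi⟩ := hu x (by rintro rfl; simp at hx)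
      exact Finset.sum_pos' (fun j _ => le_max_right _ _) ⟨i, Finset.mem_univ i, by simp [hi]⟩)
  refine ⟨(∑ i, max (h i) 0) / c, fun h' hh' x hx => ?_⟩
  rw [mem_closedBall_zero_iff, le_div_iff₀ hc]
  by_cases hx0 : x = 0
  · simp only [hx0, norm_zero, zero_mul]
    exact Finset.sum_nonneg fun i _ => le_max_right _ _
  have hn : 0 < ‖x‖ := norm_pos_iff.2 hx0
  have h1 : f (‖x‖⁻¹ • x) = ‖x‖⁻¹ * f x := by
    simp only [f, Finset.mul_sum, real_inner_smul_left]
    refine Finset.sum_congr rfl fun i _ => ?_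
    rw [mul_max_of_nonneg _ _ (inv_pos.2 hn).le, mul_zero]
  have h2 := hcf (‖x‖⁻¹ • x) (by simp [norm_smul, hn.ne'])
  rw [h1, inv_mul_eq_div, le_div_iff₀ hn, mul_comm] at h2
  exact h2.trans (Finset.sum_le_sum fun i _ => max_le_max ((hx i).trans (hh' i)) le_rfl)

/-- Outer normals and a support vector for which the polytope is bounded and simple. -/
structure IsSimpleSystem (u : ι → E) (h₀ : ι → ℝ) : Prop where
  pos : ∀ d : E, d ≠ 0 → ∃ i, 0 < inner ℝ d (u i)
  ne_zero : ∀ i, u i ≠ 0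
  nonempty : (hpoly u h₀).Nonempty
  linearIndependent : ∀ I : Finset ι, IsFace u h₀ I → LinearIndependent ℝ fun i : I => u i

namespace IsSimpleSystem

variable {u : ι → E} {h₀ : ι → ℝ}

theorem isCompact (S : IsSimpleSystem u h₀) (h : ι → ℝ) : IsCompact (hpoly u h) := by
  obtain ⟨r, hr⟩ := isCompact_hpoly S.pos h
  exact Metric.isCompact_of_isClosed_isBounded (isClosed_hpoly u h)
    (Metric.isBounded_closedBall.subset (hr h le_rfl))

theorem mem_interior (S : IsSimpleSystem u h₀) : h₀ ∈ interior (typeCone u h₀) := by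
  classical
  rw [mem_interior_iff_mem_nhds]
  refine Filter.eventually_all.2 fun I => ?_
  by_cases hI : IsFace u h₀ I
  swap
  · exact Filter.Eventually.of_forall fun h hh => absurd hh hI
  obtain ⟨x, hx, hxI⟩ := hI
  let J : Finset ι := Finset.univ.filter fun i => inner ℝ x (u i) = h₀ i
  have hJ : IsFace u h₀ J := ⟨x, hx, fun i hi => (Finset.mem_filter.1 hi).2⟩
  obtain ⟨R, hR⟩ := exists_inner_eq_of_linearIndependent (S.linearIndependent J hJ)
  have hRc : Continuous R := R.continuous_of_finiteDimensional
  have key : ∀ᶠ h in nhds h₀, ∀ i ∉ J, inner ℝ (x + R (h - h₀)) (u i) ≤ h i := by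
    refine Filter.eventually_all.2 fun i => ?_
    by_cases hi : i ∈ J
    · exact Filter.Eventually.of_forall fun h hh => absurd hi hh
    · have hlt : inner ℝ x (u i) < h₀ i := lt_of_le_of_ne (hx i) fun e => hi (by simp [J, e])
      have hc : ContinuousAt (fun h => inner ℝ (x + R (h - h₀)) (u i)) h₀ := by fun_prop
      have hc' : ContinuousAt (fun h : ι → ℝ => h i) h₀ := (continuous_apply i).continuousAt
      exact (hc.eventually_lt hc' (by simpa using hlt)).mono fun h hh _ => hh.le
  filter_upwards [key] with h hh _
  have htight : ∀ i ∈ J, inner ℝ (x + R (h - h₀)) (u i) = h i := fun i hi => by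
    rw [inner_add_left, hR _ i hi, (Finset.mem_filter.1 hi).2]
    simp
  exact ⟨x + R (h - h₀), fun i => if hi : i ∈ J then (htight i hi).le else hh i hi,
    fun i hi => htight i (by simp [J, hxI i hi])⟩

theorem hpoly_add (S : IsSimpleSystem u h₀) {h h' : ι → ℝ} (hh : h ∈ typeCone u h₀)
    (hh' : h' ∈ typeCone u h₀) : hpoly u (h + h') = hpoly u h + hpoly u h' := by
  classical
  refine subset_antisymm (fun z hz => ?_) (hpoly_add_subset u h h')
  by_contra hzn
  have hcomp : IsCompact (hpoly u h + hpoly u h') := (S.isCompact h).add (S.isCompact h')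
  obtain ⟨f, s, hfs, hsz⟩ := geometric_hahn_banach_closed_point
    ((convex_hpoly u h).add (convex_hpoly u h')) hcomp.isClosed hzn
  let c : E := (InnerProductSpace.toDual ℝ E).symm f
  have hfc : ∀ y, f y = inner ℝ y c := fun y => by
    rw [real_inner_comm]
    simp [c]
  obtain ⟨x₀, hx₀, hmax⟩ := (S.isCompact h₀).exists_isMaxOn S.nonempty
    (f := fun y => inner ℝ y c) (by fun_prop)
  let J : Finset ι := Finset.univ.filter fun i => inner ℝ x₀ (u i) = h₀ i
  have hJ : IsFace u h₀ J := ⟨x₀, hx₀, fun i hi => (Finset.mem_filter.1 hi).2⟩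
  obtain ⟨a, ha, hca⟩ := exists_nonneg_combination hx₀ (fun y hy => hmax hy)
    (I := J) (by simp [J]) (S.linearIndependent J hJ)
  obtain ⟨x, hx, hxJ⟩ := hh J hJ
  obtain ⟨y, hy, hyJ⟩ := hh' J hJ
  have h1 := hfs (x + y) (add_mem_add hx hy)
  rw [hfc] at h1 hsz
  have h2 : inner ℝ z c ≤ inner ℝ (x + y) c := by
    rw [hca, inner_sum, inner_sum]
    refine Finset.sum_le_sum fun i hi => ?_
    rw [real_inner_smul_right, real_inner_smul_right, inner_add_left, hxJ i hi, hyJ i hi]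
    exact mul_le_mul_of_nonneg_left (hz i) (ha i)
  linarith

theorem isFace_add_iff (S : IsSimpleSystem u h₀) {h h' : ι → ℝ} (hh : h ∈ typeCone u h₀)
    (hh' : h' ∈ typeCone u h₀) {I : Finset ι} :
    IsFace u (h + h') I ↔ IsFace u h I ∧ IsFace u h' I := by
  refine ⟨fun ⟨x, hx, hxI⟩ => ?_, fun H => H.1.add H.2⟩
  rw [S.hpoly_add hh hh'] at hx
  obtain ⟨y, hy, z, hz, rfl⟩ := hx
  have : ∀ i ∈ I, inner ℝ y (u i) = h i ∧ inner ℝ z (u i) = h' i := fun i hi => by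
    have h1 := hxI i hi
    have h2 := hy i
    have h3 := hz i
    simp only [inner_add_left, Pi.add_apply] at h1
    constructor <;> linarith
  exact ⟨⟨y, hy, fun i hi => (this i hi).1⟩, ⟨z, hz, fun i hi => (this i hi).2⟩⟩

theorem isFace_iff (S : IsSimpleSystem u h₀) {h : ι → ℝ} (hh : h ∈ interior (typeCone u h₀))
    {I : Finset ι} : IsFace u h I ↔ IsFace u h₀ I := by
  refine ⟨fun H => ?_, fun H => interior_subset hh I H⟩
  have hev : ∀ᶠ t : ℝ in nhdsWithin 0 (Ioi 0), h - t • h₀ ∈ typeCone u h₀ := by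
    have hc : Filter.Tendsto (fun t : ℝ => h - t • h₀) (nhds 0) (nhds h) :=
      Continuous.tendsto' (by fun_prop) _ _ (by simp)
    exact (hc.eventually (mem_interior_iff_mem_nhds.1 hh)).filter_mono nhdsWithin_le_nhds
  obtain ⟨t, ht, ht0⟩ := (hev.and self_mem_nhdsWithin).exists
  have ht0 : 0 < t := ht0
  have h1 : IsFace u ((h - t • h₀) + t • h₀) I := by simpa using H
  exact (isFace_smul_iff ht0).1 ((S.isFace_add_iff ht fun J hJ => hJ.smul ht0.le).1 h1).2

theorem exists_insert [DecidableEq ι] (S : IsSimpleSystem u h₀) {I : Finset ι}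
    (hI : IsFace u h₀ I) (hcard : I.card < Module.finrank ℝ E) :
    ∃ j ∉ I, IsFace u h₀ (insert j I) := by
  classical
  by_contra! hno
  let W : Submodule ℝ E := Submodule.span ℝ (I.image u : Set E)
  have hW : W ≠ ⊤ := fun hW => by
    have h1 := finrank_span_finset_le_card (R := ℝ) (I.image u)
    have h2 : Module.finrank ℝ W = Module.finrank ℝ E := by rw [hW, finrank_top]
    have h3 := Finset.card_image_le (s := I) (f := u)
    have h4 : Module.finrank ℝ W ≤ (I.image u).card := h1
    omega
  obtain ⟨d, hd, hd0⟩ := (Submodule.ne_bot_iff _).1 fun e =>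
    hW (Submodule.orthogonal_eq_bot_iff.1 e)
  have hdI : ∀ i ∈ I, inner ℝ d (u i) = 0 := fun i hi => by
    rw [real_inner_comm]
    exact (Submodule.mem_orthogonal _ _).1 hd _
      (Submodule.subset_span (by simpa using ⟨i, hi, rfl⟩))
  let F : Set E := hpoly u h₀ ∩ {x | ∀ i ∈ I, inner ℝ x (u i) = h₀ i}
  have hF : IsCompact F := (S.isCompact h₀).inter_right (by
    have : {x : E | ∀ i ∈ I, inner ℝ x (u i) = h₀ i} = ⋂ i ∈ I, {x | inner ℝ x (u i) = h₀ i} := by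
      ext; simp
    rw [this]
    exact isClosed_biInter fun i _ => isClosed_eq (by fun_prop) continuous_const)
  obtain ⟨w, hw, hwI⟩ := hI
  obtain ⟨y, ⟨hy, hyI⟩, hmax⟩ := hF.exists_isMaxOn ⟨w, hw, hwI⟩ (f := fun y => inner ℝ y d)
    (by fun_prop)
  have hyI : ∀ i ∈ I, inner ℝ y (u i) = h₀ i := hyI
  have hstrict : ∀ i ∉ I, inner ℝ y (u i) < h₀ i := fun i hi =>
    lt_of_le_of_ne (hy i) fun e => hno i hi ⟨y, hy, fun k hk => by
      rcases Finset.mem_insert.1 hk with rfl | hk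
      · exact e
      · exact hyI k hk⟩
  have hev : ∀ᶠ t : ℝ in nhdsWithin 0 (Ioi 0), ∀ i ∉ I, inner ℝ (y + t • d) (u i) < h₀ i := by
    refine Filter.eventually_all.2 fun i => ?_
    by_cases hi : i ∈ I
    · exact Filter.Eventually.of_forall fun t ht => absurd hi ht
    · have hc : ContinuousAt (fun t : ℝ => inner ℝ (y + t • d) (u i)) 0 := by fun_prop
      exact ((hc.eventually_lt continuousAt_const (by simpa using hstrict i hi)).filter_mono
        nhdsWithin_le_nhds).mono fun t ht _ => ht
  obtain ⟨t, ht, ht0⟩ := (hev.and self_mem_nhdsWithin).exists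
  have ht0 : 0 < t := ht0
  have htI : ∀ i ∈ I, inner ℝ (y + t • d) (u i) = h₀ i := fun i hi => by
    rw [inner_add_left, real_inner_smul_left, hdI i hi, hyI i hi]; ring
  have h1 : inner ℝ (y + t • d) d ≤ inner ℝ y d := hmax
    ⟨fun i => if hi : i ∈ I then (htI i hi).le else (ht i hi).le, htI⟩
  rw [inner_add_left, real_inner_smul_left, real_inner_self_eq_norm_sq] at h1
  have := mul_pos ht0 (pow_pos (norm_pos_iff.2 hd0) 2)
  linarith

theorem card_le (S : IsSimpleSystem u h₀) {I : Finset ι} (hI : IsFace u h₀ I) :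
    I.card ≤ Module.finrank ℝ E := by
  simpa using (S.linearIndependent I hI).fintype_card_le_finrank

end IsSimpleSystem

end SimplePolytopes

/-! ### Volumes of polytopes and iterated differences -/

section Volume

variable {n : ℕ} {ι : Type*}

/-- The volume of a polytope as a function of its support vector. -/
def hvol (u : ι → EuclideanSpace ℝ (Fin n)) (h : ι → ℝ) : ℝ := (volume (hpoly u h)).toReal

/-- Points exceeding exactly the constraints in `I`, by at most `δ`. -/
def slab [DecidableEq ι] (u : ι → EuclideanSpace ℝ (Fin n)) (h : ι → ℝ) (δ : ℝ) (I : Finset ι) :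
    Set (EuclideanSpace ℝ (Fin n)) :=
  {x | (∀ i, inner ℝ x (u i) ≤ h i + if i ∈ I then δ else 0) ∧ ∀ i ∈ I, h i < inner ℝ x (u i)}

/-- Iterated forward differences in the directions of a list of indices. -/
def mdiff [DecidableEq ι] (δ : ℝ) : List ι → ((ι → ℝ) → ℝ) → (ι → ℝ) → ℝ
  | [], f, h => f h
  | j :: l, f, h => mdiff δ l f (h + δ • Pi.single j 1) - mdiff δ l f h

theorem hvol_smul (u : ι → EuclideanSpace ℝ (Fin n)) (h : ι → ℝ) {c : ℝ} (hc : 0 < c) :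
    hvol u (c • h) = c ^ n * hvol u h := by
  rw [hvol, hpoly_smul u h hc, Measure.addHaar_smul, ENNReal.toReal_mul, finrank_euclideanSpace,
    Fintype.card_fin, abs_of_pos (pow_pos hc n), ENNReal.toReal_ofReal (pow_pos hc n).le, hvol]

theorem hvol_add_pairing (u : ι → EuclideanSpace ℝ (Fin n)) (h : ι → ℝ)
    (v : EuclideanSpace ℝ (Fin n)) : hvol u (h + pairing u v) = hvol u h := by
  rw [hvol, hpoly_add_pairing, image_add_right, measure_preimage_add_right, hvol]

theorem slab_add_single [DecidableEq ι] {u : ι → EuclideanSpace ℝ (Fin n)} (h : ι → ℝ) {δ : ℝ}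
    (hδ : 0 ≤ δ) {j : ι} {I : Finset ι} (hj : j ∉ I) :
    slab u (h + δ • Pi.single j 1) δ I = slab u h δ (insert j I) ∪ slab u h δ I := by
  have hne : ∀ i, i ∈ I → i ≠ j := fun i hi e => hj (e ▸ hi)
  ext x
  simp only [slab, mem_union, mem_ofPred_eq]
  constructor
  · rintro ⟨h1, h2⟩
    have h2' : ∀ i ∈ I, h i < inner ℝ x (u i) := fun i hi => by
      simpa [hne i hi] using h2 i hi
    by_cases hxj : h j < inner ℝ x (u j)
    · left
      refine ⟨fun i => ?_, fun i hi => ?_⟩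
      · by_cases hij : i = j
        · subst hij
          simpa [hj] using h1 i
        · simpa [hij] using h1 i
      · rcases Finset.mem_insert.1 hi with rfl | hi
        · exact hxj
        · exact h2' i hi
    · right
      refine ⟨fun i => ?_, h2'⟩
      by_cases hij : i = j
      · subst hij
        simpa [hj] using hxj
      · simpa [hij] using h1 i
  · rintro (⟨h1, h2⟩ | ⟨h1, h2⟩)
    · refine ⟨fun i => ?_, fun i hi => ?_⟩
      · by_cases hij : i = j
        · subst hij
          simpa [hj] using h1 i
        · simpa [hij] using h1 i
      · simpa [hne i hi] using h2 i (Finset.mem_insert_of_mem hi)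
    · refine ⟨fun i => ?_, fun i hi => ?_⟩
      · by_cases hij : i = j
        · subst hij
          have := h1 i
          simp only [hj, if_false, add_zero] at this
          simp [hj]
          linarith
        · simpa [hij] using h1 i
      · simpa [hne i hi] using h2 i hi

variable [Fintype ι]

theorem measurableSet_slab [DecidableEq ι] (u : ι → EuclideanSpace ℝ (Fin n)) (h : ι → ℝ) (δ : ℝ)
    (I : Finset ι) : MeasurableSet (slab u h δ I) := by
  have : slab u h δ I = (⋂ i, {x | inner ℝ x (u i) ≤ h i + if i ∈ I then δ else 0}) ∩
      ⋂ i ∈ I, {x | h i < inner ℝ x (u i)} := by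
    ext; simp [slab]
  rw [this]
  refine (MeasurableSet.iInter fun i => ?_).inter (Finset.measurableSet_biInter _ fun i _ => ?_)
  · exact (isClosed_le (by fun_prop) continuous_const).measurableSet
  · exact (isOpen_lt continuous_const (by fun_prop)).measurableSet

theorem isBounded_slab [DecidableEq ι] {u : ι → EuclideanSpace ℝ (Fin n)}
    (hu : ∀ d : EuclideanSpace ℝ (Fin n), d ≠ 0 → ∃ i, 0 < inner ℝ d (u i)) (h : ι → ℝ) (δ : ℝ)
    (I : Finset ι) : Bornology.IsBounded (slab u h δ I) := by
  obtain ⟨r, hr⟩ := isCompact_hpoly hu (fun i => h i + if i ∈ I then δ else 0)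
  exact Metric.isBounded_closedBall.subset (Subset.trans (fun x hx => hx.1) (hr _ le_rfl))

theorem continuous_hvol {u : ι → EuclideanSpace ℝ (Fin n)}
    (hu : ∀ d : EuclideanSpace ℝ (Fin n), d ≠ 0 → ∃ i, 0 < inner ℝ d (u i))
    (hu0 : ∀ i, u i ≠ 0) : Continuous (hvol u) := by
  have hmeas : ∀ h, MeasurableSet (hpoly u h) := fun h => (isClosed_hpoly u h).measurableSet
  have heq : hvol u = fun h => ∫ x, (hpoly u h).indicator (fun _ => (1 : ℝ)) x := by
    ext h
    rw [integral_indicator_const _ (hmeas h)]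
    simp [hvol, Measure.real]
  rw [heq, continuous_iff_continuousAt]
  intro h
  obtain ⟨r, hr⟩ := isCompact_hpoly hu (h + 1)
  refine continuousAt_of_dominated
    (bound := (Metric.closedBall (0 : EuclideanSpace ℝ (Fin n)) r).indicator fun _ => 1) ?_ ?_ ?_ ?_
  · exact Filter.Eventually.of_forall fun h' =>
      (measurable_const.indicator (hmeas h')).aestronglyMeasurable
  · filter_upwards [Metric.ball_mem_nhds h one_pos] with h' hh'
    refine Filter.Eventually.of_forall fun x => ?_
    rw [Real.norm_of_nonneg (indicator_nonneg (fun _ _ => zero_le_one) x)]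
    refine indicator_le_indicator_of_subset (hr h' fun i => ?_) (fun _ => zero_le_one) x
    have h1 := (dist_le_pi_dist h' h i).trans (Metric.mem_ball.1 hh').le
    rw [Real.dist_eq] at h1
    have := (abs_le.1 h1).2
    simp only [Pi.add_apply, Pi.one_apply]
    linarith
  · rw [integrable_indicator_iff measurableSet_closedBall]
    exact integrableOn_const (measure_closedBall_lt_top.ne)
  · have hnull : ∀ᵐ x : EuclideanSpace ℝ (Fin n), ∀ i, inner ℝ x (u i) ≠ h i := by
      refine ae_all_iff.2 fun i => ?_
      let s : AffineSubspace ℝ (EuclideanSpace ℝ (Fin n)) :=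
        (AffineSubspace.mk' (h i) ⊥).comap
          (((innerSL ℝ (u i)).toLinearMap).toAffineMap)
      have hs : (s : Set (EuclideanSpace ℝ (Fin n))) = {x | inner ℝ x (u i) = h i} := by
        ext x
        simp [s, real_inner_comm, sub_eq_zero]
      have hne : s ≠ ⊤ := fun e => by
        have h0 : (0 : EuclideanSpace ℝ (Fin n)) ∈ (s : Set (EuclideanSpace ℝ (Fin n))) := by
          rw [e]; simp
        have h1 : u i ∈ (s : Set (EuclideanSpace ℝ (Fin n))) := by rw [e]; simp
        rw [hs] at h0 h1
        have h0 : inner ℝ 0 (u i) = h i := h0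
        have h1 : inner ℝ (u i) (u i) = h i := h1
        rw [← h0, inner_zero_left] at h1
        exact hu0 i (inner_self_eq_zero.1 h1)
      have := Measure.addHaar_affineSubspace volume s hne
      rw [hs] at this
      simpa [ae_iff] using this
    filter_upwards [hnull] with x hx
    by_cases hxm : x ∈ hpoly u h
    · have hev : ∀ᶠ h' in nhds h, x ∈ hpoly u h' := by
        refine Filter.eventually_all.2 fun i => ?_
        exact (continuousAt_const.eventually_lt (continuous_apply i).continuousAt
          (lt_of_le_of_ne (hxm i) (hx i))).mono fun _ => le_of_lt
      refine (continuousAt_const (y := (1 : ℝ))).congr ?_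
      filter_upwards [hev] with h' hh'
      simp [hh']
    · have : ∃ i, h i < inner ℝ x (u i) := by simpa [hpoly] using hxm
      obtain ⟨i, hi⟩ := this
      have hev : ∀ᶠ h' in nhds h, x ∉ hpoly u h' :=
        ((continuous_apply i).continuousAt.eventually_lt continuousAt_const hi).mono
          fun h' hh' hm => absurd (hm i) (not_le.2 hh')
      refine (continuousAt_const (y := (0 : ℝ))).congr ?_
      filter_upwards [hev] with h' hh'
      simp [hh']

variable [DecidableEq ι]

theorem mdiff_hvol {u : ι → EuclideanSpace ℝ (Fin n)}
    (hu : ∀ d : EuclideanSpace ℝ (Fin n), d ≠ 0 → ∃ i, 0 < inner ℝ d (u i)) {δ : ℝ} (hδ : 0 ≤ δ)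
    {l : List ι} (hl : l.Nodup) (h : ι → ℝ) :
    mdiff δ l (hvol u) h = (volume (slab u h δ l.toFinset)).toReal := by
  induction l generalizing h with
  | nil => simp [mdiff, slab, hvol, hpoly]
  | cons j l ih =>
    obtain ⟨hj, hl⟩ := List.nodup_cons.1 hl
    have hj' : j ∉ l.toFinset := by simpa using hj
    have hdisj : Disjoint (slab u h δ (insert j l.toFinset)) (slab u h δ l.toFinset) := by
      refine Set.disjoint_left.2 fun x hx hx' => ?_
      have h1 := hx.2 j (Finset.mem_insert_self _ _)
      have h2 := hx'.1 j
      simp only [hj', if_false, add_zero] at h2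
      linarith
    rw [mdiff, ih hl, ih hl, slab_add_single h hδ hj',
      measure_union hdisj (measurableSet_slab u h δ _),
      ENNReal.toReal_add (isBounded_slab hu h δ _).measure_lt_top.ne
      (isBounded_slab hu h δ _).measure_lt_top.ne, List.toFinset_cons]
    ring

theorem volume_slab_mul_le {u : ι → EuclideanSpace ℝ (Fin n)}
    (hu : ∀ d : EuclideanSpace ℝ (Fin n), d ≠ 0 → ∃ i, 0 < inner ℝ d (u i)) (h h' : ι → ℝ) (δ : ℝ)
    (I : Finset ι) :
    volume (slab u h δ I) * volume (slab u h' δ I) ≤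
      volume (slab u ((1 / 2 : ℝ) • (h + h')) δ I) ^ 2 := by
  refine volume_mul_le_midpoints (measurableSet_slab u _ _ _) (measurableSet_slab u _ _ _)
    (measurableSet_slab u _ _ _) (isBounded_slab hu _ _ _) (isBounded_slab hu _ _ _)
    (isBounded_slab hu _ _ _) fun x hx y hy => ⟨fun i => ?_, fun i hi => ?_⟩
  · have h1 := hx.1 i
    have h2 := hy.1 i
    simp only [inner_smul_left, inner_add_left, Pi.smul_apply, Pi.add_apply, smul_eq_mul]
    simp only [conj_trivial]
    linarith
  · have h1 := hx.2 i hi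
    have h2 := hy.2 i hi
    simp only [inner_smul_left, inner_add_left, Pi.smul_apply, Pi.add_apply, smul_eq_mul]
    simp only [conj_trivial]
    linarith

variable {u : ι → EuclideanSpace ℝ (Fin n)} {h₀ : ι → ℝ}

theorem IsSimpleSystem.slab_eq_empty (S : IsSimpleSystem u h₀) {h : ι → ℝ} {δ : ℝ} (hδ : 0 ≤ δ)
    (hh : Metric.closedBall h δ ⊆ interior (typeCone u h₀)) {I : Finset ι}
    (hI : ¬ IsFace u h₀ I) : slab u h δ I = ∅ := by
  refine eq_empty_of_forall_notMem fun x hx => hI ?_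
  let g : ι → ℝ := fun i => if i ∈ I then inner ℝ x (u i) else h i
  have hg : g ∈ interior (typeCone u h₀) := by
    refine hh ((dist_pi_le_iff hδ).2 fun i => ?_)
    rw [Real.dist_eq]
    by_cases hi : i ∈ I
    · have h1 := hx.1 i
      have h2 := hx.2 i hi
      simp only [hi, if_true] at h1
      simp only [g, hi, if_true]
      rw [abs_of_pos (by linarith)]
      linarith
    · simpa [g, hi] using hδ
  refine (S.isFace_iff hg).1 ⟨x, fun i => ?_, fun i hi => by simp [g, hi]⟩
  by_cases hi : i ∈ I
  · simp [g, hi]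
  · simpa [g, hi] using hx.1 i

theorem IsSimpleSystem.exists_le_volume_slab (S : IsSimpleSystem u h₀) {I : Finset ι}
    (hI : IsFace u h₀ I) :
    ∃ c : ℝ, 0 < c ∧ ∀ᶠ δ in nhdsWithin (0 : ℝ) (Ioi 0),
      c * δ ^ n ≤ (volume (slab u h₀ δ I)).toReal := by
  obtain ⟨x, hxI, hx⟩ := hI.exists_strict S.mem_interior
  obtain ⟨R, hR⟩ := exists_inner_eq_of_linearIndependent (S.linearIndependent I hI)
  let P : Set (EuclideanSpace ℝ (Fin n)) :=
    Metric.ball (R 1) 1 ∩ ⋂ i ∈ I, ({y | 0 < inner ℝ y (u i)} ∩ {y | inner ℝ y (u i) < 2})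
  have hPo : IsOpen P := Metric.isOpen_ball.inter (isOpen_biInter_finset fun i _ =>
    (isOpen_lt (f := fun _ => 0) (g := fun y => inner ℝ y (u i)) (by fun_prop)
      (by fun_prop)).inter
    (isOpen_lt (f := fun y => inner ℝ y (u i)) (g := fun _ => 2) (by fun_prop) (by fun_prop)))
  have hPn : P.Nonempty := ⟨R 1, Metric.mem_ball_self one_pos, by
    simp only [mem_iInter]
    intro i hi
    simp [hR 1 i hi]⟩
  have hPb : Bornology.IsBounded P := Metric.isBounded_ball.subset inter_subset_left
  refine ⟨(volume P).toReal * (1 / 2) ^ n, mul_pos (ENNReal.toReal_pos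
    (hPo.measure_pos volume hPn).ne' hPb.measure_lt_top.ne) (by positivity), ?_⟩
  have hev : ∀ᶠ δ in nhdsWithin (0 : ℝ) (Ioi 0), ∀ i ∉ I, ∀ y ∈ P,
      inner ℝ (x + (δ / 2) • y) (u i) ≤ h₀ i := by
    refine Filter.eventually_all.2 fun i => ?_
    by_cases hi : i ∈ I
    · exact Filter.Eventually.of_forall fun δ hδ => absurd hi hδ
    · have hc : ContinuousAt (fun δ : ℝ => inner ℝ x (u i) + δ / 2 * ((‖R 1‖ + 1) * ‖u i‖)) 0 := by
        fun_prop
      filter_upwards [(hc.eventually_lt continuousAt_const (by simpa using hx i hi)).filter_mono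
        nhdsWithin_le_nhds, self_mem_nhdsWithin] with δ hδ hδ0 _ y hy
      have hδ0 : 0 < δ := hδ0
      rw [inner_add_left, real_inner_smul_left]
      refine le_trans ?_ hδ.le
      have h1 : ‖y‖ ≤ ‖R 1‖ + 1 := by
        have := mem_ball_iff_norm.1 hy.1
        have h2 := norm_le_norm_add_norm_sub' y (R 1)
        linarith
      have h2 := (real_inner_le_norm y (u i)).trans
        (mul_le_mul_of_nonneg_right h1 (norm_nonneg (u i)))
      have := mul_le_mul_of_nonneg_left h2 (by linarith : (0 : ℝ) ≤ δ / 2)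
      linarith
  filter_upwards [hev, self_mem_nhdsWithin] with δ hδ hδ0
  have hδ0 : 0 < δ := hδ0
  have hsub : (fun z => x + z) '' ((δ / 2) • P) ⊆ slab u h₀ δ I := by
    rintro _ ⟨_, ⟨y, hy, rfl⟩, rfl⟩
    have hyI : ∀ i ∈ I, 0 < inner ℝ y (u i) ∧ inner ℝ y (u i) < 2 := fun i hi => by
      have := hy.2
      simp only [mem_iInter] at this
      exact this i hi
    refine ⟨fun i => ?_, fun i hi => ?_⟩
    · by_cases hi : i ∈ I
      · simp only [hi, if_true, inner_add_left, real_inner_smul_left, hxI i hi]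
        nlinarith [hyI i hi]
      · simpa [hi] using hδ i hi y hy
    · simp only [inner_add_left, real_inner_smul_left, hxI i hi]
      nlinarith [hyI i hi]
  have h1 := ENNReal.toReal_mono (isBounded_slab S.pos h₀ δ I).measure_lt_top.ne
    (measure_mono (μ := volume) hsub)
  rw [image_add_left, measure_preimage_add, Measure.addHaar_smul, ENNReal.toReal_mul,
    finrank_euclideanSpace, Fintype.card_fin, abs_of_pos (by positivity),
    ENNReal.toReal_ofReal (by positivity)] at h1
  refine le_trans (le_of_eq ?_) h1
  rw [div_pow, div_pow, one_pow]
  ring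

end Volume

/-! ### Iterated partial derivatives -/

section Partials

open scoped ContDiff

variable {ι : Type*} [Fintype ι]

/-- The derivative in direction `z`, as an operator on functions. -/
def ddir (z : ι → ℝ) (g : (ι → ℝ) → ℝ) : (ι → ℝ) → ℝ := fun h => fderiv ℝ g h z

/-- The iterated partial derivative along a list of indices. -/
def pd [DecidableEq ι] : List ι → ((ι → ℝ) → ℝ) → (ι → ℝ) → ℝ
  | [], g => g
  | j :: l, g => ddir (Pi.single j 1) (pd l g)

theorem contDiff_ddir {g : (ι → ℝ) → ℝ} (hg : ContDiff ℝ ∞ g) (z : ι → ℝ) :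
    ContDiff ℝ ∞ (ddir z g) :=
  (hg.fderiv_right (m := ∞) le_rfl).clm_apply contDiff_const

theorem hasDerivAt_ddir {g : (ι → ℝ) → ℝ} (hg : ContDiff ℝ ∞ g) (h z : ι → ℝ) (t : ℝ) :
    HasDerivAt (fun t : ℝ => g (h + t • z)) (ddir z g (h + t • z)) t := by
  have h1 : HasDerivAt (fun t : ℝ => h + t • z) z t := by
    simpa using ((hasDerivAt_id t).smul_const z).const_add h
  exact ((hg.differentiable (by simp)).differentiableAt.hasFDerivAt).comp_hasDerivAt t h1

theorem ddir_comm {g : (ι → ℝ) → ℝ} (hg : ContDiff ℝ ∞ g) (y z : ι → ℝ) :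
    ddir y (ddir z g) = ddir z (ddir y g) := by
  ext h
  have hd : DifferentiableAt ℝ (fderiv ℝ g) h :=
    ((hg.fderiv_right (m := ∞) le_rfl).differentiable (by simp)).differentiableAt
  have key : ∀ y z, ddir y (ddir z g) h = fderiv ℝ (fderiv ℝ g) h y z := fun y z => by
    change fderiv ℝ (fun h => fderiv ℝ g h z) h y = _
    rw [fderiv_clm_apply hd (differentiableAt_const z)]
    simp
  rw [key, key]
  exact (hg.contDiffAt.isSymmSndFDerivAt (by simpa using ENat.LEInfty.out)) y z

theorem ddir_eq_sum [DecidableEq ι] (g : (ι → ℝ) → ℝ) (z h : ι → ℝ) :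
    ddir z g h = ∑ i, z i * ddir (Pi.single i 1) g h := by
  simp only [ddir]
  conv_lhs => rw [← Finset.univ_sum_single z]
  rw [map_sum]
  refine Finset.sum_congr rfl fun i _ => ?_
  rw [← smul_eq_mul, ← map_smul]
  congr 1
  ext j
  by_cases hij : j = i
  · subst hij; simp
  · simp [hij]

theorem ddir_eq_zero_of_isOpen {g : (ι → ℝ) → ℝ} {U : Set (ι → ℝ)} (hU : IsOpen U)
    (hg : ∀ h ∈ U, g h = 0) (z : ι → ℝ) : ∀ h ∈ U, ddir z g h = 0 := by
  intro h hh
  have : g =ᶠ[nhds h] fun _ => 0 := Filter.eventually_of_mem (hU.mem_nhds hh) hg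
  simp [ddir, this.fderiv_eq]

theorem contDiff_eval (p : MvPolynomial ι ℝ) : ContDiff ℝ ∞ fun h => MvPolynomial.eval h p := by
  induction p using MvPolynomial.induction_on with
  | C a => simpa using contDiff_const
  | add p q hp hq => simpa using hp.add hq
  | mul_X p i hp => simpa using hp.mul (contDiff_apply ℝ ℝ i)

theorem ddir_eval (z : ι → ℝ) (p : MvPolynomial ι ℝ) :
    ddir z (fun h => MvPolynomial.eval h p) = fun h => MvPolynomial.eval h (dirD z p) := by
  ext h
  simpa using (hasDerivAt_ddir (contDiff_eval p) h z 0).unique (hasDerivAt_eval_line p h z 0)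

variable [DecidableEq ι]

theorem contDiff_pd {g : (ι → ℝ) → ℝ} (hg : ContDiff ℝ ∞ g) (l : List ι) :
    ContDiff ℝ ∞ (pd l g) := by
  induction l with
  | nil => exact hg
  | cons j l ih => exact contDiff_ddir ih _

theorem ddir_pd {g : (ι → ℝ) → ℝ} (hg : ContDiff ℝ ∞ g) (z : ι → ℝ) (l : List ι) :
    ddir z (pd l g) = pd l (ddir z g) := by
  induction l with
  | nil => rfl
  | cons j l ih => rw [pd, ddir_comm (contDiff_pd hg l), ih, pd]

theorem pd_perm {g : (ι → ℝ) → ℝ} (hg : ContDiff ℝ ∞ g) {l l' : List ι} (hl : l.Perm l') :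
    pd l g = pd l' g := by
  induction hl with
  | nil => rfl
  | cons j _ ih => rw [pd, pd, ih]
  | swap i j l => rw [pd, pd, pd, pd, ddir_comm (contDiff_pd hg l)]
  | trans _ _ ih ih' => exact ih.trans ih'

theorem pd_append_eq_zero {g : (ι → ℝ) → ℝ} {U : Set (ι → ℝ)} (hU : IsOpen U) {l : List ι}
    (hl : ∀ h ∈ U, pd l g h = 0) (l' : List ι) : ∀ h ∈ U, pd (l' ++ l) g h = 0 := by
  induction l' with
  | nil => exact hl
  | cons j l' ih => exact ddir_eq_zero_of_isOpen hU ih _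

theorem hasDerivAt_mdiff {g : (ι → ℝ) → ℝ} (hg : ContDiff ℝ ∞ g) (δ : ℝ) (l : List ι)
    (h z : ι → ℝ) (t : ℝ) :
    HasDerivAt (fun t : ℝ => mdiff δ l g (h + t • z)) (mdiff δ l (ddir z g) (h + t • z)) t := by
  induction l generalizing h with
  | nil => exact hasDerivAt_ddir hg h z t
  | cons j l ih =>
    have := (ih (h + δ • Pi.single j 1)).sub (ih h)
    simp only [mdiff]
    simpa only [add_right_comm, Pi.sub_def] using this

theorem exists_mdiff_eq {g : (ι → ℝ) → ℝ} (hg : ContDiff ℝ ∞ g) {δ : ℝ} (hδ : 0 < δ)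
    (l : List ι) (h : ι → ℝ) :
    ∃ ξ, ‖ξ - h‖ ≤ l.length * δ ∧ mdiff δ l g h = δ ^ l.length * pd l g ξ := by
  induction l generalizing g h with
  | nil => exact ⟨h, by simp, by simp [mdiff, pd]⟩
  | cons j l ih =>
    let e : ι → ℝ := Pi.single j 1
    obtain ⟨t, ht, hslope⟩ := exists_hasDerivAt_eq_slope
      (fun t : ℝ => mdiff δ l g (h + t • e)) (fun t => mdiff δ l (ddir e g) (h + t • e)) hδ
      (fun t _ => (hasDerivAt_mdiff hg δ l h e t).continuousAt.continuousWithinAt)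
      (fun t _ => hasDerivAt_mdiff hg δ l h e t)
    obtain ⟨ξ, hξ, hξ'⟩ := ih (contDiff_ddir hg e) (h + t • e)
    refine ⟨ξ, ?_, ?_⟩
    · have h1 : ‖t • e‖ ≤ δ := by
        have he : ‖e‖ ≤ 1 := (pi_norm_le_iff_of_nonneg zero_le_one).2 fun i => by
          by_cases hij : i = j
          · subst hij; simp [e]
          · simp [e, hij]
        rw [norm_smul, Real.norm_of_nonneg ht.1.le]
        nlinarith [ht.1, ht.2, norm_nonneg e]
      have h2 : ξ - h = (ξ - (h + t • e)) + t • e := by abel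
      rw [h2]
      refine (norm_add_le _ _).trans ((add_le_add hξ h1).trans (le_of_eq ?_))
      push_cast [List.length_cons]
      ring
    · rw [mdiff, pd, ddir_pd hg]
      rw [hξ', eq_div_iff (by linarith)] at hslope
      simp only [zero_smul, add_zero, sub_zero] at hslope
      change mdiff δ l g (h + δ • e) - mdiff δ l g h = _
      rw [← hslope, List.length_cons]
      ring

theorem tendsto_mdiff {g : (ι → ℝ) → ℝ} (hg : ContDiff ℝ ∞ g) (l : List ι) (h : ι → ℝ) :
    Filter.Tendsto (fun δ : ℝ => mdiff δ l g h / δ ^ l.length) (nhdsWithin 0 (Ioi 0))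
      (nhds (pd l g h)) := by
  choose ξ hξ hξ' using fun δ : Ioi (0 : ℝ) => exists_mdiff_eq hg δ.2 l h
  rw [Metric.tendsto_nhdsWithin_nhds]
  intro ε hε
  obtain ⟨r, hr, hball⟩ := Metric.continuousAt_iff.1 (contDiff_pd hg l).continuous.continuousAt ε hε
  refine ⟨r / (l.length + 1), by positivity, fun δ hδ hδr => ?_⟩
  have hδ0 : 0 < δ := hδ
  rw [hξ' ⟨δ, hδ⟩, mul_div_cancel_left₀ _ (pow_pos hδ0 _).ne']
  refine hball (x := ξ ⟨δ, hδ⟩) ?_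
  rw [dist_eq_norm]
  refine (hξ ⟨δ, hδ⟩).trans_lt ?_
  rw [Real.dist_eq, sub_zero, abs_of_pos hδ0, lt_div_iff₀ (by positivity)] at hδr
  simp only
  nlinarith

/-- A smooth function whose derivatives of order `n` vanish on a convex open set is polynomial of
degree less than `n` along lines. -/
theorem exists_taylor_polynomial (n : ℕ) {g : (ι → ℝ) → ℝ} (hg : ContDiff ℝ ∞ g)
    {U : Set (ι → ℝ)} (hU : Convex ℝ U) {a : ι → ℝ} (ha : a ∈ U)
    (hpd : ∀ l : List ι, l.length = n → ∀ h ∈ U, pd l g h = 0) :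
    ∃ c : ℕ → MvPolynomial ι ℝ, (∀ k, (c k).totalDegree ≤ k) ∧ ∀ x, a + x ∈ U →
      ∀ t ∈ Icc (0 : ℝ) 1,
        g (a + t • x) = ∑ k ∈ Finset.range n, t ^ k * MvPolynomial.eval x (c k) := by
  have hseg : ∀ x, a + x ∈ U → ∀ t ∈ Icc (0 : ℝ) 1, a + t • x ∈ U := fun x hx t ht => by
    have := hU.add_smul_sub_mem ha hx ht
    simpa using this
  induction n generalizing g with
  | zero => exact ⟨0, by simp, fun x hx t ht => by simpa [pd] using hpd [] rfl _ (hseg x hx t ht)⟩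
  | succ n ih =>
    choose c hc hceq using fun i : ι => ih (contDiff_ddir hg (Pi.single i 1))
      fun l hl h hh => by
        rw [← ddir_pd hg]
        exact hpd (i :: l) (by simp [hl]) h hh
    let d : ℕ → MvPolynomial ι ℝ := fun k => match k with
      | 0 => MvPolynomial.C (g a)
      | k + 1 => (1 / ((k : ℝ) + 1)) • ∑ i, MvPolynomial.X i * c i k
    refine ⟨d, fun k => ?_, fun x hx t ht => ?_⟩
    · cases k with
      | zero => simp [d]
      | succ k =>
        refine (MvPolynomial.totalDegree_smul_le _ _).trans ?_
        refine MvPolynomial.totalDegree_finsetSum_le fun i _ => ?_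
        refine (MvPolynomial.totalDegree_mul _ _).trans ?_
        rw [MvPolynomial.totalDegree_X]
        have := hc i k
        omega
    · let F : ℝ → ℝ := fun t => g (a + t • x) -
        ∑ k ∈ Finset.range (n + 1), t ^ k * MvPolynomial.eval x (d k)
      have hF : ∀ t ∈ Icc (0 : ℝ) 1, HasDerivAt F 0 t := by
        intro t ht
        have h1 := hasDerivAt_ddir hg a x t
        have h2 : HasDerivAt (fun t : ℝ => ∑ k ∈ Finset.range (n + 1),
            t ^ k * MvPolynomial.eval x (d k)) (∑ k ∈ Finset.range (n + 1),
            k * t ^ (k - 1) * MvPolynomial.eval x (d k)) t := by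
          refine HasDerivAt.fun_sum fun k _ => ?_
          exact (hasDerivAt_pow k t).mul_const _
        refine (h1.sub h2).congr_deriv ?_
        rw [ddir_eq_sum, Finset.sum_range_succ', sub_eq_zero]
        simp only [Nat.cast_zero, zero_mul, add_zero, Nat.add_sub_cancel]
        simp_rw [hceq _ x hx t ht, Finset.mul_sum]
        rw [Finset.sum_comm]
        refine Finset.sum_congr rfl fun k _ => ?_
        simp only [d, MvPolynomial.smul_eval, map_sum, map_mul, MvPolynomial.eval_X]
        push_cast
        have hk : (k : ℝ) + 1 ≠ 0 := by positivity
        rw [Finset.mul_sum, Finset.mul_sum]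
        refine Finset.sum_congr rfl fun i _ => ?_
        field_simp
      have hconst := constant_of_has_deriv_right_zero
        (fun t ht => (hF t ht).continuousAt.continuousWithinAt)
        (fun t ht => (hF t (Ico_subset_Icc_self ht)).hasDerivWithinAt) t ht
      have h0 : F 0 = 0 := by
        simp [F, Finset.sum_range_succ', d]
      rw [h0] at hconst
      exact sub_eq_zero.1 hconst

end Partials

/-! ### The volume is polynomial on the type cone -/

section Polynomiality

open scoped ContDiff

variable {ι : Type*} [Fintype ι]

/-- A polynomial vanishing on a nonempty open set is zero. -/
theorem eq_zero_of_eval_eq_zero {p : MvPolynomial ι ℝ} {U : Set (ι → ℝ)} (hU : IsOpen U)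
    (hne : U.Nonempty) (hp : ∀ h ∈ U, MvPolynomial.eval h p = 0) : p = 0 := by
  obtain ⟨a, ha⟩ := hne
  obtain ⟨r, hr, hball⟩ := Metric.isOpen_iff.1 hU a ha
  refine MvPolynomial.funext_set (fun i => Metric.ball (a i) r) (fun i => ?_) fun x hx => ?_
  · rw [Real.ball_eq_Ioo]
    exact Ioo_infinite (by linarith)
  · rw [map_zero]
    refine hp x (hball ((dist_pi_lt_iff hr).2 fun i => hx i (mem_univ i)))

theorem eval_smul_of_isHomogeneous {p : MvPolynomial ι ℝ} {m : ℕ} (hp : p.IsHomogeneous m) (c : ℝ)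
    (h : ι → ℝ) : MvPolynomial.eval (c • h) p = c ^ m * MvPolynomial.eval h p := by
  rw [MvPolynomial.eval_eq', MvPolynomial.eval_eq', Finset.mul_sum]
  refine Finset.sum_congr rfl fun d hd => ?_
  have hm : ∑ i, d i = m := by
    rw [← hp (MvPolynomial.mem_support_iff.1 hd)]
    simp [Finsupp.weight_apply, Finsupp.sum_fintype]
  simp only [Pi.smul_apply, smul_eq_mul, mul_pow, Finset.prod_mul_distrib]
  rw [Finset.prod_pow_eq_pow_sum, hm]
  ring

/-- Mollification of a function by a bump function. -/
def mollify (φ : ContDiffBump (0 : ι → ℝ)) (f : (ι → ℝ) → ℝ) (x : ι → ℝ) : ℝ :=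
  ∫ t, φ.normed volume t * f (x - t)

theorem mollify_eq_convolution (φ : ContDiffBump (0 : ι → ℝ)) (f : (ι → ℝ) → ℝ) :
    mollify φ f = convolution (φ.normed volume) f (ContinuousLinearMap.lsmul ℝ ℝ) volume := rfl

theorem contDiff_mollify (φ : ContDiffBump (0 : ι → ℝ)) {f : (ι → ℝ) → ℝ} (hf : Continuous f) :
    ContDiff ℝ ∞ (mollify φ f) := by
  rw [mollify_eq_convolution]
  exact φ.hasCompactSupport_normed.contDiff_convolution_left _ φ.contDiff_normed
    hf.locallyIntegrable

variable [DecidableEq ι]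

theorem continuous_mdiff {f : (ι → ℝ) → ℝ} (hf : Continuous f) (δ : ℝ) (l : List ι) :
    Continuous (mdiff δ l f) := by
  induction l with
  | nil => exact hf
  | cons j l ih => exact (ih.comp (continuous_id.add continuous_const)).sub ih

theorem mdiff_mollify (φ : ContDiffBump (0 : ι → ℝ)) {f : (ι → ℝ) → ℝ} (hf : Continuous f)
    (δ : ℝ) (l : List ι) (h : ι → ℝ) :
    mdiff δ l (mollify φ f) h = mollify φ (mdiff δ l f) h := by
  induction l generalizing h with
  | nil => rfl
  | cons j l ih =>
    have hfi : ∀ h, Integrable fun t => φ.normed volume t * mdiff δ l f (h - t) := fun h => by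
      have hc := continuous_mdiff hf δ l
      exact (φ.continuous_normed.mul (hc.comp (by fun_prop))).integrable_of_hasCompactSupport
        φ.hasCompactSupport_normed.mul_right
    rw [mdiff, ih, ih, mollify, mollify, mollify, ← integral_sub (hfi _) (hfi _)]
    refine integral_congr_ae (Filter.Eventually.of_forall fun t => ?_)
    simp only [mdiff]
    rw [mul_sub, add_sub_right_comm]

variable {n : ℕ} {u : ι → EuclideanSpace ℝ (Fin n)} {h₀ : ι → ℝ}

/-- Translation invariance makes all partial derivatives of high order vanish once those along
non-faces do. -/
theorem IsSimpleSystem.pd_eq_zero (S : IsSimpleSystem u h₀) {g : (ι → ℝ) → ℝ}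
    (hg : ContDiff ℝ ∞ g) {U : Set (ι → ℝ)} (hU : IsOpen U)
    (hpair : ∀ v, ddir (pairing u v) g = 0)
    (hnon : ∀ l : List ι, l.Nodup → ¬ IsFace u h₀ l.toFinset → ∀ h ∈ U, pd l g h = 0)
    {l : List ι} (hl : n < l.length) : ∀ h ∈ U, pd l g h = 0 := by
  suffices H : ∀ m (l : List ι), n < l.length → Fintype.card ι ≤ l.toFinset.card + m →
      ∀ h ∈ U, pd l g h = 0 from H (Fintype.card ι) l hl (by omega)
  intro m
  induction m with
  | zero => ?_
  | succ m ih => ?_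
  all_goals
    intro l hl hcard h hh
    obtain ⟨l', hl'⟩ := (List.dedup_sublist l).exists_perm_append
    by_cases hI : IsFace u h₀ l.toFinset
    swap
    · rw [pd_perm hg (hl'.trans List.perm_append_comm)]
      exact pd_append_eq_zero hU (hnon _ l.nodup_dedup (by
        have : l.dedup.toFinset = l.toFinset := by ext; simp
        rwa [this])) l' h hh
    have hIn := S.card_le hI
    rw [finrank_euclideanSpace, Fintype.card_fin] at hIn
    have hlen := hl'.length_eq
    rw [List.length_append, ← List.card_toFinset] at hlen
    obtain ⟨i, l'', rfl⟩ : ∃ i l'', l' = i :: l'' := by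
      cases l' with
      | nil => simp at hlen; omega
      | cons i l'' => exact ⟨i, l'', rfl⟩
    have hperm : l.Perm (i :: (l.dedup ++ l'')) := hl'.trans List.perm_middle
    have hi : i ∈ l.toFinset := List.mem_toFinset.2 (hperm.mem_iff.2 (by simp))
    have hsub : (l.dedup ++ l'').toFinset = l.toFinset := by
      ext k
      simp only [List.mem_toFinset, List.mem_append, List.mem_dedup]
      refine ⟨fun hk => hk.elim id fun hk => hperm.mem_iff.2 (by simp [hk]), Or.inl⟩
    obtain ⟨R, hR⟩ := exists_inner_eq_of_linearIndependent (S.linearIndependent _ hI)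
    let v := R (Pi.single i 1)
    have h0 : ddir (pairing u v) (pd (l.dedup ++ l'') g) h = 0 := by
      have hz : ∀ l : List ι, pd l (0 : (ι → ℝ) → ℝ) = 0 := fun l => by
        induction l with
        | nil => rfl
        | cons j l ih => ext h; simp [pd, ih, ddir]
      rw [ddir_pd hg, hpair, hz]; rfl
    rw [pd_perm hg hperm, pd]
    rw [ddir_eq_sum, Finset.sum_eq_single i] at h0
    · rwa [pairing_apply, hR _ i hi, Pi.single_eq_same, one_mul] at h0
    · intro j _ hji
      rw [pairing_apply]
      by_cases hj : j ∈ l.toFinset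
      · rw [hR _ j hj, Pi.single_eq_of_ne hji, zero_mul]
      · have hc : (insert j l.toFinset).card = l.toFinset.card + 1 :=
          Finset.card_insert_of_notMem hj
        have hle := Finset.card_le_univ (insert j l.toFinset)
        first
        | omega
        | refine mul_eq_zero_of_right _ (ih (j :: (l.dedup ++ l'')) ?_ ?_ h hh)
          · exact hperm.length_eq ▸ hl
          · rw [List.toFinset_cons, hsub, hc]
            omega
    · simp

theorem IsSimpleSystem.exists_polynomial_of_convex (S : IsSimpleSystem u h₀) {U : Set (ι → ℝ)}
    (hUo : IsOpen U) (hUc : Convex ℝ U) {ε : ℝ} (hε : 0 < ε)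
    (hU : ∀ x ∈ U, Metric.ball x (2 * ε) ⊆ interior (typeCone u h₀)) :
    ∃ p : MvPolynomial ι ℝ, ∀ h ∈ U, MvPolynomial.eval h p = hvol u h := by
  rcases U.eq_empty_or_nonempty with rfl | ⟨a, ha⟩
  · exact ⟨0, by simp⟩
  have hV : Continuous (hvol u) := continuous_hvol S.pos S.ne_zero
  let φ : ℕ → ContDiffBump (0 : ι → ℝ) := fun k =>
    ⟨ε / (k + 1) / 2, ε / (k + 1), by positivity, half_lt_self (by positivity)⟩
  have hφ : Filter.Tendsto (fun k => (φ k).rOut) Filter.atTop (nhds 0) :=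
    ((tendsto_const_div_atTop_nhds_zero_nat ε).comp (Filter.tendsto_add_atTop_nat 1)).congr
      fun k => by simp [φ]
  have hφε : ∀ k, (φ k).rOut ≤ ε := fun k => div_le_self hε.le (by simp)
  have hW : ∀ k, ContDiff ℝ ∞ (mollify (φ k) (hvol u)) := fun k => contDiff_mollify _ hV
  have hpd : ∀ k (l : List ι), l.length = n + 1 → ∀ h ∈ U, pd l (mollify (φ k) (hvol u)) h = 0 := by
    intro k l hl
    refine S.pd_eq_zero (hW k) hUo (fun v => ?_) (fun l hl hI h hh => ?_) (by omega)
    · ext h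
      have h1 := hasDerivAt_ddir (hW k) h (pairing u v) 0
      have h2 : (fun t : ℝ => mollify (φ k) (hvol u) (h + t • pairing u v)) =
          fun _ => mollify (φ k) (hvol u) h := by
        ext t
        refine integral_congr_ae (Filter.Eventually.of_forall fun s => ?_)
        simp only
        rw [← map_smul, add_sub_right_comm, hvol_add_pairing]
      rw [h2] at h1
      simpa using h1.unique (hasDerivAt_const _ _)
    · refine tendsto_nhds_unique (tendsto_mdiff (hW k) l h) (tendsto_const_nhds.congr' ?_)
      filter_upwards [Ioo_mem_nhdsGT hε] with δ hδ
      rw [mdiff_mollify _ hV, mollify, integral_eq_zero_of_ae, zero_div]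
      refine Filter.Eventually.of_forall fun t => ?_
      simp only [Pi.zero_apply]
      by_cases ht : t ∈ Metric.ball (0 : ι → ℝ) (φ k).rOut
      · rw [mdiff_hvol S.pos hδ.1.le hl, S.slab_eq_empty hδ.1.le ?_ hI]
        · simp
        · refine Subset.trans (fun y hy => ?_) (hU h hh)
          have h1 := Metric.mem_closedBall.1 hy
          have h2 : dist (h - t) h < ε := by
            simpa using (mem_ball_zero_iff.1 ht).trans_le (hφε k)
          rw [Metric.mem_ball]
          have := dist_triangle y (h - t) h
          linarith [hδ.2]
      · rw [← (φ k).support_normed_eq (μ := volume), Function.notMem_support] at ht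
        rw [ht, zero_mul]
  choose c hc hceq using fun k => exists_taylor_polynomial (n + 1) (hW k) hUc ha (hpd k)
  let X := {x : ι → ℝ // a + x ∈ U}
  let ev : MvPolynomial ι ℝ →ₗ[ℝ] X → ℝ :=
    LinearMap.pi fun x => (MvPolynomial.aeval x.1 : MvPolynomial ι ℝ →ₐ[ℝ] ℝ).toLinearMap
  have hev : ∀ q x, ev q x = MvPolynomial.eval x.1 q := fun q x => by
    simp [ev, MvPolynomial.aeval_eq_eval]
  let W := (MvPolynomial.restrictTotalDegree ι ℝ n).map ev
  have hmem : (fun x : X => hvol u (a + x.1)) ∈ W := by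
    have hcl : IsClosed (W : Set (X → ℝ)) := Submodule.closed_of_finiteDimensional W
    refine hcl.mem_of_tendsto (f := fun k => fun x : X => mollify (φ k) (hvol u) (a + x.1))
      (b := Filter.atTop) (tendsto_pi_nhds.2 fun x => ?_) (Filter.Eventually.of_forall fun k => ?_)
    · exact ContDiffBump.convolution_tendsto_right_of_continuous hφ hV _
    · refine ⟨∑ j ∈ Finset.range (n + 1), c k j, ?_, ?_⟩
      · refine Submodule.sum_mem _ fun j hj => ?_
        rw [MvPolynomial.mem_restrictTotalDegree]
        exact (hc k j).trans (by have := Finset.mem_range.1 hj; omega)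
      · ext x
        have := hceq k x.1 x.2 1 (by simp)
        simp only [one_smul, one_pow, one_mul] at this
        rw [hev, map_sum, this]
  obtain ⟨q, -, hq⟩ := hmem
  refine ⟨MvPolynomial.aeval (fun i => MvPolynomial.X i - MvPolynomial.C (a i)) q, fun h hh => ?_⟩
  have h1 := congrFun hq ⟨h - a, by simpa using hh⟩
  rw [hev] at h1
  simp only [add_sub_cancel] at h1
  rw [← h1, ← MvPolynomial.aeval_eq_eval, ← MvPolynomial.aeval_eq_eval]
  have : (MvPolynomial.aeval h).comp (MvPolynomial.aeval fun i =>
      MvPolynomial.X i - MvPolynomial.C (a i)) = (MvPolynomial.aeval (h - a) :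
      MvPolynomial ι ℝ →ₐ[ℝ] ℝ) := by
    ext i
    simp
  exact AlgHom.congr_fun this q

theorem IsSimpleSystem.exists_volume_polynomial (S : IsSimpleSystem u h₀) :
    ∃ p : MvPolynomial ι ℝ, p.IsHomogeneous n ∧
      ∀ h ∈ interior (typeCone u h₀), MvPolynomial.eval h p = hvol u h := by
  have hTc : Convex ℝ (interior (typeCone u h₀)) := (convex_typeCone u h₀).interior
  have hloc : ∀ h ∈ interior (typeCone u h₀), ∃ p : MvPolynomial ι ℝ, ∃ ε > 0,
      MvPolynomial.eval h p = hvol u h ∧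
      ∀ x ∈ Metric.ball h₀ ε, MvPolynomial.eval x p = hvol u x := by
    intro h hh
    have hseg : segment ℝ h₀ h ⊆ interior (typeCone u h₀) := hTc.segment_subset S.mem_interior hh
    have hcomp : IsCompact (segment ℝ h₀ h) := by
      rw [segment_eq_image]
      exact isCompact_Icc.image (by fun_prop)
    obtain ⟨δ, hδ, hδs⟩ := hcomp.exists_thickening_subset_open isOpen_interior hseg
    obtain ⟨p, hp⟩ := S.exists_polynomial_of_convex
      (U := Metric.thickening (δ / 3) (segment ℝ h₀ h))
      Metric.isOpen_thickening ((convex_segment h₀ h).thickening _) (ε := δ / 3) (by linarith)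
      (fun x hx y hy => hδs (by
        obtain ⟨z, hz, hxz⟩ := Metric.mem_thickening_iff.1 hx
        refine Metric.mem_thickening_iff.2 ⟨z, hz, ?_⟩
        have := dist_triangle y x z
        have := Metric.mem_ball.1 hy
        linarith))
    refine ⟨p, δ / 3, by linarith, hp h ?_, fun x hx => hp x ?_⟩
    · exact Metric.self_subset_thickening (by linarith) _ (right_mem_segment ℝ _ _)
    · exact Metric.mem_thickening_iff.2 ⟨h₀, left_mem_segment ℝ _ _, hx⟩
  obtain ⟨p, ε, hε, -, hp⟩ := hloc h₀ S.mem_interior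
  have hpT : ∀ h ∈ interior (typeCone u h₀), MvPolynomial.eval h p = hvol u h := by
    intro h hh
    obtain ⟨q, ε', hε', hq, hq'⟩ := hloc h hh
    have : q - p = 0 := eq_zero_of_eval_eq_zero (Metric.isOpen_ball (x := h₀) (ε := min ε ε'))
      ⟨h₀, Metric.mem_ball_self (lt_min hε hε')⟩ fun x hx => by
        rw [map_sub, hq' x (Metric.ball_subset_ball (min_le_right _ _) hx),
          hp x (Metric.ball_subset_ball (min_le_left _ _) hx), sub_self]
    rw [← sub_eq_zero.1 this, hq]
  refine ⟨MvPolynomial.homogeneousComponent n p,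
    MvPolynomial.homogeneousComponent_isHomogeneous _ _, fun h hh => ?_⟩
  let Q : Polynomial ℝ := ∑ k ∈ Finset.range (p.totalDegree + 1), Polynomial.monomial k
    (MvPolynomial.eval h (MvPolynomial.homogeneousComponent k p))
  have hQ : Q = Polynomial.monomial n (hvol u h) := by
    refine Polynomial.eq_of_infinite_eval_eq _ _ ((Ioi_infinite (0 : ℝ)).mono fun c hc => ?_)
    have hc : 0 < c := hc
    have h1 := hpT _ (smul_mem_interior_typeCone hh hc)
    rw [hvol_smul u h hc] at h1
    conv_lhs at h1 => rw [← MvPolynomial.sum_homogeneousComponent p]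
    rw [map_sum] at h1
    simp only [Q, mem_ofPred_eq, Polynomial.eval_finsetSum, Polynomial.eval_monomial]
    rw [mul_comm, ← h1]
    refine Finset.sum_congr rfl fun k _ => ?_
    rw [eval_smul_of_isHomogeneous (MvPolynomial.homogeneousComponent_isHomogeneous k p), mul_comm]
  have hcoef := congrArg (fun q => Polynomial.coeff q n) hQ
  simp only [Q, Polynomial.finsetSum_coeff, Polynomial.coeff_monomial, if_true,
    Finset.sum_ite_eq', Finset.mem_range] at hcoef
  split_ifs at hcoef with hn
  · exact hcoef
  · rw [MvPolynomial.homogeneousComponent_eq_zero _ _ (by omega), map_zero, hcoef]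

end Polynomiality

/-! ### The face polynomials of a simple system -/

section FacePoly

open scoped ContDiff

variable {ι : Type*} [Fintype ι] [DecidableEq ι]

/-- The mixed partial derivative of `p` along the indices in `I`. -/
def facePoly (p : MvPolynomial ι ℝ) (I : Finset ι) : MvPolynomial ι ℝ :=
  I.toList.foldr (fun j q => MvPolynomial.pderiv j q) p

theorem eval_foldr_pderiv (p : MvPolynomial ι ℝ) (l : List ι) :
    (fun h => MvPolynomial.eval h (l.foldr (fun j q => MvPolynomial.pderiv j q) p)) =
      pd l fun h => MvPolynomial.eval h p := by
  induction l with
  | nil => rfl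
  | cons j l ih => rw [pd, ← ih, ddir_eval, dirD_single]; rfl

theorem eval_facePoly (p : MvPolynomial ι ℝ) (I : Finset ι) :
    (fun h => MvPolynomial.eval h (facePoly p I)) = pd I.toList fun h => MvPolynomial.eval h p :=
  eval_foldr_pderiv p _

theorem facePoly_empty (p : MvPolynomial ι ℝ) : facePoly p ∅ = p := by
  simp [facePoly]

theorem pderiv_facePoly (p : MvPolynomial ι ℝ) {I : Finset ι} {j : ι} (hj : j ∉ I) :
    MvPolynomial.pderiv j (facePoly p I) = facePoly p (insert j I) := by
  refine MvPolynomial.funext fun h => ?_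
  refine (congrFun (eval_foldr_pderiv p (j :: I.toList)) h).trans ?_
  rw [pd_perm (contDiff_eval p) (Finset.toList_insert hj).symm]
  exact (congrFun (eval_facePoly p (insert j I)) h).symm

theorem isHomogeneous_facePoly {p : MvPolynomial ι ℝ} {n : ℕ} (hp : p.IsHomogeneous n)
    (I : Finset ι) : (facePoly p I).IsHomogeneous (n - I.card) := by
  rw [← Finset.length_toList, facePoly]
  induction I.toList with
  | nil => exact hp
  | cons j l ih =>
    rw [List.length_cons, ← Nat.sub_sub]
    exact ih.pderiv

theorem dirD_facePoly_eq_zero {p : MvPolynomial ι ℝ} {z : ι → ℝ} (hp : dirD z p = 0)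
    (I : Finset ι) : dirD z (facePoly p I) = 0 := by
  rw [facePoly]
  induction I.toList with
  | nil => exact hp
  | cons j l ih => rw [List.foldr_cons, dirD_pderiv, ih, map_zero]

theorem mdiff_congr {f g : (ι → ℝ) → ℝ} {δ : ℝ} (hδ : 0 ≤ δ) {l : List ι} {h : ι → ℝ}
    (hfg : ∀ x, dist x h ≤ l.length * δ → f x = g x) : mdiff δ l f h = mdiff δ l g h := by
  induction l generalizing h with
  | nil => exact hfg h (by simp)
  | cons j l ih =>
    have he : ‖(Pi.single j 1 : ι → ℝ)‖ ≤ 1 := by rw [Pi.norm_single]; simp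
    have hd : dist (h + δ • (Pi.single j 1 : ι → ℝ)) h ≤ δ := by
      rw [dist_eq_norm, add_sub_cancel_left, norm_smul, Real.norm_of_nonneg hδ]
      nlinarith
    push_cast [List.length_cons] at hfg
    rw [mdiff, mdiff, ih fun x hx => hfg x ?_, ih fun x hx => hfg x ?_]
    · linarith
    · linarith [dist_triangle x (h + δ • (Pi.single j 1 : ι → ℝ)) h]

variable {n : ℕ} {u : ι → EuclideanSpace ℝ (Fin n)} {h₀ : ι → ℝ}

theorem IsSimpleSystem.tendsto_volume_slab (S : IsSimpleSystem u h₀) {p : MvPolynomial ι ℝ}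
    (hp : ∀ h ∈ interior (typeCone u h₀), MvPolynomial.eval h p = hvol u h) (I : Finset ι)
    {h : ι → ℝ} (hh : h ∈ interior (typeCone u h₀)) :
    Filter.Tendsto (fun δ : ℝ => (volume (slab u h δ I)).toReal / δ ^ I.card)
      (nhdsWithin 0 (Ioi 0)) (nhds (MvPolynomial.eval h (facePoly p I))) := by
  have h1 := tendsto_mdiff (contDiff_eval p) I.toList h
  rw [← congrFun (eval_facePoly p I) h, Finset.length_toList] at h1
  refine h1.congr' ?_
  obtain ⟨r, hr, hball⟩ := Metric.isOpen_iff.1 isOpen_interior h hh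
  filter_upwards [Ioo_mem_nhdsGT (show 0 < r / (I.card + 1) by positivity)] with δ hδ
  have h2 := mdiff_hvol S.pos hδ.1.le I.nodup_toList h
  rw [Finset.toList_toFinset] at h2
  rw [← h2, mdiff_congr hδ.1.le fun x hx => hp x (hball ?_)]
  rw [Finset.length_toList] at hx
  have h3 := (lt_div_iff₀ (by positivity)).1 hδ.2
  rw [Metric.mem_ball]
  nlinarith [hδ.1]

theorem IsSimpleSystem.dirD_pairing (S : IsSimpleSystem u h₀) {p : MvPolynomial ι ℝ}
    (hp : ∀ h ∈ interior (typeCone u h₀), MvPolynomial.eval h p = hvol u h)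
    (v : EuclideanSpace ℝ (Fin n)) : dirD (pairing u v) p = 0 := by
  refine eq_zero_of_eval_eq_zero isOpen_interior ⟨h₀, S.mem_interior⟩ fun h hh => ?_
  have h1 := hasDerivAt_eval_line p h (pairing u v) 0
  have hev : ∀ᶠ t : ℝ in nhds 0, h + t • pairing u v ∈ interior (typeCone u h₀) := by
    have hc : Continuous fun t : ℝ => h + t • pairing u v := by fun_prop
    exact hc.continuousAt.eventually (isOpen_interior.mem_nhds (by simpa using hh))
  have h2 : (fun t : ℝ => MvPolynomial.eval (h + t • pairing u v) p) =ᶠ[nhds 0]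
      fun _ => hvol u h := by
    filter_upwards [hev] with t ht
    rw [hp _ ht, ← map_smul, hvol_add_pairing]
  simpa using h1.unique ((hasDerivAt_const _ _).congr_of_eventuallyEq h2)

/-- The volume polynomial of a simple system, together with its derivatives, is a system of face
polynomials. -/
theorem IsSimpleSystem.facePolynomials (S : IsSimpleSystem u h₀) {p : MvPolynomial ι ℝ}
    (hom : p.IsHomogeneous n)
    (hp : ∀ h ∈ interior (typeCone u h₀), MvPolynomial.eval h p = hvol u h) :
    FacePolynomials n (interior (typeCone u h₀)) (IsFace u h₀) (facePoly p) where
  pderiv_eq I j hj := pderiv_facePoly p hj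
  eq_zero I hI := by
    refine eq_zero_of_eval_eq_zero isOpen_interior ⟨h₀, S.mem_interior⟩ fun h hh => ?_
    refine tendsto_nhds_unique (S.tendsto_volume_slab hp I hh) (tendsto_const_nhds.congr' ?_)
    obtain ⟨r, hr, hball⟩ := Metric.isOpen_iff.1 isOpen_interior h hh
    filter_upwards [Ioo_mem_nhdsGT hr] with δ hδ
    rw [S.slab_eq_empty hδ.1.le ((Metric.closedBall_subset_ball hδ.2).trans hball) hI]
    simp
  exists_lt I hI h hh := by
    obtain ⟨x, hx, hx'⟩ := hI.exists_strict hh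
    exact ⟨pairing u x, dirD_facePoly_eq_zero (S.dirD_pairing hp x) I, hx, hx'⟩
  exists_eq I hI h := by
    obtain ⟨R, hR⟩ := exists_inner_eq_of_linearIndependent (S.linearIndependent I hI)
    exact ⟨pairing u (R h), dirD_facePoly_eq_zero (S.dirD_pairing hp _) I, hR h⟩
  const_pos I hI hcard := by
    obtain ⟨c, hc, hle⟩ := S.exists_le_volume_slab hI
    have h0 : (facePoly p I).IsHomogeneous 0 := by
      simpa [hcard] using isHomogeneous_facePoly hom I
    rw [← eval_eq_constantCoeff h0 h₀]
    refine hc.trans_le (ge_of_tendsto (S.tendsto_volume_slab hp I S.mem_interior) ?_)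
    filter_upwards [hle, self_mem_nhdsWithin] with δ hδ hδ0
    rwa [le_div_iff₀ (pow_pos hδ0 _), hcard]
  extend I hI hcard := S.exists_insert hI (by simpa using hcard)
  minkowski I m hI hcard h hh x := by
    have hom' : (facePoly p I).IsHomogeneous (m + 2) := by
      have := isHomogeneous_facePoly hom I
      rwa [show n - I.card = m + 2 by omega] at this
    have hnonneg : ∀ h ∈ interior (typeCone u h₀), 0 ≤ MvPolynomial.eval h (facePoly p I) :=
      fun h hh => ge_of_tendsto (S.tendsto_volume_slab hp I hh) <| by
        filter_upwards [self_mem_nhdsWithin] with δ hδ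
        exact div_nonneg ENNReal.toReal_nonneg (pow_nonneg (le_of_lt hδ) _)
    refine mix_sq_of_quasiconcave hom' isOpen_interior hnonneg (fun x hx y hy => ?_) hh x
    have hxy : (1 / 2 : ℝ) • (x + y) ∈ interior (typeCone u h₀) := by
      have := (convex_typeCone u h₀).interior hx hy (a := 1 / 2) (b := 1 / 2) (by norm_num)
        (by norm_num) (by norm_num)
      rwa [← smul_add] at this
    have hmul : MvPolynomial.eval x (facePoly p I) * MvPolynomial.eval y (facePoly p I) ≤
        MvPolynomial.eval ((1 / 2 : ℝ) • (x + y)) (facePoly p I) ^ 2 := by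
      refine le_of_tendsto_of_tendsto ((S.tendsto_volume_slab hp I hx).mul
        (S.tendsto_volume_slab hp I hy)) ((S.tendsto_volume_slab hp I hxy).pow 2) ?_
      filter_upwards [self_mem_nhdsWithin] with δ hδ
      have hfin : volume (slab u ((1 / 2 : ℝ) • (x + y)) δ I) ^ 2 ≠ ⊤ :=
        ENNReal.pow_ne_top (isBounded_slab S.pos _ _ _).measure_lt_top.ne
      have := ENNReal.toReal_mono hfin (volume_slab_mul_le S.pos x y δ I)
      rw [ENNReal.toReal_mul, ENNReal.toReal_pow] at this
      have hδ0 : 0 < δ ^ I.card := pow_pos hδ _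
      rw [div_mul_div_comm, div_pow, ← sq]
      gcongr
    refine le_of_sq_le_sq ?_ (hnonneg _ hxy)
    refine le_trans ?_ hmul
    rcases le_total (MvPolynomial.eval x (facePoly p I)) (MvPolynomial.eval y (facePoly p I))
      with hle | hle
    · rw [min_eq_left hle, sq]
      exact mul_le_mul_of_nonneg_left hle (hnonneg x hx)
    · rw [min_eq_right hle, sq]
      exact mul_le_mul_of_nonneg_right hle (hnonneg y hy)

end FacePoly

/-! ### Polytopes as intersections of half-spaces -/

section WeylMinkowski

open scoped NNReal

/-- A finitely generated convex cone is an intersection of finitely many half-spaces. -/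
theorem exists_mem_span_iff_forall_le {V : Type*} [AddCommGroup V] [Module ℝ V]
    [FiniteDimensional ℝ V] (A : Finset V) :
    ∃ F : Finset (V →ₗ[ℝ] ℝ), ∀ y, y ∈ Submodule.span ℝ≥0 (A : Set V) ↔ ∀ f ∈ F, f y ≤ 0 := by
  classical
  induction A using Finset.induction_on with
  | empty =>
    let b := Module.finBasis ℝ V
    refine ⟨Finset.univ.image b.coord ∪ Finset.univ.image fun i => -b.coord i, fun y => ?_⟩
    rw [Finset.coe_empty, Submodule.span_empty, Submodule.mem_bot, ← b.forall_coord_eq_zero_iff]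
    simp only [Finset.mem_union, Finset.mem_image, Finset.mem_univ, true_and]
    constructor
    · rintro h _ (⟨i, rfl⟩ | ⟨i, rfl⟩) <;> simp only [LinearMap.neg_apply, h i, neg_zero, le_refl]
    · intro h i
      have h1 := h _ (Or.inl ⟨i, rfl⟩)
      have h2 := h _ (Or.inr ⟨i, rfl⟩)
      rw [LinearMap.neg_apply] at h2
      linarith
  | insert a A _ ih =>
    obtain ⟨F, hF⟩ := ih
    refine ⟨{f ∈ F | f a ≤ 0} ∪ ({f ∈ F | 0 < f a} ×ˢ {f ∈ F | f a ≤ 0}).image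
      fun q => q.1 a • q.2 - q.2 a • q.1, fun y => ?_⟩
    have hy : y ∈ Submodule.span ℝ≥0 ((insert a A : Finset V) : Set V) ↔
        ∃ t : ℝ, 0 ≤ t ∧ ∀ f ∈ F, f y ≤ t * f a := by
      rw [Finset.coe_insert, Submodule.mem_span_insert]
      constructor
      · rintro ⟨t, z, hz, rfl⟩
        refine ⟨t, t.2, fun f hf => ?_⟩
        have := (hF z).1 hz f hf
        rw [map_add, NNReal.smul_def, map_smul, smul_eq_mul]
        linarith
      · rintro ⟨t, ht, h⟩
        refine ⟨t.toNNReal, y - t • a, (hF _).2 fun f hf => ?_, ?_⟩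
        · rw [map_sub, map_smul, smul_eq_mul]
          linarith [h f hf]
        · rw [NNReal.smul_def, Real.coe_toNNReal t ht]
          exact (add_sub_cancel _ _).symm
    rw [hy]
    simp only [Finset.mem_union, Finset.mem_image, Finset.mem_filter, Finset.mem_product,
      Prod.exists]
    constructor
    · rintro ⟨t, ht, h⟩ _ (⟨hf, hfa⟩ | ⟨f, g, ⟨⟨hf, hfa⟩, hg, hga⟩, rfl⟩)
      · exact (h _ hf).trans (mul_nonpos_of_nonneg_of_nonpos ht hfa)
      · simp only [LinearMap.sub_apply, LinearMap.smul_apply, smul_eq_mul]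
        nlinarith [h f hf, h g hg]
    · intro h
      rcases ({f ∈ F | 0 < f a} : Finset _).eq_empty_or_nonempty with hP | hP
      · refine ⟨0, le_rfl, fun f hf => ?_⟩
        rw [zero_mul]
        refine h f (Or.inl ⟨hf, not_lt.1 fun hfa => ?_⟩)
        exact Finset.notMem_empty f (hP ▸ Finset.mem_filter.2 ⟨hf, hfa⟩)
      · obtain ⟨f, hfP, hmax⟩ := Finset.exists_max_image _ (fun f : V →ₗ[ℝ] ℝ => f y / f a) hP
        obtain ⟨hf, hfa⟩ := Finset.mem_filter.1 hfP
        refine ⟨max (f y / f a) 0, le_max_right _ _, fun g hg => ?_⟩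
        rcases lt_or_ge 0 (g a) with hga | hga
        · rw [← div_le_iff₀ hga]
          exact (hmax g (Finset.mem_filter.2 ⟨hg, hga⟩)).trans (le_max_left _ _)
        · rcases max_cases (f y / f a) 0 with ⟨hm, -⟩ | ⟨hm, -⟩
          · have := h _ (Or.inr ⟨f, g, ⟨⟨hf, hfa⟩, hg, hga⟩, rfl⟩)
            simp only [LinearMap.sub_apply, LinearMap.smul_apply, smul_eq_mul] at this
            rw [hm, div_mul_eq_mul_div, le_div_iff₀ hfa]
            linarith
          · rw [hm, zero_mul]
            exact h g (Or.inl ⟨hg, hga⟩)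

theorem exists_convexHull_eq_hpoly {E : Type} [NormedAddCommGroup E] [InnerProductSpace ℝ E]
    [FiniteDimensional ℝ E] {A : Finset E} (hA : A.Nonempty) :
    ∃ (ι : Type) (_ : Fintype ι) (u : ι → E) (h : ι → ℝ), (∀ i, u i ≠ 0) ∧
      convexHull ℝ (A : Set E) = hpoly u h := by
  classical
  obtain ⟨F, hF⟩ := exists_mem_span_iff_forall_le (A.image fun a => ((a, 1) : E × ℝ))
  let ν : (E × ℝ →ₗ[ℝ] ℝ) → E := fun f =>
    (InnerProductSpace.toDual ℝ E).symm (f ∘ₗ LinearMap.inl ℝ E ℝ).toContinuousLinearMap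
  have hν : ∀ f x, f (x, 1) = inner ℝ x (ν f) + f (0, 1) := fun f x => by
    rw [real_inner_comm, InnerProductSpace.toDual_symm_apply]
    simp [← map_add]
  refine ⟨{f : F // ν f ≠ 0}, inferInstance, fun f => ν f.1, fun f => -f.1.1 (0, 1),
    fun f => f.2, subset_antisymm (convexHull_min (fun a ha f => ?_) (convex_hpoly _ _))
      fun x hx => ?_⟩
  · have := (hF (a, 1)).1 (Submodule.subset_span (by simpa using ha)) f.1.1 f.1.2
    rw [hν] at this
    linarith
  · have hmem : ((x, 1) : E × ℝ) ∈
        Submodule.span ℝ≥0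
          ((A.image fun a => ((a, 1) : E × ℝ) : Finset (E × ℝ)) : Set (E × ℝ)) := by
      refine (hF _).2 fun f hf => ?_
      rw [hν]
      by_cases h0 : ν f = 0
      · obtain ⟨a, ha⟩ := hA
        have := (hF (a, 1)).1 (Submodule.subset_span (by simpa using ha)) f hf
        rw [hν, h0, inner_zero_right] at this
        rwa [h0, inner_zero_right]
      · have := hx ⟨⟨f, hf⟩, h0⟩
        simp only at this
        linarith
    obtain ⟨c, -, hc⟩ := Submodule.mem_span_finset.1 hmem
    rw [Finset.sum_image (by simp [Set.InjOn])] at hc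
    have h1 := congrArg Prod.fst hc
    have h2 := congrArg Prod.snd hc
    simp only [Prod.fst_sum, Prod.snd_sum, Prod.smul_fst, Prod.smul_snd, NNReal.smul_def,
      smul_eq_mul, mul_one] at h1 h2
    rw [← h1]
    exact (convex_convexHull ℝ _).sum_mem (fun _ _ => NNReal.coe_nonneg _) h2
      fun a ha => subset_convexHull ℝ _ ha

end WeylMinkowski

/-! ### Perturbation to a simple system -/

section Generic

theorem exists_isSimpleSystem {E : Type*} [NormedAddCommGroup E] [InnerProductSpace ℝ E]
    [FiniteDimensional ℝ E] {ι : Type*} [Fintype ι] {u : ι → E}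
    (hu : ∀ d : E, d ≠ 0 → ∃ i, 0 < inner ℝ d (u i)) (hu0 : ∀ i, u i ≠ 0) {w : ι → ℝ} {z : E}
    (hz : ∀ i, inner ℝ z (u i) < w i) :
    ∃ h₀, IsSimpleSystem u h₀ ∧ w ∈ typeCone u h₀ := by
  classical
  have hdense : Dense {h : ι → ℝ | ∀ I : Finset ι, IsFace u h I →
      LinearIndependent ℝ fun i : I => u i} := by
    refine Measure.dense_of_ae (μ := volume) (ae_all_iff.2 fun I => ?_)
    by_cases hI : LinearIndependent ℝ fun i : I => u i
    · exact Filter.Eventually.of_forall fun _ _ => hI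
    rw [Fintype.not_linearIndependent_iff] at hI
    obtain ⟨c, hc, i₀, hi₀⟩ := hI
    let L : (ι → ℝ) →ₗ[ℝ] ℝ := ∑ i : I, c i • LinearMap.proj (i : ι)
    have hL : ∀ h, L h = ∑ i : I, c i * h i := fun h => by simp [L]
    have hne : LinearMap.ker L ≠ ⊤ := fun htop => hi₀ <| by
      have : Pi.single (i₀ : ι) (1 : ℝ) ∈ LinearMap.ker L := htop ▸ Submodule.mem_top
      rw [LinearMap.mem_ker, hL, Finset.sum_eq_single i₀] at this
      · simpa using this
      · intro j _ hj
        rw [Pi.single_eq_of_ne (fun e => hj (Subtype.ext e)), mul_zero]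
      · simp
    refine measure_mono_null (fun h hh => ?_) (Measure.addHaar_submodule volume _ hne)
    obtain ⟨⟨x, -, hxI⟩, -⟩ := Classical.not_imp.1 hh
    rw [SetLike.mem_coe, LinearMap.mem_ker, hL]
    calc ∑ i : I, c i * h i = inner ℝ x (∑ i : I, c i • u i) := by
          rw [inner_sum]
          refine Finset.sum_congr rfl fun i _ => ?_
          rw [real_inner_smul_right, hxI i i.2]
      _ = 0 := by rw [hc, inner_zero_right]
  have hcone : ∀ᶠ h in nhds w, w ∈ typeCone u h := by
    refine Filter.eventually_all.2 fun I => ?_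
    by_cases hI : IsFace u w I
    · exact Filter.Eventually.of_forall fun _ _ => hI
    obtain ⟨r, hr⟩ := isCompact_hpoly hu (w + 1)
    let Z : Set (Metric.closedBall (0 : E) r × (ι → ℝ)) :=
      {q | (∀ i, inner ℝ (q.1 : E) (u i) ≤ q.2 i) ∧ ∀ i ∈ I, inner ℝ (q.1 : E) (u i) = q.2 i}
    have hZ : IsClosed Z := by
      have : Z = (⋂ i, {q | inner ℝ (q.1 : E) (u i) ≤ q.2 i}) ∩
          ⋂ i ∈ I, {q | inner ℝ (q.1 : E) (u i) = q.2 i} := by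
        ext; simp [Z]
      rw [this]
      refine (isClosed_iInter fun i => isClosed_le ?_ ?_).inter
        (isClosed_biInter fun i _ => isClosed_eq ?_ ?_) <;> fun_prop
    have hZc : IsClosed (Prod.snd '' Z) := isClosedMap_snd_of_compactSpace _ hZ
    have hw : w ∉ Prod.snd '' Z := by
      rintro ⟨⟨x, _⟩, hx, rfl⟩
      exact hI ⟨x, hx⟩
    have hle : ∀ᶠ h in nhds w, h ≤ w + 1 := by
      refine Filter.eventually_all.2 fun i => ?_
      have hc : Continuous fun h : ι → ℝ => h i := continuous_apply i
      exact hc.continuousAt.eventually (Iic_mem_nhds (by simp))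
    filter_upwards [hZc.isOpen_compl.mem_nhds hw, hle] with h hh hle ⟨x, hx, hxI⟩
    exact absurd ⟨(⟨x, hr h hle hx⟩, h), ⟨hx, hxI⟩, rfl⟩ hh
  have hne : ∀ᶠ h in nhds w, z ∈ hpoly u h := by
    refine Filter.eventually_all.2 fun i => ?_
    have hc : Continuous fun h : ι → ℝ => h i := continuous_apply i
    exact hc.continuousAt.eventually (Ici_mem_nhds (hz i))
  obtain ⟨h₀, hli, hcone, hne⟩ :=
    ((mem_closure_iff_frequently.1 (hdense w)).and_eventually (hcone.and hne)).exists
  exact ⟨h₀, ⟨hu, hu0, ⟨z, hne⟩, hli⟩, hcone⟩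

end Generic

/-! ### Realizing finitely many polytopes in one type cone -/

section Approximation

theorem pairing_mem_typeCone {E ι : Type*} [NormedAddCommGroup E] [InnerProductSpace ℝ E]
    (u : ι → E) (h₀ : ι → ℝ) (v : E) : pairing u v ∈ typeCone u h₀ :=
  fun _ _ => ⟨v, fun _ => le_rfl, fun _ _ => rfl⟩

variable {E : Type} [NormedAddCommGroup E] [InnerProductSpace ℝ E] [FiniteDimensional ℝ E]

theorem exists_isSimpleSystem_of_convexHull {κ : Type*} [Fintype κ] [Nonempty κ] (A : κ → Finset E)
    (hA : ∀ j, (interior (convexHull ℝ (A j : Set E))).Nonempty) {ε : ℝ} (hε : 0 < ε) :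
    ∃ (ι : Type) (_ : Fintype ι) (u : ι → E) (h₀ : ι → ℝ) (f : κ → ι → ℝ), IsSimpleSystem u h₀ ∧
      (∀ j, f j ∈ interior (typeCone u h₀)) ∧
      (∀ j, convexHull ℝ (A j : Set E) ⊆ hpoly u (f j)) ∧
      (∀ j, hpoly u (f j) ⊆ Metric.cthickening ε (convexHull ℝ (A j : Set E))) ∧
      ∀ i j, convexHull ℝ (A i : Set E) ⊆ convexHull ℝ (A j : Set E) → f i ≤ f j := by
  classical
  set Q : κ → Set E := fun j => convexHull ℝ (A j : Set E) with hQ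
  have hQc : ∀ j, IsCompact (Q j) := fun j => (A j).finite_toSet.isCompact_convexHull ℝ
  have hQn : ∀ j, (Q j).Nonempty := fun j => (hA j).mono interior_subset
  have hAn : (∑ j, A j).Nonempty := by
    choose a ha using fun j => convexHull_nonempty_iff.1 (hQn j)
    refine ⟨∑ j, a j, Finset.mem_coe.1 ?_⟩
    rw [Finset.coe_sum]
    exact (mem_fintype_sum _ _).2 ⟨a, ha, rfl⟩
  obtain ⟨ι, _, u, h, hu0, hS⟩ := exists_convexHull_eq_hpoly hAn
  rw [Finset.coe_sum, convexHull_sum] at hS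
  choose m hmQ hm using fun (j : κ) (d : E) => (hQc j).exists_isMaxOn (hQn j)
    (f := fun q => inner ℝ q d) (by fun_prop)
  replace hm : ∀ j d, ∀ q ∈ Q j, inner ℝ q d ≤ inner ℝ (m j d) d := fun j d q hq => hm j d hq
  have hsum : ∀ q : κ → E, (∀ j, q j ∈ Q j) → ∑ j, q j ∈ ∑ j, Q j := fun q hq =>
    (mem_fintype_sum _ _).2 ⟨q, hq, rfl⟩
  let x : κ → ι → ℝ := fun j i => inner ℝ (m j (u i)) (u i)
  let w : ι → ℝ := fun i => ∑ j, x j i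
  have hSw : ∑ j, Q j = hpoly u w := by
    refine subset_antisymm (fun z hz i => ?_) fun z hz => ?_
    · obtain ⟨q, hq, rfl⟩ := (mem_fintype_sum _ _).1 hz
      rw [sum_inner]
      exact Finset.sum_le_sum fun j _ => hm j _ _ (hq j)
    · rw [hS]
      refine fun i => (hz i).trans ?_
      have := hS ▸ hsum (fun j => m j (u i)) fun j => hmQ j _
      simpa only [sum_inner] using this i
  have hScomp : IsCompact (∑ j, Q j) := by
    rw [hQ, ← convexHull_sum, ← Finset.coe_sum]
    exact (Finset.finite_toSet _).isCompact_convexHull ℝ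
  have hSn : (∑ j, Q j).Nonempty := by
    choose q hq using hQn
    exact ⟨_, hsum q hq⟩
  have hu : ∀ d : E, d ≠ 0 → ∃ i, 0 < inner ℝ d (u i) := by
    intro d hd
    by_contra! hneg
    obtain ⟨s, hs, hmax⟩ := hScomp.exists_isMaxOn hSn (f := fun q => inner ℝ q d) (by fun_prop)
    have hsd : s + d ∈ ∑ j, Q j := by
      rw [hSw] at hs ⊢
      intro i
      rw [inner_add_left]
      linarith [hs i, hneg i]
    have h1 : inner ℝ (s + d) d ≤ inner ℝ s d := hmax hsd
    rw [inner_add_left, real_inner_self_eq_norm_sq] at h1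
    have := norm_pos_iff.2 hd
    nlinarith
  choose z hz using hA
  have hzx : ∀ j i, inner ℝ (z j) (u i) < x j i := by
    intro j i
    have hc : Continuous fun t : ℝ => z j + t • u i := by fun_prop
    have hev : ∀ᶠ t : ℝ in nhds 0, z j + t • u i ∈ Q j :=
      hc.continuousAt.eventually (by simpa using mem_interior_iff_mem_nhds.1 (hz j))
    obtain ⟨t, ht, ht0⟩ := ((hev.filter_mono nhdsWithin_le_nhds).and
      (self_mem_nhdsWithin (s := Ioi 0))).exists
    have h1 := hm j (u i) _ ht
    rw [inner_add_left, real_inner_smul_left, real_inner_self_eq_norm_sq] at h1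
    have h2 : 0 < t * ‖u i‖ ^ 2 := mul_pos ht0 (pow_pos (norm_pos_iff.2 (hu0 i)) 2)
    change _ < inner ℝ (m j (u i)) (u i)
    linarith
  obtain ⟨h₀, S, hw⟩ := exists_isSimpleSystem hu hu0 (w := w) (z := ∑ j, z j) fun i => by
    rw [sum_inner]
    exact Finset.sum_lt_sum_of_nonempty Finset.univ_nonempty fun j _ => hzx j i
  have hx : ∀ j, x j ∈ typeCone u h₀ := by
    intro j I hI
    obtain ⟨y, hy, hyI⟩ := hw I hI
    rw [← hSw] at hy
    obtain ⟨q, hq, rfl⟩ := (mem_fintype_sum _ _).1 hy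
    refine ⟨q j, fun i => hm j _ _ (hq j), fun i hi => ?_⟩
    have h1 := hyI i hi
    rw [sum_inner] at h1
    exact (Finset.sum_eq_sum_iff_of_le fun j _ => hm j (u i) _ (hq j)).1 h1 j (Finset.mem_univ j)
  have hxQ : ∀ j, hpoly u (x j) = Q j := by
    intro j
    refine subset_antisymm (fun y hy => ?_) fun q hq i => hm j _ _ hq
    by_contra hyn
    obtain ⟨L, c, hL, hcL⟩ := geometric_hahn_banach_closed_point (convex_convexHull ℝ _)
      (hQc j).isClosed hyn
    let d := (InnerProductSpace.toDual ℝ E).symm L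
    have hd : ∀ v, L v = inner ℝ v d := fun v => by
      rw [real_inner_comm, InnerProductSpace.toDual_symm_apply]
    have hmem : ∑ k, Function.update (fun k => m k d) j y k ∈ hpoly u w := by
      intro i
      rw [sum_inner]
      refine Finset.sum_le_sum fun k _ => ?_
      by_cases hk : k = j
      · subst hk
        rw [Function.update_self]
        exact hy i
      · rw [Function.update_of_ne hk]
        exact hm k _ _ (hmQ k d)
    rw [← hSw] at hmem
    obtain ⟨q, hq, hqe⟩ := (mem_fintype_sum _ _).1 hmem
    have h1 := congrArg (fun v => inner ℝ v d) hqe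
    simp only [sum_inner] at h1
    have h2 : ∑ k, inner ℝ (q k) d < ∑ k, inner ℝ (Function.update (fun k => m k d) j y k) d := by
      refine Finset.sum_lt_sum (fun k _ => ?_) ⟨j, Finset.mem_univ j, ?_⟩
      · by_cases hk : k = j
        · subst hk
          rw [Function.update_self, ← hd, ← hd]
          exact ((hL _ (hq k)).trans hcL).le
        · rw [Function.update_of_ne hk]
          exact hm k _ _ (hq k)
      · rw [Function.update_self, ← hd, ← hd]
        exact (hL _ (hq j)).trans hcL
    exact h2.ne h1
  obtain ⟨v, hv⟩ := S.nonempty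
  let g := h₀ + pairing u (-v)
  have hg0 : 0 ≤ g := fun i => by
    have := hv i
    simp only [g, Pi.zero_apply, Pi.add_apply, pairing_apply, inner_neg_left]
    linarith
  have hg : g ∈ interior (typeCone u h₀) := by
    have := add_mem_interior_typeCone (pairing_mem_typeCone u h₀ (-v)) S.mem_interior
    rwa [add_comm] at this
  obtain ⟨r, hr⟩ := isCompact_hpoly hu g
  let η := ε / (|r| + 1)
  have hη : 0 < η := by positivity
  refine ⟨ι, inferInstance, u, h₀, fun j => x j + η • g, S,
    fun j => add_mem_interior_typeCone (hx j) (smul_mem_interior_typeCone hg hη),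
    fun j q hq i => ?_, fun j => ?_, fun i j hij k => ?_⟩
  · exact (hm j _ _ hq).trans (le_add_of_nonneg_right (mul_nonneg hη.le (hg0 i)))
  · rw [S.hpoly_add (hx j) (interior_subset (smul_mem_interior_typeCone hg hη)), hxQ,
      hpoly_smul u g hη, ← (hQc j).add_closedBall_zero hε.le]
    refine add_subset_add_left ?_
    rintro _ ⟨y, hy, rfl⟩
    have h1 := mem_closedBall_zero_iff.1 (hr g le_rfl hy)
    rw [mem_closedBall_zero_iff, norm_smul, Real.norm_of_nonneg hη.le]
    calc η * ‖y‖ ≤ η * (|r| + 1) := by gcongr; linarith [le_abs_self r]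
      _ = ε := div_mul_cancel₀ _ (by positivity)
  · exact add_le_add_left (hm j _ _ (hij (hmQ i _))) _

/-- Finitely many convex bodies are approximated from outside by polytopes whose support vectors lie
in the interior of a common type cone. -/
theorem exists_isSimpleSystem_approx {κ : Type*} [Fintype κ] [Nonempty κ] {C : κ → Set E}
    (hC : ∀ j, IsCompact (C j)) (hCc : ∀ j, Convex ℝ (C j)) (hCn : ∀ j, (C j).Nonempty) {ε : ℝ}
    (hε : 0 < ε) :
    ∃ (ι : Type) (_ : Fintype ι) (u : ι → E) (h₀ : ι → ℝ) (f : κ → ι → ℝ), IsSimpleSystem u h₀ ∧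
      (∀ j, f j ∈ interior (typeCone u h₀)) ∧ (∀ j, C j ⊆ hpoly u (f j)) ∧
      (∀ j, hpoly u (f j) ⊆ Metric.cthickening ε (C j)) ∧
      ∀ i j, Metric.cthickening ε (C i) ⊆ C j → f i ≤ f j := by
  choose A hA hA' using fun j =>
    (hCc j).exists_subset_interior_convexHull_finset_of_isCompact (hC j)
      (Metric.cthickening_mem_nhdsSet (C j) (half_pos hε))
  obtain ⟨ι, _, u, h₀, f, S, hf, hAf, hfA, hmono⟩ :=
    exists_isSimpleSystem_of_convexHull A (fun j => (hCn j).mono (hA j)) (half_pos hε)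
  refine ⟨ι, inferInstance, u, h₀, f, S, hf, fun j => (hA j).trans (interior_subset.trans (hAf j)),
    fun j => (hfA j).trans ?_, fun i j hij => hmono i j ?_⟩
  · refine (Metric.cthickening_subset_of_subset _ (hA' j)).trans ?_
    refine (Metric.cthickening_cthickening_subset (half_pos hε).le (half_pos hε).le _).trans ?_
    rw [add_halves]
  · exact (hA' i).trans ((Metric.cthickening_mono (half_le_self hε.le) _).trans
      (hij.trans ((hA j).trans interior_subset)))

end Approximation

/-! ### The anisotropic perimeter of polytopes in one type cone -/

section Perimeter

variable {n : ℕ}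

theorem aniPer_eq_of_eqOn {C K : Set (EuclideanSpace ℝ (Fin n))} (q : Polynomial ℝ)
    (hq : ∀ s : ℝ, 0 ≤ s → (volume (C + s • K)).toReal = q.eval s) :
    aniPer C K = q.derivative.eval 0 := by
  refine HasDerivWithinAt.derivWithin ?_ (uniqueDiffOn_Ici (0 : ℝ) 0 self_mem_Ici)
  exact (q.hasDerivAt 0).hasDerivWithinAt.congr (fun s hs => hq s hs) (hq 0 le_rfl)

theorem eval_aeval_line {ι : Type*} (p : MvPolynomial ι ℝ) (x k : ι → ℝ) (s : ℝ) :
    (MvPolynomial.aeval (fun i => Polynomial.C (x i) + Polynomial.C (k i) * Polynomial.X)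
      p).eval s = MvPolynomial.eval (x + s • k) p := by
  induction p using MvPolynomial.induction_on with
  | C a => simp
  | add p q hp hq => simp [hp, hq]
  | mul_X p i hp => simp [hp, mul_comm s]

namespace IsSimpleSystem

variable {ι : Type*} {u : ι → EuclideanSpace ℝ (Fin n)} {h₀ : ι → ℝ}

theorem hpoly_nonempty (S : IsSimpleSystem u h₀) {h : ι → ℝ} (hh : h ∈ typeCone u h₀) :
    (hpoly u h).Nonempty := by
  obtain ⟨x, hx⟩ := S.nonempty
  obtain ⟨y, hy, -⟩ := hh ∅ ⟨x, hx, by simp⟩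
  exact ⟨y, hy⟩

theorem volume_add_smul (S : IsSimpleSystem u h₀) [Fintype ι] {p : MvPolynomial ι ℝ}
    (hp : ∀ h ∈ interior (typeCone u h₀), MvPolynomial.eval h p = hvol u h) {x k : ι → ℝ}
    (hx : x ∈ interior (typeCone u h₀)) (hk : k ∈ interior (typeCone u h₀)) {s : ℝ} (hs : 0 ≤ s) :
    (volume (hpoly u x + s • hpoly u k)).toReal = MvPolynomial.eval (x + s • k) p := by
  rcases hs.eq_or_lt with rfl | hs
  · rw [Set.zero_smul_set (S.hpoly_nonempty (interior_subset hk)), add_zero, zero_smul, add_zero,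
      hp x hx]
    rfl
  · have hsk := smul_mem_interior_typeCone hk hs
    rw [← hpoly_smul u k hs, ← S.hpoly_add (interior_subset hx) (interior_subset hsk),
      hp _ (add_mem_interior_typeCone (interior_subset hx) hsk)]
    rfl

theorem exists_polynomial_volume_add_smul (S : IsSimpleSystem u h₀) [Fintype ι] {x k : ι → ℝ}
    (hx : x ∈ interior (typeCone u h₀)) (hk : k ∈ interior (typeCone u h₀)) :
    ∃ q : Polynomial ℝ, q.natDegree ≤ n ∧
      ∀ s : ℝ, 0 ≤ s → (volume (hpoly u x + s • hpoly u k)).toReal = q.eval s := by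
  classical
  obtain ⟨p, hom, hp⟩ := S.exists_volume_polynomial
  refine ⟨_, ?_, fun s hs => (S.volume_add_smul hp hx hk hs).trans (eval_aeval_line p x k s).symm⟩
  rw [← mul_one n]
  refine MvPolynomial.aeval_natDegree_le p hom.totalDegree_le _ fun i => ?_
  refine (Polynomial.natDegree_add_le _ _).trans (max_le (by simp) ?_)
  exact (Polynomial.natDegree_C_mul_le _ _).trans Polynomial.natDegree_X_le

theorem aniPer_hpoly (S : IsSimpleSystem u h₀) [Fintype ι] {p : MvPolynomial ι ℝ}
    (hp : ∀ h ∈ interior (typeCone u h₀), MvPolynomial.eval h p = hvol u h) {x k : ι → ℝ}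
    (hx : x ∈ interior (typeCone u h₀)) (hk : k ∈ interior (typeCone u h₀)) :
    aniPer (hpoly u x) (hpoly u k) = MvPolynomial.eval x (dirD k p) := by
  refine HasDerivWithinAt.derivWithin ?_ (uniqueDiffOn_Ici (0 : ℝ) 0 self_mem_Ici)
  have h1 := (hasDerivAt_eval_line p x k 0).hasDerivWithinAt (s := Ici 0)
  rw [zero_smul, add_zero] at h1
  exact h1.congr (fun s hs => S.volume_add_smul hp hx hk hs) (S.volume_add_smul hp hx hk le_rfl)

theorem aniPer_nonneg (S : IsSimpleSystem u h₀) [Fintype ι] (hn : 2 ≤ n) {x k : ι → ℝ}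
    (hx : x ∈ interior (typeCone u h₀)) (hk : k ∈ interior (typeCone u h₀)) :
    0 ≤ aniPer (hpoly u x) (hpoly u k) := by
  classical
  obtain ⟨p, hom, hp⟩ := S.exists_volume_polynomial
  have h0 : IsFace u h₀ ∅ := by
    obtain ⟨x, hx⟩ := S.nonempty
    exact ⟨x, hx, by simp⟩
  rw [S.aniPer_hpoly hp hx hk]
  have := (S.facePolynomials hom hp).eval_dirD_pos h0 (by rwa [facePoly_empty]) hn hk hx
  rw [facePoly_empty] at this
  exact this.le

theorem aniPer_mono (S : IsSimpleSystem u h₀) [Fintype ι] (hn : 2 ≤ n) {x y k : ι → ℝ}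
    (hx : x ∈ interior (typeCone u h₀)) (hy : y ∈ interior (typeCone u h₀))
    (hk : k ∈ interior (typeCone u h₀)) (hxy : x ≤ y) :
    aniPer (hpoly u x) (hpoly u k) ≤ aniPer (hpoly u y) (hpoly u k) := by
  classical
  obtain ⟨p, hom, hp⟩ := S.exists_volume_polynomial
  rw [S.aniPer_hpoly hp hx hk, S.aniPer_hpoly hp hy hk]
  have := (S.facePolynomials hom hp).eval_dirD_mono (by rwa [facePoly_empty]) hn
    (convex_typeCone u h₀).interior hk hx hy hxy
  rwa [facePoly_empty] at this

theorem rpow_aniPer_add_le (S : IsSimpleSystem u h₀) [Fintype ι] (hn : 2 ≤ n) {x y k : ι → ℝ}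
    (hx : x ∈ interior (typeCone u h₀)) (hy : y ∈ interior (typeCone u h₀))
    (hk : k ∈ interior (typeCone u h₀)) {a b : ℝ} (ha : 0 < a) (hb : 0 < b) (hab : a + b = 1) :
    a * aniPer (hpoly u x) (hpoly u k) ^ ((1 : ℝ) / ((n : ℝ) - 1)) +
        b * aniPer (hpoly u y) (hpoly u k) ^ ((1 : ℝ) / ((n : ℝ) - 1)) ≤
      aniPer (a • hpoly u x + b • hpoly u y) (hpoly u k) ^ ((1 : ℝ) / ((n : ℝ) - 1)) := by
  classical
  obtain ⟨p, hom, hp⟩ := S.exists_volume_polynomial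
  have h0 : IsFace u h₀ ∅ := by
    obtain ⟨x, hx⟩ := S.nonempty
    exact ⟨x, hx, by simp⟩
  have hax := smul_mem_interior_typeCone hx ha
  have hby := smul_mem_interior_typeCone hy hb
  rw [← hpoly_smul u x ha, ← hpoly_smul u y hb,
    ← S.hpoly_add (interior_subset hax) (interior_subset hby), S.aniPer_hpoly hp hx hk,
    S.aniPer_hpoly hp hy hk,
    S.aniPer_hpoly hp (add_mem_interior_typeCone (interior_subset hax) hby) hk]
  have := ((S.facePolynomials hom hp).rpow_eval_dirD_concaveOn h0 (by rwa [facePoly_empty]) hn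
    (convex_typeCone u h₀).interior hk).2 hx hy ha.le hb.le hab
  simpa only [facePoly_empty, smul_eq_mul] using this

end IsSimpleSystem

end Perimeter

/-! ### Outer approximation of convex bodies -/

section Limits

/-- `P` contains `C` and is contained in its closed `r`-neighbourhood. -/
def Surrounds {E : Type*} [PseudoEMetricSpace E] (r : ℝ) (C P : Set E) : Prop :=
  C ⊆ P ∧ P ⊆ Metric.cthickening r C

theorem Surrounds.mono {E : Type*} [PseudoEMetricSpace E] {r s : ℝ} {C P : Set E}
    (h : Surrounds r C P) (hrs : r ≤ s) : Surrounds s C P :=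
  ⟨h.1, h.2.trans (Metric.cthickening_mono hrs C)⟩

theorem Surrounds.smul_add_smul {E : Type*} [NormedAddCommGroup E] [NormedSpace ℝ E]
    {r : ℝ} (hr : 0 ≤ r) {C P K R : Set E} (hC : IsCompact C)
    (hK : IsCompact K) (hP : Surrounds r C P) (hR : Surrounds r K R) {a b : ℝ} (ha : 0 ≤ a)
    (hb : 0 ≤ b) : Surrounds ((a + b) * r) (a • C + b • K) (a • P + b • R) := by
  refine ⟨add_subset_add (smul_set_mono hP.1) (smul_set_mono hR.1), ?_⟩
  rw [← ((hC.smul a).add (hK.smul b)).add_closedBall_zero (by positivity)]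
  rw [Surrounds, ← hC.add_closedBall_zero hr] at hP
  rw [Surrounds, ← hK.add_closedBall_zero hr] at hR
  rintro _ ⟨_, ⟨x, hx, rfl⟩, _, ⟨y, hy, rfl⟩, rfl⟩
  obtain ⟨c, hc, d, hd, rfl⟩ := hP.2 hx
  obtain ⟨k, hk, e, he, rfl⟩ := hR.2 hy
  refine ⟨a • c + b • k, add_mem_add (smul_mem_smul_set hc) (smul_mem_smul_set hk),
    a • d + b • e, ?_, ?_⟩
  · rw [mem_closedBall_zero_iff] at hd he ⊢
    calc ‖a • d + b • e‖ ≤ ‖a • d‖ + ‖b • e‖ := norm_add_le _ _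
      _ = a * ‖d‖ + b * ‖e‖ := by
        rw [norm_smul, norm_smul, Real.norm_of_nonneg ha, Real.norm_of_nonneg hb]
      _ ≤ a * r + b * r := by gcongr
      _ = (a + b) * r := by ring
  · simp only [smul_add]
    abel

theorem tendsto_volume_of_surrounds {E : Type*} [MetricSpace E] [ProperSpace E]
    [MeasureSpace E] [OpensMeasurableSpace E] [IsFiniteMeasureOnCompacts (volume : Measure E)]
    {D : Set E} (hD : IsCompact D) {P : ℕ → Set E} {r : ℕ → ℝ}
    (hP : ∀ m, Surrounds (r m) D (P m)) (hr : Filter.Tendsto r Filter.atTop (nhds 0)) :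
    Filter.Tendsto (fun m => (volume (P m)).toReal) Filter.atTop (nhds (volume D).toReal) := by
  refine (ENNReal.tendsto_toReal hD.measure_lt_top.ne).comp ?_
  exact tendsto_of_tendsto_of_tendsto_of_le_of_le tendsto_const_nhds
    ((tendsto_measure_cthickening_of_isCompact hD).comp hr)
    (fun m => measure_mono (hP m).1) (fun m => measure_mono (hP m).2)

variable {n : ℕ}

theorem tendsto_volume_add_smul {C K : Set (EuclideanSpace ℝ (Fin n))} (hC : IsCompact C)
    (hK : IsCompact K) {P R : ℕ → Set (EuclideanSpace ℝ (Fin n))} {r : ℕ → ℝ} (hr0 : ∀ m, 0 ≤ r m)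
    (hP : ∀ m, Surrounds (r m) C (P m)) (hR : ∀ m, Surrounds (r m) K (R m))
    (hr : Filter.Tendsto r Filter.atTop (nhds 0)) {s : ℝ} (hs : 0 ≤ s) :
    Filter.Tendsto (fun m => (volume (P m + s • R m)).toReal) Filter.atTop
      (nhds (volume (C + s • K)).toReal) := by
  refine tendsto_volume_of_surrounds (r := fun m => (1 + s) * r m) (hC.add (hK.smul s))
    (fun m => ?_) ?_
  · simpa only [one_smul] using (hP m).smul_add_smul (hr0 m) hC hK (hR m) zero_le_one hs
  · simpa using hr.const_mul (1 + s)

/-- The polynomial of degree at most `n` with values `v` at `0, …, n`. -/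
def natInterpolate (n : ℕ) (v : ℕ → ℝ) : Polynomial ℝ :=
  Lagrange.interpolate (Finset.range (n + 1)) (fun i => (i : ℝ)) v

theorem eq_natInterpolate {q : Polynomial ℝ} (hq : q.natDegree ≤ n) :
    q = natInterpolate n fun i => q.eval (i : ℝ) := by
  refine Lagrange.eq_interpolate (Nat.cast_injective.injOn) ?_
  rw [Finset.card_range]
  exact (Polynomial.degree_le_of_natDegree_le hq).trans_lt (by exact_mod_cast n.lt_succ_self)

theorem tendsto_eval_natInterpolate {v : ℕ → ℕ → ℝ} {w : ℕ → ℝ}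
    (h : ∀ i, Filter.Tendsto (fun m => v m i) Filter.atTop (nhds (w i))) (s : ℝ) :
    Filter.Tendsto (fun m => (natInterpolate n (v m)).eval s) Filter.atTop
      (nhds ((natInterpolate n w).eval s)) := by
  simp only [natInterpolate, Lagrange.interpolate_apply, Polynomial.eval_finsetSum,
    Polynomial.eval_mul, Polynomial.eval_C]
  exact tendsto_finsetSum _ fun i _ => (h i).mul_const _

theorem tendsto_eval_derivative_natInterpolate {v : ℕ → ℕ → ℝ} {w : ℕ → ℝ}
    (h : ∀ i, Filter.Tendsto (fun m => v m i) Filter.atTop (nhds (w i))) (s : ℝ) :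
    Filter.Tendsto (fun m => (natInterpolate n (v m)).derivative.eval s) Filter.atTop
      (nhds ((natInterpolate n w).derivative.eval s)) := by
  simp only [natInterpolate, Lagrange.interpolate_apply, Polynomial.derivative_sum,
    Polynomial.derivative_C_mul, Polynomial.eval_finsetSum, Polynomial.eval_mul, Polynomial.eval_C]
  exact tendsto_finsetSum _ fun i _ => (h i).mul_const _

/-- Steiner's formula: the volume of `C + s K` is a polynomial in `s ≥ 0` of degree at most `n`. -/
theorem volume_add_smul_eq_natInterpolate {C K : Set (EuclideanSpace ℝ (Fin n))}
    (hC : IsCompact C) (hCc : Convex ℝ C) (hCn : C.Nonempty) (hK : IsCompact K)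
    (hKc : Convex ℝ K) (hKn : K.Nonempty) {s : ℝ} (hs : 0 ≤ s) :
    (volume (C + s • K)).toReal =
      (natInterpolate n fun i => (volume (C + (i : ℝ) • K)).toReal).eval s := by
  have key : ∀ m : ℕ, ∃ P R : Set (EuclideanSpace ℝ (Fin n)),
      Surrounds (1 / ((m : ℝ) + 1)) C P ∧ Surrounds (1 / ((m : ℝ) + 1)) K R ∧
      ∃ q : Polynomial ℝ, q.natDegree ≤ n ∧
        ∀ s : ℝ, 0 ≤ s → (volume (P + s • R)).toReal = q.eval s := by
    intro m
    obtain ⟨ι, hι, u, h₀, f, S, hf, hsub, hsup, -⟩ := exists_isSimpleSystem_approx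
      (C := ![C, K]) (by simp [Fin.forall_fin_two, hC, hK])
      (by simp [Fin.forall_fin_two, hCc, hKc]) (by simp [Fin.forall_fin_two, hCn, hKn])
      (Nat.one_div_pos_of_nat (α := ℝ) (n := m))
    exact ⟨_, _, ⟨hsub 0, hsup 0⟩, ⟨hsub 1, hsup 1⟩,
      S.exists_polynomial_volume_add_smul (hf 0) (hf 1)⟩
  choose P R hP hR q hq hqe using key
  have hlim : ∀ s : ℝ, 0 ≤ s → Filter.Tendsto (fun m => (q m).eval s) Filter.atTop
      (nhds (volume (C + s • K)).toReal) := fun s hs => by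
    simp only [← hqe _ s hs]
    exact tendsto_volume_add_smul hC hK (fun m => by positivity) hP hR
      tendsto_one_div_add_atTop_nhds_zero_nat hs
  refine tendsto_nhds_unique (hlim s hs) ?_
  have h1 := tendsto_eval_natInterpolate (n := n) (fun i : ℕ => hlim i i.cast_nonneg) s
  exact h1.congr fun m => by rw [← eq_natInterpolate (hq m)]

theorem aniPer_eq {C K : Set (EuclideanSpace ℝ (Fin n))}
    (hC : IsCompact C) (hCc : Convex ℝ C) (hCn : C.Nonempty) (hK : IsCompact K)
    (hKc : Convex ℝ K) (hKn : K.Nonempty) :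
    aniPer C K =
      (natInterpolate n fun i => (volume (C + (i : ℝ) • K)).toReal).derivative.eval 0 :=
  aniPer_eq_of_eqOn _ fun _ hs => volume_add_smul_eq_natInterpolate hC hCc hCn hK hKc hKn hs

theorem tendsto_aniPer {C K : Set (EuclideanSpace ℝ (Fin n))}
    (hC : IsCompact C) (hCc : Convex ℝ C) (hCn : C.Nonempty) (hK : IsCompact K)
    (hKc : Convex ℝ K) (hKn : K.Nonempty) {P R : ℕ → Set (EuclideanSpace ℝ (Fin n))}
    (hPc : ∀ m, IsCompact (P m) ∧ Convex ℝ (P m)) (hRc : ∀ m, IsCompact (R m) ∧ Convex ℝ (R m))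
    {r : ℕ → ℝ} (hr0 : ∀ m, 0 ≤ r m) (hP : ∀ m, Surrounds (r m) C (P m))
    (hR : ∀ m, Surrounds (r m) K (R m)) (hr : Filter.Tendsto r Filter.atTop (nhds 0)) :
    Filter.Tendsto (fun m => aniPer (P m) (R m)) Filter.atTop (nhds (aniPer C K)) := by
  rw [aniPer_eq hC hCc hCn hK hKc hKn]
  have h1 := tendsto_eval_derivative_natInterpolate (n := n)
    (fun i : ℕ => tendsto_volume_add_smul hC hK hr0 hP hR hr i.cast_nonneg) 0
  exact h1.congr fun m => (aniPer_eq (hPc m).1 (hPc m).2 (hCn.mono (hP m).1) (hRc m).1 (hRc m).2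
    (hKn.mono (hR m).1)).symm

theorem IsSimpleSystem.isCompact_convex {ι : Type*} [Fintype ι] {u : ι → EuclideanSpace ℝ (Fin n)}
    {h₀ : ι → ℝ} (S : IsSimpleSystem u h₀) (h : ι → ℝ) :
    IsCompact (hpoly u h) ∧ Convex ℝ (hpoly u h) :=
  ⟨S.isCompact h, convex_hpoly u h⟩

theorem aniPer_nonneg (hn : 2 ≤ n) {C K : Set (EuclideanSpace ℝ (Fin n))}
    (hC : IsCompact C) (hCc : Convex ℝ C) (hCn : C.Nonempty) (hK : IsCompact K)
    (hKc : Convex ℝ K) (hKn : K.Nonempty) : 0 ≤ aniPer C K := by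
  have key : ∀ m : ℕ, ∃ P R : Set (EuclideanSpace ℝ (Fin n)),
      (IsCompact P ∧ Convex ℝ P) ∧ (IsCompact R ∧ Convex ℝ R) ∧
      Surrounds (1 / ((m : ℝ) + 1)) C P ∧ Surrounds (1 / ((m : ℝ) + 1)) K R ∧
      0 ≤ aniPer P R := by
    intro m
    obtain ⟨ι, hι, u, h₀, f, S, hf, hsub, hsup, -⟩ := exists_isSimpleSystem_approx
      (C := ![C, K]) (by simp [Fin.forall_fin_two, hC, hK])
      (by simp [Fin.forall_fin_two, hCc, hKc]) (by simp [Fin.forall_fin_two, hCn, hKn])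
      (Nat.one_div_pos_of_nat (α := ℝ) (n := m))
    exact ⟨_, _, S.isCompact_convex _, S.isCompact_convex _, ⟨hsub 0, hsup 0⟩, ⟨hsub 1, hsup 1⟩,
      S.aniPer_nonneg hn (hf 0) (hf 1)⟩
  choose P R hPc hRc hP hR hle using key
  exact ge_of_tendsto' (tendsto_aniPer hC hCc hCn hK hKc hKn hPc hRc (fun m => by positivity) hP hR
    tendsto_one_div_add_atTop_nhds_zero_nat) hle

theorem aniPer_mono (hn : 2 ≤ n) {C D K : Set (EuclideanSpace ℝ (Fin n))} (hCD : C ⊆ D)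
    (hC : IsCompact C) (hCc : Convex ℝ C) (hCn : C.Nonempty) (hD : IsCompact D)
    (hDc : Convex ℝ D) (hK : IsCompact K) (hKc : Convex ℝ K) (hKn : K.Nonempty) :
    aniPer C K ≤ aniPer D K := by
  have hDn := hCn.mono hCD
  have key : ∀ m : ℕ, ∃ P Q R : Set (EuclideanSpace ℝ (Fin n)),
      (IsCompact P ∧ Convex ℝ P) ∧ (IsCompact Q ∧ Convex ℝ Q) ∧ (IsCompact R ∧ Convex ℝ R) ∧
      Surrounds (2 * (1 / ((m : ℝ) + 1))) C P ∧ Surrounds (2 * (1 / ((m : ℝ) + 1))) D Q ∧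
      Surrounds (2 * (1 / ((m : ℝ) + 1))) K R ∧ aniPer P R ≤ aniPer Q R := by
    intro m
    have hε := Nat.one_div_pos_of_nat (α := ℝ) (n := m)
    set ε := 1 / ((m : ℝ) + 1)
    obtain ⟨ι, hι, u, h₀, f, S, hf, hsub, hsup, hle⟩ := exists_isSimpleSystem_approx
      (C := ![C, Metric.cthickening ε D, K]) (by simp [Fin.forall_fin_succ, hC, hD.cthickening, hK])
      (by simp [Fin.forall_fin_succ, hCc, hDc.cthickening, hKc])
      (by simp [Fin.forall_fin_succ, hCn, hDn.mono (Metric.self_subset_cthickening D), hKn]) hε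
    have h2 : ε ≤ 2 * ε := by linarith
    refine ⟨_, _, _, S.isCompact_convex _, S.isCompact_convex _, S.isCompact_convex _,
      Surrounds.mono ⟨hsub 0, hsup 0⟩ h2, ⟨(Metric.self_subset_cthickening D).trans (hsub 1), ?_⟩,
      Surrounds.mono ⟨hsub 2, hsup 2⟩ h2, S.aniPer_mono hn (hf 0) (hf 1) (hf 2) (hle 0 1 ?_)⟩
    · refine (hsup 1).trans ((Metric.cthickening_cthickening_subset hε.le hε.le D).trans ?_)
      rw [two_mul]
    · exact Metric.cthickening_subset_of_subset ε hCD
  choose P Q R hPc hQc hRc hP hQ hR hle using key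
  have hr : Filter.Tendsto (fun m : ℕ => 2 * (1 / ((m : ℝ) + 1))) Filter.atTop (nhds 0) := by
    simpa using (tendsto_one_div_add_atTop_nhds_zero_nat (𝕜 := ℝ)).const_mul 2
  exact le_of_tendsto_of_tendsto'
    (tendsto_aniPer hC hCc hCn hK hKc hKn hPc hRc (fun m => by positivity) hP hR hr)
    (tendsto_aniPer hD hDc hDn hK hKc hKn hQc hRc (fun m => by positivity) hQ hR hr) hle

theorem rpow_aniPer_add_le (hn : 2 ≤ n) {C D K : Set (EuclideanSpace ℝ (Fin n))}
    (hC : IsCompact C) (hCc : Convex ℝ C) (hCn : C.Nonempty) (hD : IsCompact D)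
    (hDc : Convex ℝ D) (hDn : D.Nonempty) (hK : IsCompact K) (hKc : Convex ℝ K) (hKn : K.Nonempty)
    {a b : ℝ} (ha : 0 < a) (hb : 0 < b) (hab : a + b = 1) :
    a * aniPer C K ^ ((1 : ℝ) / ((n : ℝ) - 1)) + b * aniPer D K ^ ((1 : ℝ) / ((n : ℝ) - 1)) ≤
      aniPer (a • C + b • D) K ^ ((1 : ℝ) / ((n : ℝ) - 1)) := by
  have key : ∀ m : ℕ, ∃ P Q R : Set (EuclideanSpace ℝ (Fin n)),
      (IsCompact P ∧ Convex ℝ P) ∧ (IsCompact Q ∧ Convex ℝ Q) ∧ (IsCompact R ∧ Convex ℝ R) ∧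
      Surrounds (1 / ((m : ℝ) + 1)) C P ∧ Surrounds (1 / ((m : ℝ) + 1)) D Q ∧
      Surrounds (1 / ((m : ℝ) + 1)) K R ∧
      a * aniPer P R ^ ((1 : ℝ) / ((n : ℝ) - 1)) + b * aniPer Q R ^ ((1 : ℝ) / ((n : ℝ) - 1)) ≤
        aniPer (a • P + b • Q) R ^ ((1 : ℝ) / ((n : ℝ) - 1)) := by
    intro m
    obtain ⟨ι, hι, u, h₀, f, S, hf, hsub, hsup, -⟩ := exists_isSimpleSystem_approx
      (C := ![C, D, K]) (by simp [Fin.forall_fin_succ, hC, hD, hK])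
      (by simp [Fin.forall_fin_succ, hCc, hDc, hKc])
      (by simp [Fin.forall_fin_succ, hCn, hDn, hKn])
      (Nat.one_div_pos_of_nat (α := ℝ) (n := m))
    exact ⟨_, _, _, S.isCompact_convex _, S.isCompact_convex _, S.isCompact_convex _,
      ⟨hsub 0, hsup 0⟩, ⟨hsub 1, hsup 1⟩, ⟨hsub 2, hsup 2⟩,
      S.rpow_aniPer_add_le hn (hf 0) (hf 1) (hf 2) ha hb hab⟩
  choose P Q R hPc hQc hRc hP hQ hR hle using key
  have hr : Filter.Tendsto (fun m : ℕ => 1 / ((m : ℝ) + 1)) Filter.atTop (nhds 0) :=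
    tendsto_one_div_add_atTop_nhds_zero_nat
  have hr0 : ∀ m : ℕ, (0 : ℝ) ≤ 1 / ((m : ℝ) + 1) := fun m => by positivity
  have hn1 : (1 : ℝ) ≤ n := by exact_mod_cast one_le_two.trans hn
  have he : (0 : ℝ) ≤ 1 / ((n : ℝ) - 1) := one_div_nonneg.2 (sub_nonneg.2 hn1)
  have hsum : ∀ m : ℕ, Surrounds (1 / ((m : ℝ) + 1)) (a • C + b • D) (a • P m + b • Q m) :=
    fun m => by
      simpa only [hab, one_mul] using (hP m).smul_add_smul (hr0 m) hC hD (hQ m) ha.le hb.le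
  refine le_of_tendsto_of_tendsto' (((Filter.Tendsto.rpow_const
    (tendsto_aniPer hC hCc hCn hK hKc hKn hPc hRc hr0 hP hR hr) (Or.inr he)).const_mul a).add
    ((Filter.Tendsto.rpow_const
      (tendsto_aniPer hD hDc hDn hK hKc hKn hQc hRc hr0 hQ hR hr) (Or.inr he)).const_mul b))
    (Filter.Tendsto.rpow_const (tendsto_aniPer ((hC.smul a).add (hD.smul b))
      ((hCc.smul a).add (hDc.smul b)) (hCn.smul_set.add hDn.smul_set) hK hKc hKn
      (fun m => ⟨((hPc m).1.smul a).add ((hQc m).1.smul b),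
        ((hPc m).2.smul a).add ((hQc m).2.smul b)⟩) hRc hr0 hsum hR hr) (Or.inr he)) hle

end Limits

/-! ### Inner parallel bodies -/

section InnerParallel

variable {n : ℕ} {Ω K : Set (EuclideanSpace ℝ (Fin n))}

theorem innerPar_eq_iInter (Ω K : Set (EuclideanSpace ℝ (Fin n))) (l : ℝ) :
    innerPar Ω K l = ⋂ y ∈ K, (fun x => x + l • y) ⁻¹' Ω := by
  ext x
  simp [innerPar]

theorem isCompact_innerPar (hΩ : IsCompact Ω) (hK : K.Nonempty) (l : ℝ) :
    IsCompact (innerPar Ω K l) := by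
  obtain ⟨y, hy⟩ := hK
  have hcl : IsClosed (innerPar Ω K l) := by
    rw [innerPar_eq_iInter]
    exact isClosed_biInter fun y _ => hΩ.isClosed.preimage (by fun_prop)
  refine (hΩ.image (continuous_sub_right (l • y))).of_isClosed_subset hcl fun x hx => ?_
  exact ⟨x + l • y, hx y hy, add_sub_cancel_right _ _⟩

theorem smul_innerPar_add_subset (hΩ : Convex ℝ Ω) {a b : ℝ} (ha : 0 ≤ a) (hb : 0 ≤ b)
    (hab : a + b = 1) (l l' : ℝ) :
    a • innerPar Ω K l + b • innerPar Ω K l' ⊆ innerPar Ω K (a * l + b * l') := by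
  rintro _ ⟨_, ⟨x, hx, rfl⟩, _, ⟨x', hx', rfl⟩, rfl⟩ y hy
  convert hΩ (hx y hy) (hx' y hy) ha hb hab using 1
  module

theorem convex_innerPar (hΩ : Convex ℝ Ω) (l : ℝ) : Convex ℝ (innerPar Ω K l) := by
  intro x hx x' hx' a b ha hb hab
  have := smul_innerPar_add_subset (K := K) hΩ ha hb hab l l
    (add_mem_add (smul_mem_smul_set hx) (smul_mem_smul_set hx'))
  rwa [← add_mul, hab, one_mul] at this

theorem innerPar_nonempty (hΩ : IsCompact Ω) (hΩc : Convex ℝ Ω) (hΩn : Ω.Nonempty)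
    (hK : K.Nonempty) {l : ℝ} (hl : l ∈ Icc 0 (inrad Ω K)) : (innerPar Ω K l).Nonempty := by
  obtain ⟨ω, hω⟩ := hΩn
  have hω0 : ω ∈ innerPar Ω K 0 := fun y _ => by simpa using hω
  rcases hl.1.eq_or_lt with rfl | hl0
  · exact ⟨ω, hω0⟩
  have hr : 0 < inrad Ω K := hl0.trans_le hl.2
  set A : Set ℝ := {l : ℝ | 0 ≤ l ∧ ∃ x, ∀ y ∈ K, x + l • y ∈ Ω} with hA
  have hA0 : (0 : ℝ) ∈ A := ⟨le_rfl, ω, hω0⟩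
  have hAb : BddAbove A := by
    by_contra h
    exact hr.ne' (Real.sSup_of_not_bddAbove h)
  have hAc : IsCompact A := by
    obtain ⟨y, hy⟩ := hK
    obtain ⟨B, hB⟩ := hΩ.isBounded.exists_norm_le
    have hZ : IsCompact ((Icc 0 (inrad Ω K) ×ˢ Metric.closedBall 0 (B + inrad Ω K * ‖y‖)) ∩
        ⋂ y ∈ K, (fun z : ℝ × EuclideanSpace ℝ (Fin n) => z.2 + z.1 • y) ⁻¹' Ω) :=
      (isCompact_Icc.prod (isCompact_closedBall _ _)).inter_right
        (isClosed_biInter fun y _ => hΩ.isClosed.preimage (by fun_prop))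
    convert hZ.image continuous_fst
    ext a
    constructor
    · rintro ⟨ha, x, hx⟩
      have ha' : a ≤ inrad Ω K := le_csSup hAb ⟨ha, x, hx⟩
      refine ⟨(a, x), ⟨⟨⟨ha, ha'⟩, ?_⟩, by simpa using hx⟩, rfl⟩
      rw [mem_closedBall_zero_iff]
      calc ‖x‖ = ‖(x + a • y) - a • y‖ := by rw [add_sub_cancel_right]
        _ ≤ ‖x + a • y‖ + ‖a • y‖ := norm_sub_le _ _
        _ ≤ B + inrad Ω K * ‖y‖ := by
          rw [norm_smul, Real.norm_of_nonneg ha]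
          gcongr
          exact hB _ (hx y hy)
    · rintro ⟨⟨a, x⟩, ⟨⟨ha, -⟩, hx⟩, rfl⟩
      exact ⟨ha.1, x, by simpa using hx⟩
  obtain ⟨-, x, hx⟩ : inrad Ω K ∈ A := hAc.sSup_mem ⟨0, hA0⟩
  have hq : l / inrad Ω K ≤ 1 := (div_le_one hr).2 hl.2
  have := smul_innerPar_add_subset hΩc (div_nonneg hl0.le hr.le) (sub_nonneg.2 hq)
    (add_sub_cancel _ _) (inrad Ω K) 0 (add_mem_add (smul_mem_smul_set hx) (smul_mem_smul_set hω0))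
  rw [mul_zero, add_zero, div_mul_cancel₀ _ hr.ne'] at this
  exact ⟨_, this⟩

end InnerParallel

/-- `λ ↦ Per_K(Ω ∼ λK)^{1/(n-1)}` is concave on `[0, r(Ω,K)]`. -/
theorem stmt13 {n : ℕ} (hn : 2 ≤ n) (Ω K : Set (EuclideanSpace ℝ (Fin n)))
    (hΩc : IsCompact Ω) (hΩconv : Convex ℝ Ω) (hΩint : (interior Ω).Nonempty)
    (hKc : IsCompact K) (hKconv : Convex ℝ K) (hKint : (interior K).Nonempty) :
    ConcaveOn ℝ (Set.Icc 0 (inrad Ω K))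
      (fun l => aniPer (innerPar Ω K l) K ^ ((1:ℝ) / ((n : ℝ) - 1))) := by
  have hΩn := hΩint.mono interior_subset
  have hKn := hKint.mono interior_subset
  have hcpt := isCompact_innerPar hΩc hKn
  have hcvx := convex_innerPar (K := K) hΩconv
  have hn1 : (1 : ℝ) ≤ n := by exact_mod_cast one_le_two.trans hn
  refine concaveOn_iff_forall_pos.2 ⟨convex_Icc _ _, fun l hl l' hl' a b ha hb hab => ?_⟩
  have hne := innerPar_nonempty hΩc hΩconv hΩn hKn hl
  have hne' := innerPar_nonempty hΩc hΩconv hΩn hKn hl'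
  have hadd : IsCompact (a • innerPar Ω K l + b • innerPar Ω K l') :=
    ((hcpt l).smul a).add ((hcpt l').smul b)
  have hadd' : Convex ℝ (a • innerPar Ω K l + b • innerPar Ω K l') :=
    ((hcvx l).smul a).add ((hcvx l').smul b)
  have haddn : (a • innerPar Ω K l + b • innerPar Ω K l').Nonempty :=
    hne.smul_set.add hne'.smul_set
  refine (rpow_aniPer_add_le hn (hcpt l) (hcvx l) hne (hcpt l') (hcvx l') hne' hKc hKconv hKn
    ha hb hab).trans ?_
  exact Real.rpow_le_rpow (aniPer_nonneg hn hadd hadd' haddn hKc hKconv hKn)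
    (aniPer_mono hn (smul_innerPar_add_subset hΩconv ha.le hb.le hab l l') hadd hadd' haddn
      (hcpt _) (hcvx _) hKc hKconv hKn) (one_div_nonneg.2 (sub_nonneg.2 hn1))
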